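/- arXiv:2108.04513 — 4 statements merged into one kernel-verified Lean document; each statement's English description precedes it below -/
import Mathlib

section
/- Let H be a symmetric numerical semigroup minimally generated by four elements n_1, n_2, n_3, n_4 and let k be a field. Then the minimal number of generators of the defining ideal I_H is 3 or 5, i.e. μ(I_H) = 3 or μ(I_H) = 5. -/
/-- A numerical semigroup: a submonoid of `(ℕ, +)` with finite complement. -/
def IsNumericalSemigroup (H : Set ℕ) : Prop :=
  0 ∈ H ∧ (∀ a ∈ H, ∀ b ∈ H, a + b ∈ H) ∧ Hᶜ.Finite

/-- The set of pseudo-Frobenius numbers of `H`, as a subset of `ℤ`. -/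
def PF (H : Set ℕ) : Set ℤ :=
  {f | f ∉ ((Nat.cast : ℕ → ℤ) '' H) ∧
    ∀ h ∈ H, 0 < h → f + (h : ℤ) ∈ ((Nat.cast : ℕ → ℤ) '' H)}

/-- The minimal number of generators of an ideal. -/
noncomputable def muIdeal {R : Type*} [CommRing R] (I : Ideal R) : ℕ :=
  sInf {c : ℕ | ∃ s : Finset R, s.card = c ∧ Ideal.span (s : Set R) = I}

namespace Bresinsky

section

/-- The degree of a monomial with exponent vector `a` when `x_i` has degree `n i`. -/
def deg (n a : Fin 4 → ℕ) : ℤ := ∑ i, (a i : ℤ) * n i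

/-- `i, j, k, l` is a labelling of the four indices. -/
def Lab (i j k l : Fin 4) : Prop := i ≠ j ∧ i ≠ k ∧ i ≠ l ∧ j ≠ k ∧ j ≠ l ∧ k ≠ l

lemma Lab.cover {i j k l : Fin 4} (h : Lab i j k l) (t : Fin 4) :
    t = i ∨ t = j ∨ t = k ∨ t = l := by
  unfold Lab at h
  omega

lemma deg_lab {n a : Fin 4 → ℕ} {i j k l : Fin 4} (h : Lab i j k l) :
    deg n a = a i * n i + a j * n j + a k * n k + a l * n l := by
  have hu : (Finset.univ : Finset (Fin 4)) = {i, j, k, l} := by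
    ext t
    simpa using h.cover t
  obtain ⟨h1, h2, h3, h4, h5, h6⟩ := h
  rw [deg, hu, Finset.sum_insert, Finset.sum_insert, Finset.sum_insert, Finset.sum_singleton]
  · ring
  all_goals simp [*]

lemma deg_add (n a b : Fin 4 → ℕ) : deg n (a + b) = deg n a + deg n b := by
  simp [deg, Finset.sum_add_distrib, add_mul]

lemma deg_single (n : Fin 4 → ℕ) (i : Fin 4) (p : ℕ) :
    deg n (Pi.single i p) = p * n i := by
  rw [deg, Finset.sum_eq_single i]
  · simp
  · intro j _ hj
    simp [hj]
  · simp

lemma sub_add_single {a : Fin 4 → ℕ} {t : Fin 4} (h : 0 < a t) :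
    a - Pi.single t 1 + Pi.single t 1 = a := by
  ext u
  by_cases hu : u = t
  · subst hu
    simp only [Pi.add_apply, Pi.sub_apply, Pi.single_eq_same]
    omega
  · simp [hu]

lemma deg_sub_single (n : Fin 4 → ℕ) {a : Fin 4 → ℕ} {t : Fin 4} (h : 0 < a t) :
    deg n (a - Pi.single t 1) = deg n a - n t := by
  have h2 := congrArg (deg n) (sub_add_single h)
  rw [deg_add, deg_single] at h2
  push_cast at h2
  omega

lemma deg_eq_cast (n a : Fin 4 → ℕ) : deg n a = ((∑ i, a i * n i : ℕ) : ℤ) := by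
  simp [deg]

lemma eq_zero_of_deg {n : Fin 4 → ℕ} (hpos : ∀ i, 0 < n i) {a : Fin 4 → ℕ} (h : deg n a = 0) :
    a = 0 := by
  rw [deg_eq_cast] at h
  have h' : ∑ i, a i * n i = 0 := by exact_mod_cast h
  ext t
  rcases Nat.mul_eq_zero.1 (Finset.sum_eq_zero_iff.1 h' t (Finset.mem_univ _)) with h | h
  · exact h
  · exact absurd h (hpos t).ne'

lemma exists_vec {i j k l : Fin 4} (h : Lab i j k l) (p q r s : ℕ) :
    ∃ a : Fin 4 → ℕ, a i = p ∧ a j = q ∧ a k = r ∧ a l = s := by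
  obtain ⟨h1, h2, h3, h4, h5, h6⟩ := h
  exact ⟨fun t => if t = i then p else if t = j then q else if t = k then r else s,
    by simp, by simp [h1.symm], by simp [h2.symm, h4.symm], by simp [h3.symm, h5.symm, h6.symm]⟩

/-- `i` divides some monomial of degree `D`. -/
def V (n : Fin 4 → ℕ) (D : ℤ) (i : Fin 4) : Prop := ∃ a, deg n a = D ∧ 0 < a i

/-- `x_i x_j` divides some monomial of degree `D` (in the sense of supports). -/
def E (n : Fin 4 → ℕ) (D : ℤ) (i j : Fin 4) : Prop := ∃ a, deg n a = D ∧ 0 < a i ∧ 0 < a j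

/-- Three variables simultaneously divide some monomial of degree `D`. -/
def T (n : Fin 4 → ℕ) (D : ℤ) (i j k : Fin 4) : Prop :=
  ∃ a, deg n a = D ∧ 0 < a i ∧ 0 < a j ∧ 0 < a k

lemma E.symm {n : Fin 4 → ℕ} {D : ℤ} {i j : Fin 4} (h : E n D i j) : E n D j i := by
  obtain ⟨a, h1, h2, h3⟩ := h
  exact ⟨a, h1, h3, h2⟩

/-- The complexes of `D` and `D'` are Alexander dual to each other. -/
def Dual (n : Fin 4 → ℕ) (D D' : ℤ) : Prop :=
  ∀ i j k l, Lab i j k l →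
    (E n D i j ↔ ¬ E n D' k l) ∧ (T n D i j k ↔ ¬ V n D' l) ∧ (T n D' i j k ↔ ¬ V n D l)

/-- `α i` is the least positive integer such that `α i * n i` lies in the semigroup generated by
the other generators, and `m i` is a witness of this. -/
structure Ctx (n α : Fin 4 → ℕ) (m : Fin 4 → Fin 4 → ℕ) : Prop where
  pos : ∀ i, 0 < n i
  α_pos : ∀ i, 0 < α i
  m_self : ∀ i, m i i = 0
  deg_m : ∀ i, deg n (m i) = α i * n i
  least : ∀ a b i, deg n a = deg n b → b i < a i → (∀ j, j ≠ i → a j ≤ b j) → α i + b i ≤ a i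

section basic

variable {n α : Fin 4 → ℕ} {m : Fin 4 → Fin 4 → ℕ}

lemma Ctx.eq_of_le (hc : Ctx n α m) {a b : Fin 4 → ℕ} (h : deg n a = deg n b)
    (hle : ∀ t, b t ≤ a t) (t : Fin 4) : a t = b t := by
  by_contra hne
  have hlt : b t < a t := lt_of_le_of_ne (hle t) (Ne.symm hne)
  have : deg n b < deg n a := by
    unfold deg
    apply Finset.sum_lt_sum
    · intro i _
      have := hle i
      gcongr
    · refine ⟨t, Finset.mem_univ _, ?_⟩
      have := hc.pos t
      gcongr
  omega

lemma Ctx.least_lab (hc : Ctx n α m) {a b : Fin 4 → ℕ} {D : ℤ} {i j k l : Fin 4}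
    (hL : Lab i j k l) (ha : deg n a = D) (hb : deg n b = D) (hi : b i < a i) (hj : a j ≤ b j)
    (hk : a k ≤ b k) (hl : a l ≤ b l) : α i + b i ≤ a i := by
  refine hc.least a b i (ha.trans hb.symm) hi fun t ht => ?_
  rcases hL.cover t with rfl | rfl | rfl | rfl <;> first | exact absurd rfl ht | assumption

lemma Ctx.sub (hc : Ctx n α m) {a : Fin 4 → ℕ} {D : ℤ} {i : Fin 4} (ha : deg n a = D)
    (hi : α i ≤ a i) :
    ∃ a', deg n a' = D ∧ a' i = a i - α i ∧ ∀ j, j ≠ i → a' j = a j + m i j := by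
  refine ⟨fun t => if t = i then a i - α i else a t + m i t, ?_, by simp, ?_⟩
  · have h1 : (fun t => if t = i then a i - α i else a t + m i t) + Pi.single i (α i)
        = a + m i := by
      ext t
      by_cases ht : t = i
      · subst ht
        simp [hc.m_self]
        omega
      · simp [ht]
    have h2 := congrArg (deg n) h1
    rw [deg_add, deg_add, deg_single, hc.deg_m] at h2
    omega
  · intro j hj
    simp [hj]

lemma Ctx.exists_m_pos (hc : Ctx n α m) (i : Fin 4) : ∃ t, t ≠ i ∧ 0 < m i t := by
  by_contra! h
  have h0 : ∀ t, m i t = 0 := by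
    intro t
    by_cases ht : t = i
    · rw [ht, hc.m_self]
    · have := h t ht
      omega
  have h1 := hc.deg_m i
  have h2 : (0 : ℤ) < α i * n i := by
    have := hc.pos i
    have := hc.α_pos i
    positivity
  simp [deg, h0] at h1
  have := hc.pos i
  have := hc.α_pos i
  omega

lemma Ctx.isolated (hc : Ctx n α m) {a : Fin 4 → ℕ} {i : Fin 4} (ha : deg n a = α i * n i)
    (hi : 0 < a i) : a i = α i ∧ ∀ j, j ≠ i → a j = 0 := by
  have hs := deg_single n i (α i)
  by_cases hlt : a i < α i
  · have := hc.least (Pi.single i (α i)) a i (hs.trans ha.symm) (by simpa using hlt)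
      (by intro j hj; simp [hj])
    simp at this
    omega
  · have := hc.eq_of_le (ha.trans hs.symm) (by
      intro t
      by_cases ht : t = i
      · subst ht
        simp
        omega
      · simp [ht])
    refine ⟨by simpa using this i, fun j hj => ?_⟩
    simpa [hj] using this j

lemma Ctx.not_E (hc : Ctx n α m) {i j : Fin 4} (hij : i ≠ j) : ¬ E n (α i * n i) i j := by
  rintro ⟨a, ha, h1, h2⟩
  have := (hc.isolated ha h1).2 j hij.symm
  omega

lemma Ctx.V_self (hc : Ctx n α m) (i : Fin 4) : V n (α i * n i) i :=
  ⟨Pi.single i (α i), deg_single n i (α i), by simpa using hc.α_pos i⟩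

lemma Ctx.eq_of_isolated (hc : Ctx n α m) {D : ℤ} {i : Fin 4} {b : Fin 4 → ℕ} (hV : V n D i)
    (hb : deg n b = D) (hbi : b i = 0) (hE : ∀ j, j ≠ i → ¬ E n D i j) : D = α i * n i := by
  obtain ⟨a, ha, hai⟩ := hV
  have hz : ∀ c, deg n c = D → 0 < c i → ∀ j, j ≠ i → c j = 0 := by
    intro c hcD hci j hj
    by_contra h
    exact hE j hj ⟨c, hcD, hci, by omega⟩
  have h1 := hc.least a b i (ha.trans hb.symm) (by omega) (by
    intro j hj
    rw [hz a ha hai j hj]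
    omega)
  obtain ⟨a', ha', h2, h3⟩ := hc.sub ha (by omega : α i ≤ a i)
  obtain ⟨t, ht, htp⟩ := hc.exists_m_pos i
  have h4 : a i = α i := by
    by_contra hne
    have := hz a' ha' (by omega) t ht
    have := h3 t ht
    omega
  have h5 : a = Pi.single i (α i) := by
    ext j
    by_cases hj : j = i
    · subst hj
      simpa using h4
    · simp [hj, hz a ha hai j hj]
  rw [← ha, h5, deg_single]

end basic

/-- A two-colouring of the variables that separates the monomials of degree `D`
into two nonempty classes with disjoint supports. -/
def Split (n : Fin 4 → ℕ) (D : ℤ) (C : Fin 4 → Prop) : Prop :=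
  (∀ s t, E n D s t → (C s ↔ C t)) ∧ ∃ s t, V n D s ∧ V n D t ∧ ¬ (C s ↔ C t)

lemma Split.cases {n α : Fin 4 → ℕ} {m : Fin 4 → Fin 4 → ℕ} (hc : Ctx n α m) {D : ℤ}
    {C : Fin 4 → Prop} (h : Split n D C) :
    (∃ i, D = α i * n i ∧ ∀ j, j ≠ i → V n D j → ¬ (C i ↔ C j)) ∨
    ∃ i j k l, Lab i j k l ∧ (C i ↔ C j) ∧ (C k ↔ C l) ∧ ¬ (C i ↔ C k) ∧
      V n D i ∧ V n D j ∧ V n D k ∧ V n D l := by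
  obtain ⟨hE, s, t, hs, ht, hst⟩ := h
  have key : ∀ s t, V n D s → V n D t → ¬ (C s ↔ C t) →
      (∀ j, j ≠ s → V n D j → ¬ (C s ↔ C j)) → D = α s * n s := by
    intro s t hs ht hst h
    obtain ⟨b, hb, hbt⟩ := ht
    refine hc.eq_of_isolated hs hb ?_ ?_
    · by_contra h0
      exact hst (hE s t ⟨b, hb, by omega, hbt⟩)
    · intro j hj hEj
      have hV : V n D j := by
        obtain ⟨a, ha, _, h2⟩ := hEj
        exact ⟨a, ha, h2⟩
      exact h j hj hV (hE _ _ hEj)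
  by_cases h1 : ∀ j, j ≠ s → V n D j → ¬ (C s ↔ C j)
  · exact Or.inl ⟨s, key s t hs ht hst h1, h1⟩
  by_cases h2 : ∀ j, j ≠ t → V n D j → ¬ (C t ↔ C j)
  · exact Or.inl ⟨t, key t s ht hs (by tauto) h2, h2⟩
  push Not at h1 h2
  obtain ⟨j, hj, hVj, hCj⟩ := h1
  obtain ⟨l, hl, hVl, hCl⟩ := h2
  refine Or.inr ⟨s, j, t, l, ⟨hj.symm, ?_, ?_, ?_, ?_, hl.symm⟩, hCj, hCl, hst, hs, hVj, ht, hVl⟩ <;>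
    · rintro rfl
      tauto

lemma Split.eq_of_not_E {n α : Fin 4 → ℕ} {m : Fin 4 → Fin 4 → ℕ} (hc : Ctx n α m) {D : ℤ}
    {C : Fin 4 → Prop} (h : Split n D C) {i j k l : Fin 4} (hL : Lab i j k l) (hij : C i ↔ C j)
    (hkl : C k ↔ C l) (hik : ¬ (C i ↔ C k)) (hVi : V n D i) (hVk : V n D k)
    (hE : ¬ E n D i j) : D = α i * n i := by
  obtain ⟨b, hb, hbk⟩ := hVk
  refine hc.eq_of_isolated hVi hb ?_ ?_
  · by_contra h0
    exact hik (h.1 i k ⟨b, hb, by omega, hbk⟩)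
  · intro t ht hEt
    have := h.1 _ _ hEt
    rcases hL.cover t with rfl | rfl | rfl | rfl <;> tauto

/-- A relation containing all pairs of monomials with a common variable, if not total,
yields a splitting. -/
lemma exists_split {n : Fin 4 → ℕ} {D : ℤ} (R : (Fin 4 → ℕ) → (Fin 4 → ℕ) → Prop)
    (hsymm : ∀ a b, deg n a = D → deg n b = D → R a b → R b a)
    (htrans : ∀ a b c, deg n a = D → deg n b = D → deg n c = D → R a b → R b c → R a c)
    (hshare : ∀ a b t, deg n a = D → deg n b = D → 0 < a t → 0 < b t → R a b)
    {a b : Fin 4 → ℕ} (ha : deg n a = D) (hb : deg n b = D) (hab : ¬ R a b) (hD : D ≠ 0) :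
    ∃ C, Split n D C ∧ ∀ x y s t, deg n x = D → deg n y = D → R x y → 0 < x s → 0 < y t →
      (C s ↔ C t) := by
  have hpos : ∀ c, deg n c = D → ∃ t, 0 < c t := by
    intro c hcD
    by_contra! h
    apply hD
    rw [← hcD, deg]
    apply Finset.sum_eq_zero
    intro i _
    have := h i
    simp at this
    simp [this]
  set C : Fin 4 → Prop := fun t => ∃ c, deg n c = D ∧ R c a ∧ 0 < c t with hC
  have hmem : ∀ x s, deg n x = D → 0 < x s → (C s ↔ R x a) := by
    intro x s hx hs
    constructor
    · rintro ⟨c, hcD, hca, hcs⟩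
      exact htrans x c a hx hcD ha (hshare x c s hx hcD hs hcs) hca
    · intro h
      exact ⟨x, hx, h, hs⟩
  refine ⟨C, ⟨?_, ?_⟩, ?_⟩
  · rintro s t ⟨x, hx, hs, ht⟩
    rw [hmem x s hx hs, hmem x t hx ht]
  · obtain ⟨s, hs⟩ := hpos a ha
    obtain ⟨t, ht⟩ := hpos b hb
    refine ⟨s, t, ⟨a, ha, hs⟩, ⟨b, hb, ht⟩, ?_⟩
    rw [hmem a s ha hs, hmem b t hb ht]
    intro h
    exact hab (hsymm _ _ hb ha (h.1 (hshare a a s ha ha hs hs)))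
  · intro x y s t hx hy hxy hs ht
    rw [hmem x s hx hs, hmem y t hy ht]
    exact ⟨fun h => htrans _ _ _ hy hx ha (hsymm _ _ hx hy hxy) h,
      fun h => htrans _ _ _ hx hy ha hxy h⟩

end

section

/-- The dual complex restricted to edges is the 4-cycle `p, q, r, s`. -/
structure C4 (n : Fin 4 → ℕ) (d : ℤ) (p q r s : Fin 4) : Prop where
  lab : Lab p q r s
  pq : E n d p q
  qr : E n d q r
  rs : E n d r s
  sp : E n d s p
  pr : ¬ E n d p r
  qs : ¬ E n d q s

lemma Lab.rot {p q r s : Fin 4} (h : Lab p q r s) : Lab q r s p := by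
  unfold Lab at *
  tauto

lemma Lab.refl {p q r s : Fin 4} (h : Lab p q r s) : Lab p s r q := by
  unfold Lab at *
  tauto

lemma Lab.swap_left {p q r s : Fin 4} (h : Lab p q r s) : Lab q p r s := by
  unfold Lab at *
  tauto

lemma Lab.swap_right {p q r s : Fin 4} (h : Lab p q r s) : Lab p q s r := by
  unfold Lab at *
  tauto

lemma C4.rot {n : Fin 4 → ℕ} {d : ℤ} {p q r s : Fin 4} (h : C4 n d p q r s) : C4 n d q r s p :=
  ⟨h.lab.rot, h.qr, h.rs, h.sp, h.pq, h.qs, fun h' => h.pr h'.symm⟩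

lemma C4.refl {n : Fin 4 → ℕ} {d : ℤ} {p q r s : Fin 4} (h : C4 n d p q r s) : C4 n d p s r q :=
  ⟨h.lab.refl, h.sp.symm, h.rs.symm, h.qr.symm, h.pq.symm, h.pr, fun h' => h.qs h'.symm⟩

section pure

variable {n α : Fin 4 → ℕ} {m : Fin 4 → Fin 4 → ℕ}

lemma Ctx.exch (hc : Ctx n α m) {a : Fin 4 → ℕ} {D : ℤ} {i j : Fin 4} (ha : deg n a = D)
    (hi : α i ≤ a i) (hij : i ≠ j) (h : (α i * n i : ℤ) = α j * n j) :
    ∃ a', deg n a' = D ∧ a' i = a i - α i ∧ a' j = a j + α j ∧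
      ∀ t, t ≠ i → t ≠ j → a' t = a t := by
  have hc' : Ctx n α (Function.update m i (Pi.single j (α j))) := by
    refine ⟨hc.pos, hc.α_pos, ?_, ?_, hc.least⟩
    · intro t
      by_cases ht : t = i
      · subst ht
        simp [hij]
      · simp [ht, hc.m_self]
    · intro t
      by_cases ht : t = i
      · subst ht
        simp [deg_single, h]
      · simp [ht, hc.deg_m]
  obtain ⟨a', h1, h2, h3⟩ := hc'.sub ha hi
  refine ⟨a', h1, h2, ?_, ?_⟩
  · simpa using h3 j hij.symm
  · intro t ht ht'
    simpa [ht'] using h3 t ht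

lemma C4.pure_false (hc : Ctx n α m) {d : ℤ} {i j k l : Fin 4} (h : C4 n d i j k l)
    (hp : (α i * n i : ℤ) = α j * n j) : False := by
  have hL := h.lab
  obtain ⟨hij, hik, hil, hjk, hjl, hkl⟩ := h.lab
  obtain ⟨a, ha, hal, hai⟩ := h.sp
  obtain ⟨b, hb, hbk, hbl⟩ := h.rs
  obtain ⟨c, hcd, hcj, hck⟩ := h.qr
  have hz : ∀ x, deg n x = d → (x i = 0 ∨ x k = 0) ∧ (x j = 0 ∨ x l = 0) := by
    intro x hx
    have h1 := h.pr
    have h2 := h.qs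
    constructor
    · by_contra h0
      exact h1 ⟨x, hx, by omega, by omega⟩
    · by_contra h0
      exact h2 ⟨x, hx, by omega, by omega⟩
  have za := hz a ha
  have zb := hz b hb
  have zc := hz c hcd
  have hai' : a i < α i := by
    by_contra h0
    obtain ⟨x, hx, h1, h2, h3⟩ := hc.exch ha (by omega : α i ≤ a i) hij hp
    have := hz x hx
    have := h3 l hil.symm hjl.symm
    have := hc.α_pos j
    omega
  have hcj' : c j < α j := by
    by_contra h0
    obtain ⟨x, hx, h1, h2, h3⟩ := hc.exch hcd (by omega : α j ≤ c j) hij.symm hp.symm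
    have := hz x hx
    have := h3 k hjk.symm hik.symm
    have := hc.α_pos i
    omega
  have hab : b l < a l := by
    by_contra h0
    have := hc.least_lab hL ha hb (by omega) (by omega) (by omega) (by omega)
    omega
  have hcb : b k < c k := by
    by_contra h0
    have := hc.least_lab (i := j) (j := k) (k := l) (l := i) hL.rot hcd hb
      (by omega) (by omega) (by omega) (by omega)
    omega
  have hbk' : α k ≤ b k := by
    have := hc.least_lab (i := k) (j := l) (k := i) (l := j) hL.rot.rot hb ha
      (by omega) (by omega) (by omega) (by omega)
    omega
  obtain ⟨x, hx, hx1, hx2⟩ := hc.sub hcd (by omega : α k ≤ c k)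
  obtain ⟨y, hy, hy1, hy2⟩ := hc.sub hb hbk'
  have zx := hz x hx
  have zy := hz y hy
  have ex := hx2 j hjk
  have ex' := hx2 l hkl.symm
  have ey := hy2 l hkl.symm
  have ey' := hy2 j hjk
  have ey'' := hy2 i hik
  have hm := hc.deg_m k
  have hmi : α i ≤ m k i := by
    obtain ⟨t, ht, htp⟩ := hc.exists_m_pos k
    have hti : 0 < m k i := by
      rcases hL.cover t with rfl | rfl | rfl | rfl
      · exact htp
      · omega
      · exact absurd rfl ht
      · omega
    have hs := deg_single n k (α k)
    have := hc.least_lab hL hm hs (by simpa [hik] using hti) (by omega)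
      (by simp [hc.m_self]) (by omega)
    omega
  obtain ⟨z, hz', hz1, hz2, hz3⟩ := hc.exch hy (by omega : α i ≤ y i) hij hp
  have := hz z hz'
  have := hz3 l hil.symm hjl.symm
  have := hc.α_pos j
  omega

lemma Ctx.two_pos (hc : Ctx n α m) {i j k l : Fin 4} (hL : Lab i j k l)
    (hm : ∃ s t, s ≠ t ∧ 0 < m k s ∧ 0 < m k t) (h0 : m k j = 0) : 0 < m k i ∧ 0 < m k l := by
  obtain ⟨s, t, hst, hs, ht⟩ := hm
  have := hc.m_self k
  rcases hL.cover s with rfl | rfl | rfl | rfl <;> rcases hL.cover t with rfl | rfl | rfl | rfl <;>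
    first | exact absurd rfl hst | omega

lemma pure_pair_aux (hc : Ctx n α m) {d : ℤ} {i j k l : Fin 4} (hL : Lab i j k l)
    (hp : (α i * n i : ℤ) = α j * n j)
    (hmk : ∃ s t, s ≠ t ∧ 0 < m k s ∧ 0 < m k t) (hml : ∃ s t, s ≠ t ∧ 0 < m l s ∧ 0 < m l t)
    (hz : ∀ x, deg n x = d → (x i = 0 ∨ x j = 0) ∧ (x i = 0 ∨ x k = 0 ∨ x l = 0) ∧
      (x j = 0 ∨ x k = 0 ∨ x l = 0)) (hjk : E n d j k) (hjl : E n d j l)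
    {a : Fin 4 → ℕ} (ha : deg n a = d) (hai : 0 < a i) (hak : α k ≤ a k) : False := by
  obtain ⟨h1, h2, h3, h4, h5, h6⟩ := id hL
  have hαi := hc.α_pos i
  have hαj := hc.α_pos j
  have hαk := hc.α_pos k
  have hαl := hc.α_pos l
  obtain ⟨a', ha', ek, e2⟩ := hc.sub ha hak
  have ei := e2 i h2
  have ej := e2 j h4
  have el := e2 l h6.symm
  obtain ⟨aj, al⟩ : a j = 0 ∧ a l = 0 := by
    have := hz a ha
    omega
  obtain ⟨a'i, a'j, mkj⟩ : 0 < a' i ∧ a' j = 0 ∧ m k j = 0 := by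
    have := hz a' ha'
    omega
  obtain ⟨mki, mkl⟩ := hc.two_pos hL hmk mkj
  have a'k : a' k = 0 := by
    have := hz a' ha'
    omega
  obtain ⟨e, he, hej, hek⟩ := hjk
  obtain ⟨f, hf, hfj, hfl⟩ := hjl
  obtain ⟨ei0, el0⟩ : e i = 0 ∧ e l = 0 := by
    have := hz e he
    omega
  obtain ⟨fi0, fk0⟩ : f i = 0 ∧ f k = 0 := by
    have := hz f hf
    omega
  have hfl' : α l ≤ f l := by
    by_cases hle : e j ≤ f j
    · have hek' : α k ≤ e k := by
        have := hc.least_lab (i := k) (j := l) (k := i) (l := j) hL.rot.rot he hf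
          (by omega) (by omega) (by omega) (by omega)
        omega
      obtain ⟨e', he', -, g2⟩ := hc.sub he hek'
      have := g2 i h2
      have := g2 j h4
      have := (hz e' he').1
      omega
    · have := hc.least_lab (i := l) (j := i) (k := j) (l := k) hL.rot.rot.rot hf he
        (by omega) (by omega) (by omega) (by omega)
      omega
  obtain ⟨f', hf', fl, g2⟩ := hc.sub hf hfl'
  have fi := g2 i h3
  have fj := g2 j h5
  have fk := g2 k h6
  obtain ⟨f'i, f'j⟩ : f' i = 0 ∧ 0 < f' j := by
    have := (hz f' hf').1
    omega
  obtain ⟨mlj, mlk⟩ := hc.two_pos hL.swap_left.swap_right hml (by omega)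
  clear hmk hml
  have f'l : f' l = 0 := by
    have := (hz f' hf').2.2
    omega
  have hal : a' l < α l := by
    by_contra h0
    obtain ⟨x, hx, -, x2⟩ := hc.sub ha' (by omega : α l ≤ a' l)
    have := x2 i h3
    have := x2 j h5
    have := (hz x hx).1
    omega
  have hai' : α i ≤ a' i := by
    have := hc.least_lab hL ha' hf (by omega) (by omega) (by omega) (by omega)
    omega
  have hfk : f' k < α k := by
    by_contra h0
    obtain ⟨x, hx, -, x2⟩ := hc.sub hf' (by omega : α k ≤ f' k)
    have := x2 i h2
    have := x2 j h4
    have := (hz x hx).1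
    omega
  have hfj' : α j ≤ f' j := by
    have := hc.least_lab (i := j) (j := k) (k := l) (l := i) hL.rot hf' ha
      (by omega) (by omega) (by omega) (by omega)
    omega
  obtain ⟨x, hx, x1, x2, x3⟩ := hc.exch ha' hai' h1 hp
  have xk := x3 k h2.symm h4.symm
  have xl := x3 l h3.symm h5.symm
  have zx := (hz x hx).1
  obtain ⟨y, hy, y1, y2, y3⟩ := hc.exch hf' hfj' h1.symm hp.symm
  have zy := (hz y hy).1
  have := hc.least_lab (i := l) (j := i) (k := j) (l := k) hL.rot.rot.rot hx hf'
    (by omega) (by omega) (by omega) (by omega)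
  omega

/-- The dual of a splitting `i, j ∣ k, l` cannot exist if `α i * n i = α j * n j`,
unless `α k * n k = α l * n l` as well. -/
lemma pure_pair_false (hc : Ctx n α m) {d : ℤ} {i j k l : Fin 4} (hL : Lab i j k l)
    (hp : (α i * n i : ℤ) = α j * n j)
    (hmk : ∃ s t, s ≠ t ∧ 0 < m k s ∧ 0 < m k t) (hml : ∃ s t, s ≠ t ∧ 0 < m l s ∧ 0 < m l t)
    (hik : E n d i k) (hil : E n d i l) (hjk : E n d j k) (hjl : E n d j l)
    (hij : ¬ E n d i j) (hTi : ¬ T n d i k l) (hTj : ¬ T n d j k l) : False := by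
  have hz : ∀ x, deg n x = d → (x i = 0 ∨ x j = 0) ∧ (x i = 0 ∨ x k = 0 ∨ x l = 0) ∧
      (x j = 0 ∨ x k = 0 ∨ x l = 0) := by
    intro x hx
    refine ⟨?_, ?_, ?_⟩ <;> by_contra h0
    · exact hij ⟨x, hx, by omega, by omega⟩
    · exact hTi ⟨x, hx, by omega, by omega, by omega⟩
    · exact hTj ⟨x, hx, by omega, by omega, by omega⟩
  clear hij hTi hTj
  have hL' := hL.swap_right
  have hz' : ∀ x, deg n x = d → (x i = 0 ∨ x j = 0) ∧ (x i = 0 ∨ x l = 0 ∨ x k = 0) ∧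
      (x j = 0 ∨ x l = 0 ∨ x k = 0) := fun x hx =>
    ⟨(hz x hx).1, (hz x hx).2.1.imp_right Or.symm, (hz x hx).2.2.imp_right Or.symm⟩
  obtain ⟨a, ha, hai, hak⟩ := hik
  obtain ⟨b, hb, hbi, hbl⟩ := hil
  obtain ⟨aj, al⟩ : a j = 0 ∧ a l = 0 := by
    have := hz a ha
    omega
  obtain ⟨bj, bk⟩ : b j = 0 ∧ b k = 0 := by
    have := hz b hb
    omega
  rcases le_total (a i) (b i) with hle | hle
  · have := hc.least_lab (i := k) (j := l) (k := i) (l := j) hL.rot.rot ha hb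
      (by rwa [bk]) (by rw [al]; exact Nat.zero_le _) hle (by rw [aj]; exact Nat.zero_le _)
    exact pure_pair_aux hc hL hp hmk hml hz hjk hjl ha hai (by omega)
  · have := hc.least_lab (i := l) (j := i) (k := j) (l := k) hL.rot.rot.rot hb ha
      (by rwa [al]) hle (by rw [bj]; exact Nat.zero_le _) (by rw [bk]; exact Nat.zero_le _)
    exact pure_pair_aux hc hL' hp hml hmk hz' hjl hjk hb hbi (by omega)

/-- If `α i * n i = α j * n j` and `α k * n k = α l * n l`, the dual degree of a
splitting `i, j ∣ k, l` is determined. -/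
lemma pure_pure_eq (hc : Ctx n α m) {d : ℤ} {i j k l : Fin 4} (hL : Lab i j k l)
    (hp : (α i * n i : ℤ) = α j * n j) (hp' : (α k * n k : ℤ) = α l * n l)
    (hik : E n d i k) (hil : E n d i l) (hjk : E n d j k) (hjl : E n d j l)
    (hTi : ¬ T n d i k l) (hTj : ¬ T n d j k l) (hTk : ¬ T n d i j k) (hTl : ¬ T n d i j l) :
    d = α i * n i + α k * n k := by
  have hz : ∀ x, deg n x = d → (x i = 0 ∨ x k = 0 ∨ x l = 0) ∧
      (x j = 0 ∨ x k = 0 ∨ x l = 0) ∧ (x i = 0 ∨ x j = 0 ∨ x k = 0) ∧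
      (x i = 0 ∨ x j = 0 ∨ x l = 0) := by
    intro x hx
    refine ⟨?_, ?_, ?_, ?_⟩ <;> by_contra h0
    · exact hTi ⟨x, hx, by omega, by omega, by omega⟩
    · exact hTj ⟨x, hx, by omega, by omega, by omega⟩
    · exact hTk ⟨x, hx, by omega, by omega, by omega⟩
    · exact hTl ⟨x, hx, by omega, by omega, by omega⟩
  have key : ∀ {i j : Fin 4}, Lab i j k l → E n d i k → E n d i l →
      (∀ x, deg n x = d → (x i = 0 ∨ x k = 0 ∨ x l = 0) ∧
      (x j = 0 ∨ x k = 0 ∨ x l = 0) ∧ (x i = 0 ∨ x j = 0 ∨ x k = 0) ∧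
      (x i = 0 ∨ x j = 0 ∨ x l = 0)) →
      ∃ x, deg n x = d ∧ 0 < x i ∧ x j = 0 ∧ x k = α k ∧ x l = 0 := by
    intro i j hL hik hil hz
    obtain ⟨h1, h2, h3, h4, h5, h6⟩ := id hL
    obtain ⟨a, ha, hai, hak⟩ := hik
    obtain ⟨b, hb, hbi, hbl⟩ := hil
    have za := hz a ha
    have zb := hz b hb
    have hαk := hc.α_pos k
    have hαl := hc.α_pos l
    by_cases hle : a i ≤ b i
    · have := hc.least_lab (i := k) (j := l) (k := i) (l := j) hL.rot.rot ha hb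
        (by omega) (by omega) (by omega) (by omega)
      obtain ⟨x, hx, x1, x2, x3⟩ := hc.exch ha (by omega : α k ≤ a k) h6 hp'
      have := x3 i h2 h3
      have := hz x hx
      exact ⟨a, ha, hai, by omega, by omega, by omega⟩
    · have := hc.least_lab (i := l) (j := i) (k := j) (l := k) hL.rot.rot.rot hb ha
        (by omega) (by omega) (by omega) (by omega)
      obtain ⟨x, hx, x1, x2, x3⟩ := hc.exch hb (by omega : α l ≤ b l) h6.symm hp'.symm
      have := x3 i h3 h2
      have := x3 j h5 h4
      have := hz x hx
      exact ⟨x, hx, by omega, by omega, by omega, by omega⟩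
  have hL' := hL.swap_left
  obtain ⟨x, hx, x1, x2, x3, x4⟩ := key hL hik hil hz
  obtain ⟨y, hy, y1, y2, y3, y4⟩ := key hL' hjk hjl (by
    intro x hx
    have := hz x hx
    omega)
  have h := hc.least_lab hL hx hy (by omega) (by omega) (by omega) (by omega)
  obtain ⟨h1, h2, h3, h4, h5, h6⟩ := id hL
  obtain ⟨z, hz', z1, z2, z3⟩ := hc.exch hx (by omega : α i ≤ x i) h1 hp
  have := z3 k h2.symm h4.symm
  have := hc.α_pos j
  have := hc.α_pos k
  have := hz z hz'
  have hxi : x i = α i := by omega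
  rw [← hx, deg_lab hL, x2, x3, x4, hxi]
  simp

end pure

end

section

section algebra

open MvPolynomial

variable {k : Type*} [Field k] {n : Fin 4 → ℕ}

/-- The defining ideal of the monomial curve with exponents `n`. -/
noncomputable abbrev curveIdeal (k : Type*) [Field k] (n : Fin 4 → ℕ) :
    Ideal (MvPolynomial (Fin 4) k) :=
  RingHom.ker (MvPolynomial.aeval (fun i => (Polynomial.X : Polynomial k) ^ n i) :
    MvPolynomial (Fin 4) k →ₐ[k] Polynomial k)

/-- The monomial with exponent vector `a`. -/
noncomputable def mon (k : Type*) [Field k] (a : Fin 4 → ℕ) : MvPolynomial (Fin 4) k :=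
  monomial (Finsupp.equivFunOnFinite.symm a) 1

lemma aeval_mon (a : Fin 4 → ℕ) :
    MvPolynomial.aeval (fun i => (Polynomial.X : Polynomial k) ^ n i) (mon k a) =
      Polynomial.X ^ (∑ i, a i * n i) := by
  rw [mon, aeval_monomial, map_one, one_mul, Finsupp.prod_fintype _ _ (by simp)]
  simp only [Finsupp.equivFunOnFinite_symm_apply_apply, ← pow_mul]
  rw [Finset.prod_pow_eq_pow_sum]
  simp [mul_comm]

lemma mon_add (a b : Fin 4 → ℕ) : mon k (a + b) = mon k a * mon k b := by
  rw [mon, mon, mon, monomial_mul, one_mul]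
  congr 2
  ext t
  simp

lemma mon_single (t : Fin 4) : mon k (Pi.single t 1) = X t := by
  rw [mon, X]
  congr 1
  ext i
  simp

lemma sub_mem_curveIdeal {a b : Fin 4 → ℕ} (h : deg n a = deg n b) :
    mon k a - mon k b ∈ curveIdeal k n := by
  rw [deg_eq_cast, deg_eq_cast] at h
  rw [RingHom.mem_ker, map_sub, aeval_mon, aeval_mon, Nat.cast_injective h, sub_self]

lemma linearMap_ext_mon {M : Type*} [AddCommGroup M] [Module k M]
    {f g : MvPolynomial (Fin 4) k →ₗ[k] M} (h : ∀ a, f (mon k a) = g (mon k a)) : f = g := by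
  refine (basisMonomials (Fin 4) k).ext fun a => ?_
  have := h a
  simpa [mon] using this

lemma exists_linearMap {M : Type*} [AddCommGroup M] [Module k M] (w : (Fin 4 → ℕ) → M) :
    ∃ f : MvPolynomial (Fin 4) k →ₗ[k] M, ∀ a, f (mon k a) = w a := by
  refine ⟨(basisMonomials (Fin 4) k).constr k fun a => w a, fun a => ?_⟩
  have := (basisMonomials (Fin 4) k).constr_basis k (fun a => w a)
    (Finsupp.equivFunOnFinite.symm a)
  simpa [mon] using this

lemma exists_linearMap_poly {M : Type*} [AddCommGroup M] [Module k M] (w : ℕ → M) :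
    ∃ f : Polynomial k →ₗ[k] M, ∀ e, f (Polynomial.X ^ e) = w e := by
  refine ⟨(Polynomial.basisMonomials k).constr k w, fun e => ?_⟩
  have := (Polynomial.basisMonomials k).constr_basis k w e
  simpa [Polynomial.X_pow_eq_monomial] using this

lemma curveIdeal_le {J : Ideal (MvPolynomial (Fin 4) k)}
    (hJ : ∀ a b, deg n a = deg n b → mon k a - mon k b ∈ J) : curveIdeal k n ≤ J := by
  classical
  obtain ⟨f, hf⟩ := exists_linearMap_poly (k := k) (M := MvPolynomial (Fin 4) k ⧸ J)
    (fun e => if h : ∃ a : Fin 4 → ℕ, ∑ i, a i * n i = e then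
      Ideal.Quotient.mk J (mon k h.choose) else 0)
  have key : f ∘ₗ (MvPolynomial.aeval (fun i => (Polynomial.X : Polynomial k) ^ n i) :
      MvPolynomial (Fin 4) k →ₐ[k] Polynomial k).toLinearMap =
      (Ideal.Quotient.mkₐ k J).toLinearMap := by
    refine linearMap_ext_mon fun a => ?_
    have h : ∃ b : Fin 4 → ℕ, ∑ i, b i * n i = ∑ i, a i * n i := ⟨a, rfl⟩
    rw [LinearMap.comp_apply, AlgHom.toLinearMap_apply, aeval_mon, hf, dif_pos h,
      AlgHom.toLinearMap_apply, Ideal.Quotient.mkₐ_eq_mk, Ideal.Quotient.mk_eq_mk_iff_sub_mem]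
    apply hJ
    rw [deg_eq_cast, deg_eq_cast, h.choose_spec]
  intro g hg
  have h := LinearMap.congr_fun key g
  rw [LinearMap.comp_apply, AlgHom.toLinearMap_apply, (RingHom.mem_ker).1 hg, map_zero] at h
  exact Ideal.Quotient.eq_zero_iff_mem.1 h.symm

/-- Linear functionals detecting minimal generators: the sum of the coefficients of the
monomials of degree `D` whose support meets `C`. -/
lemma exists_functional {D : ℤ} {C : Fin 4 → Prop} (hE : ∀ s t, E n D s t → (C s ↔ C t)) :
    ∃ f : MvPolynomial (Fin 4) k →ₗ[k] k,
      (∀ a, deg n a = D → (∃ t, 0 < a t ∧ C t) → f (mon k a) = 1) ∧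
      (∀ a, ¬ (deg n a = D ∧ ∃ t, 0 < a t ∧ C t) → f (mon k a) = 0) ∧
      ∀ g ∈ curveIdeal k n, ∀ p, f (p * g) = constantCoeff p * f g := by
  classical
  obtain ⟨f, hf⟩ := exists_linearMap (k := k)
    (fun a => if deg n a = D ∧ ∃ t, 0 < a t ∧ C t then (1 : k) else 0)
  have hX : ∀ t, ∀ g ∈ curveIdeal k n, f (X t * g) = 0 := by
    intro t g hg
    obtain ⟨L, hL⟩ := exists_linearMap_poly (k := k)
      (fun e => if (e : ℤ) + n t = D ∧ C t then (1 : k) else 0)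
    have key : f ∘ₗ LinearMap.mulLeft k (X t) = L ∘ₗ (MvPolynomial.aeval
        (fun i => (Polynomial.X : Polynomial k) ^ n i) :
        MvPolynomial (Fin 4) k →ₐ[k] Polynomial k).toLinearMap := by
      refine linearMap_ext_mon fun a => ?_
      rw [LinearMap.comp_apply, LinearMap.comp_apply, LinearMap.mulLeft_apply, ← mon_single,
        ← mon_add, hf, AlgHom.toLinearMap_apply, aeval_mon, hL, ← deg_eq_cast]
      have hd : deg n (Pi.single t 1 + a) = deg n a + n t := by
        rw [deg_add, deg_single]
        push_cast
        ring
      rw [hd]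
      congr 1
      simp only [eq_iff_iff]
      refine and_congr_right fun h => ⟨?_, fun h' => ⟨t, by simp, h'⟩⟩
      rintro ⟨u, hu, hC⟩
      exact (hE u t ⟨_, hd.trans h, hu, by simp⟩).1 hC
    have h := LinearMap.congr_fun key g
    rw [LinearMap.comp_apply, LinearMap.mulLeft_apply, LinearMap.comp_apply,
      AlgHom.toLinearMap_apply, (RingHom.mem_ker).1 hg, map_zero] at h
    exact h
  refine ⟨f, fun a h1 h2 => by rw [hf, if_pos ⟨h1, h2⟩], fun a h => by rw [hf, if_neg h], ?_⟩
  intro g hg p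
  induction p using MvPolynomial.induction_on with
  | C a => rw [C_mul', map_smul, constantCoeff_C, smul_eq_mul]
  | add p q hp hq => rw [add_mul, map_add, hp, hq, map_add, add_mul]
  | mul_X p t _ =>
    rw [mul_comm p, mul_assoc, hX t _ (Ideal.mul_mem_left _ p hg)]
    simp

lemma card_le_of_span {ι : Type*} [Fintype ι] [DecidableEq ι] {I : Ideal (MvPolynomial (Fin 4) k)}
    (f : ι → MvPolynomial (Fin 4) k) (φ : ι → MvPolynomial (Fin 4) k →ₗ[k] k)
    (hf : ∀ r, f r ∈ I) (hφ : ∀ r s, φ r (f s) = if r = s then 1 else 0)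
    (hmul : ∀ r, ∀ g ∈ I, ∀ p, φ r (p * g) = constantCoeff p * φ r g)
    {s : Finset (MvPolynomial (Fin 4) k)} (hs : Ideal.span (s : Set _) = I) :
    Fintype.card ι ≤ s.card := by
  classical
  set Φ : MvPolynomial (Fin 4) k →ₗ[k] (ι → k) := LinearMap.pi φ with hΦ
  have hmem : ∀ g ∈ I, Φ g ∈ Submodule.span k ((s.image Φ : Finset (ι → k)) : Set (ι → k)) := by
    intro g hg
    rw [← hs] at hg
    refine Submodule.span_induction (p := fun g _ =>
      Φ g ∈ Submodule.span k ((s.image Φ : Finset (ι → k)) : Set (ι → k))) ?_ ?_ ?_ ?_ hg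
    · intro x hx
      apply Submodule.subset_span
      simp only [Finset.coe_image]
      exact ⟨x, hx, rfl⟩
    · rw [map_zero]
      exact zero_mem _
    · intro x y _ _ hx hy
      rw [map_add]
      exact add_mem hx hy
    · intro p x hx h
      have : Φ (p • x) = constantCoeff p • Φ x := by
        ext r
        simpa [hΦ] using hmul r x (hs ▸ hx) p
      rw [this]
      exact Submodule.smul_mem _ _ h
  have htop : Submodule.span k ((s.image Φ : Finset (ι → k)) : Set (ι → k)) = ⊤ := by
    rw [eq_top_iff, ← (Pi.basisFun k ι).span_eq, Submodule.span_le]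
    rintro _ ⟨r, rfl⟩
    have : Pi.basisFun k ι r = Φ (f r) := by
      ext t
      simp [hΦ, hφ, Pi.single_apply, eq_comm]
    rw [this]
    exact hmem _ (hf r)
  have h1 := finrank_span_finset_le_card (R := k) (s.image Φ)
  rw [Set.finrank, htop, finrank_top, Module.finrank_fintype_fun_eq_card] at h1
  exact h1.trans Finset.card_image_le

lemma curveIdeal_eq_span (hpos : ∀ i, 0 < n i) {ι : Type*} (D : ι → ℤ) (a b : ι → Fin 4 → ℕ)
    (ha : ∀ r, deg n (a r) = D r) (hb : ∀ r, deg n (b r) = D r)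
    (hsplit : ∀ d C, Split n d C →
      ∃ r, D r = d ∧ ∃ t u, 0 < a r t ∧ 0 < b r u ∧ ¬ (C t ↔ C u)) :
    Ideal.span (Set.range fun r => mon k (a r) - mon k (b r)) = curveIdeal k n := by
  set J := Ideal.span (Set.range fun r => mon k (a r) - mon k (b r)) with hJ
  apply le_antisymm
  · rw [hJ, Ideal.span_le]
    rintro _ ⟨r, rfl⟩
    exact sub_mem_curveIdeal ((ha r).trans (hb r).symm)
  apply curveIdeal_le
  have main : ∀ N : ℕ, ∀ x y, deg n x = N → deg n y = N → mon k x - mon k y ∈ J := by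
    intro N
    induction N using Nat.strong_induction_on with
    | _ N ih =>
    intro x y hx hy
    have hshare : ∀ x y t, deg n x = N → deg n y = N → 0 < x t → 0 < y t →
        mon k x - mon k y ∈ J := by
      intro x y t hx hy hxt hyt
      have hd : ∀ z : Fin 4 → ℕ, 0 < z t → deg n z = N →
          deg n (z - Pi.single t 1) = ((N - n t : ℕ) : ℤ) ∧ N - n t < N := by
        intro z hz hzN
        have h1 := deg_sub_single n hz
        have h2 := deg_eq_cast n (z - Pi.single t 1)
        have := hpos t
        omega
      obtain ⟨h1, hN⟩ := hd x hxt hx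
      have h3 := ih _ hN _ _ h1 (hd y hyt hy).1
      rw [← sub_add_single hxt, ← sub_add_single hyt, mon_add, mon_add, ← sub_mul]
      exact Ideal.mul_mem_right _ _ h3
    by_contra hxy
    by_cases hN : N = 0
    · have hz : ∀ z, deg n z = N → z = 0 := fun z hz => eq_zero_of_deg hpos (by simpa [hN] using hz)
      rw [hz x hx, hz y hy, sub_self] at hxy
      exact hxy (zero_mem _)
    obtain ⟨C, hC, hR⟩ := exists_split (D := N) (fun x y => mon k x - mon k y ∈ J)
      (fun x y _ _ h => by
        have := neg_mem h
        rwa [neg_sub] at this)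
      (fun x y z _ _ _ h h' => by
        have := add_mem h h'
        rwa [sub_add_sub_cancel] at this)
      hshare hx hy hxy (by exact_mod_cast hN)
    obtain ⟨r, hr, t, u, ht, hu, htu⟩ := hsplit _ _ hC
    exact htu (hR (a r) (b r) t u ((ha r).trans hr) ((hb r).trans hr)
      (Ideal.subset_span ⟨r, rfl⟩) ht hu)
  intro x y hxy
  exact main (∑ i, y i * n i) x y (hxy.trans (deg_eq_cast n y)) (deg_eq_cast n y)

/-- A criterion for a family of binomials to be a minimal generating set of the ideal of a
monomial curve. -/
theorem muIdeal_curveIdeal (hpos : ∀ i, 0 < n i) {ι : Type*} [Fintype ι] (D : ι → ℤ)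
    (a b : ι → Fin 4 → ℕ) (C : ι → Fin 4 → Prop)
    (ha : ∀ r, deg n (a r) = D r) (hb : ∀ r, deg n (b r) = D r)
    (hE : ∀ r s t, E n (D r) s t → (C r s ↔ C r t))
    (haC : ∀ r, ∃ t, 0 < a r t ∧ C r t) (hbC : ∀ r, ¬ ∃ t, 0 < b r t ∧ C r t)
    (hdisj : ∀ r s, r ≠ s → D r = D s →
      ((∃ t, 0 < a s t ∧ C r t) ↔ ∃ t, 0 < b s t ∧ C r t))
    (hsplit : ∀ d C', Split n d C' →
      ∃ r, D r = d ∧ ∃ t u, 0 < a r t ∧ 0 < b r u ∧ ¬ (C' t ↔ C' u)) :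
    muIdeal (curveIdeal k n) = Fintype.card ι := by
  classical
  have hspan := curveIdeal_eq_span (k := k) hpos D a b ha hb hsplit
  choose φ h1 h0 hmul using fun r => exists_functional (k := k) (hE r)
  have hφ : ∀ r s, φ r (mon k (a s) - mon k (b s)) = if r = s then 1 else 0 := by
    intro r s
    rw [map_sub]
    by_cases hrs : r = s
    · subst hrs
      rw [h1 r _ (ha r) (haC r), h0 r _ fun h => hbC r h.2, if_pos rfl, sub_zero]
    rw [if_neg hrs]
    by_cases hD : D r = D s
    · by_cases hC : ∃ t, 0 < a s t ∧ C r t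
      · rw [h1 r _ ((ha s).trans hD.symm) hC,
          h1 r _ ((hb s).trans hD.symm) ((hdisj r s hrs hD).1 hC), sub_self]
      · rw [h0 r _ fun h => hC h.2, h0 r _ fun h => hC ((hdisj r s hrs hD).2 h.2), sub_self]
    · rw [h0 r _ fun h => hD (h.1.symm.trans (ha s)), h0 r _ fun h => hD (h.1.symm.trans (hb s)),
        sub_self]
  apply le_antisymm
  · refine le_trans (Nat.sInf_le ⟨Finset.univ.image fun r => mon k (a r) - mon k (b r), rfl, ?_⟩)
      Finset.card_image_le
    rw [Finset.coe_image, Finset.coe_univ, Set.image_univ, hspan]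
  · refine le_csInf ⟨_, Finset.univ.image fun r => mon k (a r) - mon k (b r), rfl, ?_⟩ ?_
    · rw [Finset.coe_image, Finset.coe_univ, Set.image_univ, hspan]
    rintro _ ⟨s, rfl, hs⟩
    exact card_le_of_span _ φ (fun r => sub_mem_curveIdeal ((ha r).trans (hb r).symm)) hφ hmul hs

end algebra

end

section

section setup

variable {n : Fin 4 → ℕ}

lemma pos_of_minimal {H : Set ℕ} (hgen : H = {m | ∃ a : Fin 4 → ℕ, m = ∑ i, a i * n i})
    (hmin : ∀ j : Fin 4, {m | ∃ a : Fin 4 → ℕ, a j = 0 ∧ m = ∑ i, a i * n i} ≠ H) (i : Fin 4) :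
    0 < n i := by
  by_contra h
  have h0 : n i = 0 := by omega
  apply hmin i
  rw [hgen]
  ext x
  constructor
  · rintro ⟨a, -, h⟩
    exact ⟨a, h⟩
  · rintro ⟨a, h⟩
    refine ⟨Function.update a i 0, by simp, ?_⟩
    rw [h]
    refine Finset.sum_congr rfl fun j _ => ?_
    by_cases hj : j = i
    · subst hj
      simp [h0]
    · simp [hj]

lemma exists_deg_iff {H : Set ℕ} (hgen : H = {m | ∃ a : Fin 4 → ℕ, m = ∑ i, a i * n i}) (z : ℤ) :
    z ∈ ((Nat.cast : ℕ → ℤ) '' H) ↔ ∃ a, deg n a = z := by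
  subst hgen
  constructor
  · rintro ⟨_, ⟨a, rfl⟩, rfl⟩
    exact ⟨a, deg_eq_cast n a⟩
  · rintro ⟨a, rfl⟩
    exact ⟨_, ⟨a, rfl⟩, (deg_eq_cast n a).symm⟩

/-- In a symmetric numerical semigroup, `z ↦ F - z` exchanges elements and gaps. -/
lemma exists_frobenius_symm {H : Set ℕ} (hH : IsNumericalSemigroup H)
    (hsym : (PF H).ncard = 1) :
    ∃ F : ℤ, ∀ z, z ∈ ((Nat.cast : ℕ → ℤ) '' H) ↔ F - z ∉ ((Nat.cast : ℕ → ℤ) '' H) := by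
  obtain ⟨h0, hadd, hfin⟩ := hH
  obtain ⟨F, hF⟩ := Set.ncard_eq_one.1 hsym
  have hFm : F ∈ PF H := by
    rw [hF]
    rfl
  refine ⟨F, fun z => ⟨?_, ?_⟩⟩
  · rintro ⟨x, hx, rfl⟩ ⟨y, hy, hxy⟩
    apply hFm.1
    refine ⟨x + y, hadd x hx y hy, ?_⟩
    push_cast
    omega
  · contrapose!
    intro hz
    obtain ⟨B, hB⟩ := hfin.bddAbove
    have hB' : ∀ x : ℕ, B < x → x ∈ H := by
      intro x hx
      by_contra h
      have := hB h
      omega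
    set S : Set ℕ := {h | h ∈ H ∧ z + h ∉ ((Nat.cast : ℕ → ℤ) '' H)} with hS
    have hSfin : S.Finite := by
      refine (Set.finite_Iic (B - z).toNat).subset ?_
      rintro h ⟨-, hh⟩
      rw [Set.mem_Iic]
      by_contra hlt
      apply hh
      exact ⟨(z + h).toNat, hB' _ (by omega), by omega⟩
    obtain ⟨h, ⟨hhH, hh⟩, hmax⟩ := hSfin.exists_maximal ⟨0, h0, by simpa using hz⟩
    have hPF : z + h ∈ PF H := by
      refine ⟨hh, fun x hx hx0 => ?_⟩
      by_contra hn
      have hmem : h + x ∈ S := ⟨hadd h hhH x hx, by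
        push_cast
        rwa [← add_assoc]⟩
      have := hmax hmem (by simp)
      simp at this
      omega
    rw [hF, Set.mem_singleton_iff] at hPF
    exact ⟨h, hhH, by omega⟩

lemma V_iff {D : ℤ} {i : Fin 4} : V n D i ↔ ∃ a, deg n a = D - n i := by
  constructor
  · rintro ⟨a, ha, hi⟩
    refine ⟨a - Pi.single i 1, ?_⟩
    rw [deg_sub_single n hi, ha]
  · rintro ⟨a, ha⟩
    refine ⟨a + Pi.single i 1, ?_, by simp⟩
    rw [deg_add, deg_single, ha]
    push_cast
    ring

lemma E_iff {D : ℤ} {i j : Fin 4} (hij : i ≠ j) : E n D i j ↔ V n (D - n i) j := by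
  constructor
  · rintro ⟨a, ha, hi, hj⟩
    refine ⟨a - Pi.single i 1, ?_, by simpa [hij.symm] using hj⟩
    rw [deg_sub_single n hi, ha]
  · rintro ⟨a, ha, hj⟩
    refine ⟨a + Pi.single i 1, ?_, by simp, by simp [hj]⟩
    rw [deg_add, deg_single, ha]
    push_cast
    ring

lemma T_iff {D : ℤ} {i j k : Fin 4} (hij : i ≠ j) (hik : i ≠ k) :
    T n D i j k ↔ E n (D - n i) j k := by
  constructor
  · rintro ⟨a, ha, hi, hj, hk⟩
    refine ⟨a - Pi.single i 1, ?_, by simpa [hij.symm] using hj, by simpa [hik.symm] using hk⟩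
    rw [deg_sub_single n hi, ha]
  · rintro ⟨a, ha, hj, hk⟩
    refine ⟨a + Pi.single i 1, ?_, by simp, by simp [hj], by simp [hk]⟩
    rw [deg_add, deg_single, ha]
    push_cast
    ring

lemma dual_of_symm {F : ℤ} (hF : ∀ z, (∃ a, deg n a = z) ↔ ¬ ∃ a, deg n a = F - z) (D : ℤ) :
    Dual n D (F + deg n 1 - D) := by
  intro i j k l hL
  have hsum : deg n 1 = n i + n j + n k + n l := by
    simpa using deg_lab (n := n) (a := 1) hL
  obtain ⟨hij, hik, hil, hjk, hjl, hkl⟩ := hL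
  refine ⟨?_, ?_, ?_⟩
  · rw [E_iff hij, V_iff, E_iff hkl, V_iff, hF]
    have : F - (D - n i - n j) = F + deg n 1 - D - n k - n l := by
      rw [hsum]
      ring
    rw [this]
  · rw [T_iff hij hik, E_iff hjk, V_iff, V_iff, hF]
    have : F - (D - n i - n j - n k) = F + deg n 1 - D - n l := by
      rw [hsum]
      ring
    rw [this]
  · rw [T_iff hij hik, E_iff hjk, V_iff, V_iff, hF]
    have : F - (F + deg n 1 - D - n i - n j - n k) = D - n l := by
      rw [hsum]
      ring
    rw [this]

lemma exists_ctx (hpos : ∀ i, 0 < n i) : ∃ α m, Ctx n α m := by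
  classical
  have hex : ∀ i, ∃ r, 0 < r ∧ ∃ a : Fin 4 → ℕ, a i = 0 ∧ deg n a = (r : ℕ) * n i := by
    intro i
    obtain ⟨j, hj⟩ := exists_ne i
    refine ⟨n j, hpos j, Pi.single j (n i), by simp [hj.symm], ?_⟩
    rw [deg_single, mul_comm]
  choose hα m hm using fun i => Nat.find_spec (hex i)
  refine ⟨fun i => Nat.find (hex i), m, hpos, hα, fun i => (hm i).1, fun i => (hm i).2, ?_⟩
  intro a b i hab hi hle
  have : Nat.find (hex i) ≤ a i - b i := by
    refine Nat.find_min' _ ⟨by omega, b - a, by simp; omega, ?_⟩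
    have h1 : b + Pi.single i (a i - b i) = (b - a) + a := by
      ext t
      by_cases ht : t = i
      · subst ht
        simp
        omega
      · have := hle t ht
        simp [ht]
        omega
    have h2 := congrArg (deg n) h1
    rw [deg_add, deg_add, deg_single, hab] at h2
    linarith
  omega

end setup

end

section

variable {n α : Fin 4 → ℕ} {m : Fin 4 → Fin 4 → ℕ}

/-- A splitting in which all variables occur and both colours are used twice. -/
structure Split2 (n : Fin 4 → ℕ) (D : ℤ) (C : Fin 4 → Prop) : Prop where
  E_color : ∀ s t, E n D s t → (C s ↔ C t)
  V_all : ∀ t, V n D t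
  two : ∀ i j k l, Lab i j k l → (C i ↔ C j) → (C k ↔ C l) ∧ ¬ (C i ↔ C k)

lemma Split.cases' (hc : Ctx n α m) {D : ℤ} {C : Fin 4 → Prop} (h : Split n D C) :
    (∃ i, D = α i * n i ∧ ∀ j, j ≠ i → V n D j → ¬ (C i ↔ C j)) ∨ Split2 n D C := by
  rcases h.cases hc with h1 | ⟨p, q, r, s, hL, hpq, hrs, hpr, hp, hq, hr, hs⟩
  · exact Or.inl h1
  · refine Or.inr ⟨h.1, fun t => ?_, fun i j k l hL' hij => ?_⟩
    · rcases hL.cover t with rfl | rfl | rfl | rfl <;> assumption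
    · classical
      have h1 := deg_lab (n := 1) (a := fun t => if C t then 1 else 0) hL
      have h2 := deg_lab (n := 1) (a := fun t => if C t then 1 else 0) hL'
      rw [h1] at h2
      by_cases h3 : C p <;> by_cases h4 : C r <;> by_cases h5 : C i <;> by_cases h6 : C k <;>
        by_cases h7 : C l <;> simp_all

lemma exists_lab {i k : Fin 4} (h : i ≠ k) : ∃ j l, Lab i j k l := by
  unfold Lab
  revert i k
  decide

lemma Split2.exists_lab {D : ℤ} {C : Fin 4 → Prop} (h : Split2 n D C) {i k : Fin 4}
    (hik : ¬ (C i ↔ C k)) : ∃ j l, Lab i j k l ∧ (C i ↔ C j) ∧ (C k ↔ C l) := by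
  have hne : i ≠ k := by
    rintro rfl
    exact hik Iff.rfl
  obtain ⟨j, l, hL⟩ := Bresinsky.exists_lab hne
  by_cases hij : C i ↔ C j
  · exact ⟨j, l, hL, hij, (h.two _ _ _ _ hL hij).1⟩
  · have h1 := h.two i l k j hL.refl
    have h2 := h.two j k i l (hL.swap_left.rot.swap_left.rot.rot.rot) (by tauto)
    exact ⟨l, j, hL.refl, by tauto, by tauto⟩

/-- The dual of a splitting `i, j ∣ k, l` has all edges `ik, il, jk, jl` and no triangles. -/
lemma Split2.dual_edge {D d : ℤ} {C : Fin 4 → Prop} (h : Split2 n D C) (hd : Dual n D d)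
    {i k : Fin 4} (hik : ¬ (C i ↔ C k)) : E n d i k := by
  obtain ⟨j, l, hL, hij, hkl⟩ := h.exists_lab hik
  by_contra hE
  have hL' : Lab j l i k := by
    unfold Lab at *
    tauto
  have := h.E_color j l ((hd j l i k hL').1.2 hE)
  tauto

lemma Split2.dual_not_T {D d : ℤ} {C : Fin 4 → Prop} (h : Split2 n D C) (hd : Dual n D d)
    {i j k : Fin 4} (hij : i ≠ j) (hik : i ≠ k) (hjk : j ≠ k) : ¬ T n d i j k := by
  obtain ⟨l, hl⟩ : ∃ l, Lab i j k l := by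
    unfold Lab
    revert i j k
    decide
  intro hT
  exact (hd i j k l hl).2.2.1 hT (h.V_all l)

lemma Split2.dual_C4 {D d : ℤ} {C : Fin 4 → Prop} (h : Split2 n D C) (hd : Dual n D d)
    {i j k l : Fin 4} (hL : Lab i j k l) (hij : C i ↔ C j) (hEij : E n D i j)
    (hEkl : E n D k l) : C4 n d i k j l := by
  obtain ⟨hkl, hik⟩ := h.two _ _ _ _ hL hij
  refine ⟨hL.rot.swap_left.rot.rot.rot, h.dual_edge hd hik, h.dual_edge hd (by tauto),
    h.dual_edge hd (by tauto), h.dual_edge hd (by tauto), ?_, (hd i j k l hL).1.1 hEij⟩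
  exact (hd k l i j hL.rot.rot).1.1 hEkl

lemma Split2.eq_of_not_E (hc : Ctx n α m) {D : ℤ} {C : Fin 4 → Prop} (h : Split2 n D C)
    {i j k l : Fin 4} (hL : Lab i j k l) (hij : C i ↔ C j) (hE : ¬ E n D i j) :
    D = α i * n i ∧ D = α j * n j := by
  obtain ⟨hkl, hik⟩ := h.two _ _ _ _ hL hij
  have hS : Split n D C := ⟨h.E_color, i, k, h.V_all i, h.V_all k, hik⟩
  exact ⟨hS.eq_of_not_E hc hL hij hkl hik (h.V_all i) (h.V_all k) hE,
    hS.eq_of_not_E hc hL.swap_left hij.symm hkl (by tauto) (h.V_all j) (h.V_all k)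
      fun h => hE h.symm⟩

lemma Split2.eq_of_pure (hc : Ctx n α m) {D d : ℤ} {C : Fin 4 → Prop} (h : Split2 n D C)
    (hd : Dual n D d) {i k : Fin 4} (hik : ¬ (C i ↔ C k)) (hp : (α i * n i : ℤ) = α k * n k) :
    D = α i * n i := by
  obtain ⟨j, l, hL, hij, hkl⟩ := h.exists_lab hik
  by_cases hEij : E n D i j
  · by_cases hEkl : E n D k l
    · exact ((h.dual_C4 hd hL hij hEij hEkl).pure_false hc hp).elim
    · exact ((h.eq_of_not_E hc hL.rot.rot hkl hEkl).1.trans hp.symm)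
  · exact (h.eq_of_not_E hc hL hij hEij).1

lemma Ctx.E_color (hc : Ctx n α m) {D : ℤ} (i : Fin 4) (hD : D = α i * n i) {s t : Fin 4}
    (h : E n D s t) : s = i ↔ t = i := by
  subst hD
  by_contra h0
  by_cases hs : s = i
  · subst hs
    exact hc.not_E (by tauto) h
  · have ht : t = i := by tauto
    subst ht
    exact hc.not_E (Ne.symm hs) h.symm

lemma V_of_eq (hc : Ctx n α m) {D : ℤ} {i : Fin 4} (h : D = α i * n i) : V n D i :=
  h ▸ hc.V_self i

section counts

lemma forall_fin_three {P : Fin 3 → Prop} (h0 : P 0) (h1 : P 1) (h2 : P 2) : ∀ r, P r := by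
  intro r
  fin_cases r <;> assumption

lemma meets_single {C : Fin 4 → Prop} {i : Fin 4} {p : ℕ} (hp : 0 < p) :
    (∃ t, 0 < (Pi.single i p : Fin 4 → ℕ) t ∧ C t) ↔ C i := by
  constructor
  · rintro ⟨t, ht, hC⟩
    by_cases h : t = i
    · exact h ▸ hC
    · simp [h] at ht
  · intro h
    exact ⟨i, by simpa using hp, h⟩

lemma meets_eq {a : Fin 4 → ℕ} {i : Fin 4} : (∃ t, 0 < a t ∧ t = i) ↔ 0 < a i := by
  simp

variable {k : Type*} [Field k] {c : ℤ}

lemma muIdeal_three_equal (hc : Ctx n α m) (hd : ∀ D, Dual n D (c - D)) {p q r s : Fin 4}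
    (hL : Lab p q r s) (hp : (α p * n p : ℤ) = α r * n r) (hq : (α q * n q : ℤ) = α r * n r)
    (hs : (α s * n s : ℤ) ≠ α r * n r) : muIdeal (curveIdeal k n) = 3 := by
  obtain ⟨h1, h2, h3, h4, h5, h6⟩ := id hL
  have hα := hc.α_pos
  refine muIdeal_curveIdeal hc.pos (ι := Fin 3) ![α p * n p, α q * n q, α s * n s]
    ![Pi.single p (α p), Pi.single q (α q), Pi.single s (α s)]
    ![Pi.single r (α r), Pi.single r (α r), m s] ![(· = p), (· = q), (· = s)] ?_ ?_ ?_ ?_ ?_ ?_ ?_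
  · exact forall_fin_three (deg_single _ _ _) (deg_single _ _ _) (deg_single _ _ _)
  · exact forall_fin_three ((deg_single _ _ _).trans hp.symm) ((deg_single _ _ _).trans hq.symm)
      (hc.deg_m s)
  · exact forall_fin_three (fun _ _ => hc.E_color _ rfl) (fun _ _ => hc.E_color _ rfl)
      fun _ _ => hc.E_color _ rfl
  · exact forall_fin_three ((meets_single (hα p)).2 rfl) ((meets_single (hα q)).2 rfl)
      ((meets_single (hα s)).2 rfl)
  · refine forall_fin_three ((meets_single (hα r)).not.2 h2.symm)
      ((meets_single (hα r)).not.2 h4.symm) (meets_eq.not.2 ?_)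
    exact (hc.m_self s).not_gt
  · refine forall_fin_three (forall_fin_three ?_ ?_ ?_) (forall_fin_three ?_ ?_ ?_)
      (forall_fin_three ?_ ?_ ?_) <;> intro hrs hD
    · exact absurd rfl hrs
    · exact iff_of_false ((meets_single (hα q)).not.2 h1.symm) ((meets_single (hα r)).not.2 h2.symm)
    · exact absurd (hD.symm.trans hp) hs
    · exact iff_of_false ((meets_single (hα p)).not.2 h1) ((meets_single (hα r)).not.2 h4.symm)
    · exact absurd rfl hrs
    · exact absurd (hD.symm.trans hq) hs
    · exact absurd (hD.trans hp) hs
    · exact absurd (hD.trans hq) hs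
    · exact absurd rfl hrs
  · intro d C hC
    have key : ∀ t, ¬ (C t ↔ C r) → t = p ∨ t = q → d = α r * n r →
        ∃ x : Fin 3, (![α p * n p, α q * n q, α s * n s] : Fin 3 → ℤ) x = d ∧
        ∃ t u, 0 < (![Pi.single p (α p), Pi.single q (α q), Pi.single s (α s)] :
          Fin 3 → Fin 4 → ℕ) x t ∧ 0 < (![Pi.single r (α r), Pi.single r (α r), m s] :
          Fin 3 → Fin 4 → ℕ) x u ∧ ¬ (C t ↔ C u) := by
      rintro t htr (rfl | rfl) hdr
      · exact ⟨0, hp.trans hdr.symm, t, r, by simpa using hα t, by simpa using hα r, htr⟩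
      · exact ⟨1, hq.trans hdr.symm, t, r, by simpa using hα t, by simpa using hα r, htr⟩
    have hVp : d = α r * n r → V n d p := fun h => V_of_eq hc (h.trans hp.symm)
    have hVr : d = α r * n r → V n d r := fun h => V_of_eq hc h
    rcases hC.cases' hc with ⟨i, hi, hiV⟩ | h2
    · rcases hL.cover i with rfl | rfl | rfl | rfl
      · exact key i (hiV r h2.symm (hVr (hi.trans hp))) (Or.inl rfl) (hi.trans hp)
      · exact key i (hiV r h4.symm (hVr (hi.trans hq))) (Or.inr rfl) (hi.trans hq)
      · refine key p ?_ (Or.inl rfl) hi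
        have := hiV p h2 (hVp hi)
        tauto
      · obtain ⟨u, hu, hmu⟩ := hc.exists_m_pos i
        exact ⟨2, hi.symm, i, u, by simpa using hα i, hmu,
          hiV u hu ⟨m i, (hc.deg_m i).trans hi.symm, hmu⟩⟩
    · by_cases hpr : C p ↔ C r
      · have hqr : ¬ (C q ↔ C r) := by
          have := h2.two p r q s (by unfold Lab at *; tauto) hpr
          tauto
        exact key q hqr (Or.inr rfl) ((h2.eq_of_pure hc (hd d) hqr hq).trans hq)
      · exact key p hpr (Or.inl rfl) ((h2.eq_of_pure hc (hd d) hpr hp).trans hp)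

lemma muIdeal_two_equal (hc : Ctx n α m) (hd : ∀ D, Dual n D (c - D)) {p q r s : Fin 4}
    (hL : Lab p q r s) (hp : (α p * n p : ℤ) = α q * n q) (hpr : (α p * n p : ℤ) ≠ α r * n r)
    (hps : (α p * n p : ℤ) ≠ α s * n s) (hrs : (α r * n r : ℤ) ≠ α s * n s)
    (hmr : ∃ i j, i ≠ j ∧ 0 < m r i ∧ 0 < m r j) (hms : ∃ i j, i ≠ j ∧ 0 < m s i ∧ 0 < m s j) :
    muIdeal (curveIdeal k n) = 3 := by
  obtain ⟨h1, h2, h3, h4, h5, h6⟩ := id hL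
  have hα := hc.α_pos
  refine muIdeal_curveIdeal hc.pos (ι := Fin 3) ![α p * n p, α r * n r, α s * n s]
    ![Pi.single p (α p), Pi.single r (α r), Pi.single s (α s)]
    ![Pi.single q (α q), m r, m s] ![(· = p), (· = r), (· = s)] ?_ ?_ ?_ ?_ ?_ ?_ ?_
  · exact forall_fin_three (deg_single _ _ _) (deg_single _ _ _) (deg_single _ _ _)
  · exact forall_fin_three ((deg_single _ _ _).trans hp.symm) (hc.deg_m r) (hc.deg_m s)
  · exact forall_fin_three (fun _ _ => hc.E_color _ rfl) (fun _ _ => hc.E_color _ rfl)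
      fun _ _ => hc.E_color _ rfl
  · exact forall_fin_three ((meets_single (hα p)).2 rfl) ((meets_single (hα r)).2 rfl)
      ((meets_single (hα s)).2 rfl)
  · exact forall_fin_three ((meets_single (hα q)).not.2 h1.symm)
      (meets_eq.not.2 (hc.m_self r).not_gt) (meets_eq.not.2 (hc.m_self s).not_gt)
  · refine forall_fin_three (forall_fin_three ?_ ?_ ?_) (forall_fin_three ?_ ?_ ?_)
      (forall_fin_three ?_ ?_ ?_) <;> intro hne hD
    · exact absurd rfl hne
    · exact absurd hD hpr
    · exact absurd hD hps
    · exact absurd hD.symm hpr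
    · exact absurd rfl hne
    · exact absurd hD hrs
    · exact absurd hD.symm hps
    · exact absurd hD.symm hrs
    · exact absurd rfl hne
  · intro d C hC
    rcases hC.cases' hc with ⟨i, hi, hiV⟩ | h2
    · obtain ⟨u, hu, hmu⟩ := hc.exists_m_pos i
      have hum := hiV u hu ⟨m i, (hc.deg_m i).trans hi.symm, hmu⟩
      rcases hL.cover i with rfl | rfl | rfl | rfl
      · exact ⟨0, hi.symm, i, q, by simpa using hα i, by simpa using hα q,
          hiV q h1.symm (V_of_eq hc (hi.trans hp))⟩
      · refine ⟨0, hp.trans hi.symm, p, i, by simpa using hα p, by simpa using hα i, ?_⟩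
        have := hiV p h1 (V_of_eq hc (hi.trans hp.symm))
        tauto
      · exact ⟨1, hi.symm, i, u, by simpa using hα i, hmu, hum⟩
      · exact ⟨2, hi.symm, i, u, by simpa using hα i, hmu, hum⟩
    · by_cases hpq : C p ↔ C q
      · obtain ⟨hrs', hpr'⟩ := h2.two _ _ _ _ hL hpq
        have hE : E n d r s := by
          by_contra h0
          obtain ⟨e1, e2⟩ := h2.eq_of_not_E hc hL.rot.rot hrs' h0
          exact hrs (e1.symm.trans e2)
        exact (pure_pair_false hc hL hp hmr hms (h2.dual_edge (hd d) hpr')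
          (h2.dual_edge (hd d) (by tauto)) (h2.dual_edge (hd d) (by tauto))
          (h2.dual_edge (hd d) (by tauto))
          (fun h' => (hd d r s p q hL.rot.rot).1.1 hE h')
          (h2.dual_not_T (hd d) (by assumption) h3 h6) (h2.dual_not_T (hd d) h4 h5 h6)).elim
      · exact ⟨0, (h2.eq_of_pure hc (hd d) hpq hp).symm, p, q, by simpa using hα p,
          by simpa using hα q, hpq⟩

end counts

end

section

variable {n α : Fin 4 → ℕ} {m : Fin 4 → Fin 4 → ℕ} {c : ℤ}

/-- There is a degree whose monomials are separated by the part of the degree carried by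
two of the variables. -/
lemma exists_split_weight (hpos : ∀ i, 0 < n i) {i j k l : Fin 4} (hL : Lab i j k l) :
    ∃ D C, Split n D C ∧ ∀ x y s t, deg n x = D → deg n y = D →
      x i * n i + x j * n j = y i * n i + y j * n j → 0 < x s → 0 < y t → (C s ↔ C t) := by
  classical
  obtain ⟨h1, h2, h3, h4, h5, h6⟩ := id hL
  have hex : ∃ N : ℕ, ∃ x y : Fin 4 → ℕ, deg n x = N ∧ deg n y = N ∧
      x i * n i + x j * n j ≠ y i * n i + y j * n j := by
    refine ⟨n i * n k, Pi.single i (n k), Pi.single k (n i), ?_, ?_, ?_⟩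
    · rw [deg_single]
      push_cast
      ring
    · rw [deg_single]
      push_cast
      ring
    · have := hpos i
      have := hpos k
      simp [h1.symm, h2, h4]
      omega
  obtain ⟨x, y, hx, hy, hxy⟩ := Nat.find_spec hex
  refine ⟨(Nat.find hex : ℤ), exists_split
    (fun x y => x i * n i + x j * n j = y i * n i + y j * n j)
    (fun a b _ _ h => h.symm) (fun a b c _ _ _ h h' => h.trans h') ?_ hx hy hxy ?_⟩
  · intro a b t ha hb hat hbt
    by_contra hab
    have da := deg_sub_single n hat
    have db := deg_sub_single n hbt
    have ea := fun u => congrFun (sub_add_single hat) u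
    have eb := fun u => congrFun (sub_add_single hbt) u
    have hcast := deg_eq_cast n (a - Pi.single t 1)
    refine Nat.find_min hex (m := ∑ u, (a - Pi.single t 1 : Fin 4 → ℕ) u * n u) ?_
      ⟨a - Pi.single t 1, b - Pi.single t 1, hcast, ?_, ?_⟩
    · have := hpos t
      omega
    · omega
    · have e1 := ea i
      have e2 := ea j
      have e3 := eb i
      have e4 := eb j
      simp only [Pi.add_apply] at e1 e2 e3 e4
      rw [← e1, ← e2, ← e3, ← e4] at hab
      intro h
      apply hab
      linarith
  · intro h0
    rw [h0] at hx hy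
    rw [eq_zero_of_deg hpos hx, eq_zero_of_deg hpos hy] at hxy
    exact hxy rfl

lemma exists_split2_pair (hc : Ctx n α m) (hd : ∀ D, Dual n D (c - D)) {i j k l : Fin 4}
    (hL : Lab i j k l) (hp : (α i * n i : ℤ) = α j * n j) (hp' : (α k * n k : ℤ) = α l * n l) :
    ∃ D C, Split2 n D C ∧ (C i ↔ C j) := by
  obtain ⟨h1, h2, h3, h4, h5, h6⟩ := id hL
  obtain ⟨D, C, hS, hC⟩ := exists_split_weight hc.pos hL
  have hα := hc.α_pos
  have key : ∀ s t, (α s * n s : ℤ) = α t * n t →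
      ((Pi.single s (α s) : Fin 4 → ℕ) i * n i + (Pi.single s (α s) : Fin 4 → ℕ) j * n j =
        (Pi.single t (α t) : Fin 4 → ℕ) i * n i + (Pi.single t (α t) : Fin 4 → ℕ) j * n j) →
      D = α s * n s → (C s ↔ C t) := by
    intro s t hst hu hD
    refine hC _ _ s t ((deg_single _ _ _).trans hD.symm)
      ((deg_single _ _ _).trans (hst.symm.trans hD.symm)) hu ?_ ?_
    · simpa using hα s
    · simpa using hα t
  have hij : D = α i * n i → (C i ↔ C j) := by
    refine key i j hp ?_
    have : α i * n i = α j * n j := by exact_mod_cast hp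
    simpa [h1, h1.symm] using this
  have hkl : D = α k * n k → (C k ↔ C l) := by
    refine key k l hp' ?_
    simp [h2, h3, h4, h5]
  rcases hS.cases' hc with ⟨t, ht, hV⟩ | hS2
  · rcases hL.cover t with rfl | rfl | rfl | rfl
    · exact (hV j h1.symm (V_of_eq hc (ht.trans hp)) (hij ht)).elim
    · exact (hV i h1 (V_of_eq hc (ht.trans hp.symm)) (hij (ht.trans hp.symm)).symm).elim
    · exact (hV l h6.symm (V_of_eq hc (ht.trans hp')) (hkl ht)).elim
    · exact (hV k h6 (V_of_eq hc (ht.trans hp'.symm)) (hkl (ht.trans hp'.symm)).symm).elim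
  · refine ⟨D, C, hS2, ?_⟩
    by_contra hne
    exact hne (hij (hS2.eq_of_pure hc (hd D) hne hp))

lemma Split2.dual_eq (hc : Ctx n α m) {D d : ℤ} {C : Fin 4 → Prop} (h : Split2 n D C)
    (hd : Dual n D d) {i j k l : Fin 4} (hL : Lab i j k l) (hij : C i ↔ C j)
    (hp : (α i * n i : ℤ) = α j * n j) (hp' : (α k * n k : ℤ) = α l * n l) :
    d = α i * n i + α k * n k := by
  obtain ⟨hkl, hik⟩ := h.two _ _ _ _ hL hij
  obtain ⟨h1, h2, h3, h4, h5, h6⟩ := id hL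
  exact pure_pure_eq hc hL hp hp' (h.dual_edge hd hik) (h.dual_edge hd (by tauto))
    (h.dual_edge hd (by tauto)) (h.dual_edge hd (by tauto)) (h.dual_not_T hd h2 h3 h6)
    (h.dual_not_T hd h4 h5 h6) (h.dual_not_T hd h1 h2 h4) (h.dual_not_T hd h1 h3 h5)

lemma muIdeal_pair_pair {k' : Type*} [Field k'] (hc : Ctx n α m) (hd : ∀ D, Dual n D (c - D))
    {i j k l : Fin 4} (hL : Lab i j k l) (hp : (α i * n i : ℤ) = α j * n j)
    (hp' : (α k * n k : ℤ) = α l * n l) : muIdeal (curveIdeal k' n) = 3 := by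
  obtain ⟨h1, h2, h3, h4, h5, h6⟩ := id hL
  have hα := hc.α_pos
  obtain ⟨Q, C, hS, hij⟩ := exists_split2_pair hc hd hL hp hp'
  obtain ⟨hkl, hik⟩ := hS.two _ _ _ _ hL hij
  obtain ⟨a, ha, haj⟩ := hS.V_all j
  obtain ⟨b, hb, hbl⟩ := hS.V_all l
  have hCa : ∀ t, 0 < a t → (C t ↔ C j) := fun t ht => hS.E_color _ _ ⟨a, ha, ht, haj⟩
  have hCb : ∀ t, 0 < b t → (C t ↔ C l) := fun t ht => hS.E_color _ _ ⟨b, hb, ht, hbl⟩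
  refine muIdeal_curveIdeal hc.pos (ι := Fin 3) ![α i * n i, α k * n k, Q]
    ![Pi.single i (α i), Pi.single k (α k), a]
    ![Pi.single j (α j), Pi.single l (α l), b] ![(· = i), (· = k), fun t => (C t ↔ C j)]
    ?_ ?_ ?_ ?_ ?_ ?_ ?_
  · exact forall_fin_three (deg_single _ _ _) (deg_single _ _ _) ha
  · exact forall_fin_three ((deg_single _ _ _).trans hp.symm) ((deg_single _ _ _).trans hp'.symm)
      hb
  · refine forall_fin_three (fun _ _ => hc.E_color _ rfl) (fun _ _ => hc.E_color _ rfl)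
      fun s t hst => ?_
    have := hS.E_color s t hst
    show (C s ↔ C j) ↔ (C t ↔ C j)
    tauto
  · exact forall_fin_three ((meets_single (hα i)).2 rfl) ((meets_single (hα k)).2 rfl)
      ⟨j, haj, Iff.rfl⟩
  · refine forall_fin_three ((meets_single (hα j)).not.2 h1.symm)
      ((meets_single (hα l)).not.2 h6.symm) ?_
    rintro ⟨t, ht, hCt⟩
    have := hCb t ht
    have hCt' : C t ↔ C j := hCt
    exact hik (hij.trans (hCt'.symm.trans (this.trans hkl.symm)))
  · refine forall_fin_three (forall_fin_three ?_ ?_ ?_) (forall_fin_three ?_ ?_ ?_)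
      (forall_fin_three ?_ ?_ ?_) <;> intro hrs hD
    · exact absurd rfl hrs
    · exact iff_of_false ((meets_single (hα k)).not.2 h2.symm) ((meets_single (hα l)).not.2 h3.symm)
    · have hD : (α i * n i : ℤ) = Q := hD
      refine iff_of_false (meets_eq.not.2 fun h => ?_) (meets_eq.not.2 fun h => ?_)
      · exact hc.not_E h1 (hD ▸ ⟨a, ha, h, haj⟩)
      · exact hik ((hCb i h).trans hkl.symm)
    · exact iff_of_false ((meets_single (hα i)).not.2 h2) ((meets_single (hα j)).not.2 h4)
    · exact absurd rfl hrs
    · have hD : (α k * n k : ℤ) = Q := hD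
      refine iff_of_false (meets_eq.not.2 fun h => ?_) (meets_eq.not.2 fun h => ?_)
      · exact hik (hij.trans (hCa k h).symm)
      · exact hc.not_E h6 (hD ▸ ⟨b, hb, h, hbl⟩)
    · exact iff_of_true ((meets_single (C := fun t => (C t ↔ C j)) (hα i)).2 hij)
        ((meets_single (C := fun t => (C t ↔ C j)) (hα j)).2 Iff.rfl)
    · exact iff_of_false
        ((meets_single (C := fun t => (C t ↔ C j)) (hα k)).not.2 fun h =>
          hik (hij.trans h.symm))
        ((meets_single (C := fun t => (C t ↔ C j)) (hα l)).not.2 fun h =>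
          hik (hij.trans (h.symm.trans hkl.symm)))
    · exact absurd rfl hrs
  · intro d C' hC'
    by_contra hgoal
    have case0 : d = α i * n i → ¬ (C' i ↔ C' j) → False := fun h h' =>
      hgoal ⟨0, h.symm, i, j, by simpa using hα i, by simpa using hα j, h'⟩
    have case1 : d = α k * n k → ¬ (C' k ↔ C' l) → False := fun h h' =>
      hgoal ⟨1, h.symm, k, l, by simpa using hα k, by simpa using hα l, h'⟩
    rcases hC'.cases' hc with ⟨t, ht, hV⟩ | hS'
    · rcases hL.cover t with rfl | rfl | rfl | rfl
      · exact case0 ht (hV j h1.symm (V_of_eq hc (ht.trans hp)))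
      · exact case0 (ht.trans hp.symm) fun h =>
          hV i h1 (V_of_eq hc (ht.trans hp.symm)) h.symm
      · exact case1 ht (hV l h6.symm (V_of_eq hc (ht.trans hp')))
      · exact case1 (ht.trans hp'.symm) fun h =>
          hV k h6 (V_of_eq hc (ht.trans hp'.symm)) h.symm
    · by_cases hij' : C' i ↔ C' j
      · obtain ⟨hkl', hik'⟩ := hS'.two _ _ _ _ hL hij'
        have e1 := hS.dual_eq hc (hd Q) hL hij hp hp'
        have e2 := hS'.dual_eq hc (hd d) hL hij' hp hp'
        refine hgoal ⟨2, ?_, j, l, haj, hbl,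
          fun h => hik' (hij'.trans (h.trans hkl'.symm))⟩
        show Q = d
        omega
      · exact case0 (hS'.eq_of_pure hc (hd d) hij' hp) hij'

end

section

variable {n α : Fin 4 → ℕ} {m : Fin 4 → Fin 4 → ℕ}

lemma Ctx.exists_two_support (hc : Ctx n α m) {i : Fin 4}
    (hi : ∀ j, j ≠ i → (α i * n i : ℤ) ≠ α j * n j) :
    ∃ v, deg n v = α i * n i ∧ v i = 0 ∧ ∃ s t, s ≠ t ∧ 0 < v s ∧ 0 < v t := by
  obtain ⟨t, hti, ht⟩ := hc.exists_m_pos i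
  by_cases h : ∃ s, s ≠ t ∧ 0 < m i s
  · obtain ⟨s, hst, hs⟩ := h
    exact ⟨m i, hc.deg_m i, hc.m_self i, s, t, hst, hs, ht⟩
  push Not at h
  have hdeg := hc.deg_m i
  have hs := deg_single n i (α i)
  have hle := hc.least (m i) (Pi.single i (α i)) t (hdeg.trans hs.symm) (by simpa [hti] using ht)
    fun j hj => (h j hj).trans (Nat.zero_le _)
  simp only [ne_eq, hti, not_false_eq_true, Pi.single_eq_of_ne, add_zero] at hle
  obtain ⟨a, ha, hat, haj⟩ := hc.sub hdeg hle
  have hpos : 0 < a t := by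
    by_contra h0
    have h1 : m i t = α t := by omega
    apply hi t hti
    rw [← hdeg, deg, Finset.sum_eq_single t, h1]
    · intro j _ hj
      have := h j hj
      simp only [Nat.le_zero] at this
      simp [this]
    · simp
  have hai : a i = 0 := by
    by_contra h0
    have := (hc.isolated ha (by omega)).2 t hti
    omega
  obtain ⟨s, hst, hs⟩ := hc.exists_m_pos t
  exact ⟨a, ha, hai, s, t, hst, by have := haj s hst; omega, hpos⟩

lemma Ctx.exists_good (hc : Ctx n α m) : ∃ m', Ctx n α m' ∧ ∀ i,
    (∀ j, j ≠ i → (α i * n i : ℤ) ≠ α j * n j) → ∃ s t, s ≠ t ∧ 0 < m' i s ∧ 0 < m' i t := by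
  have h : ∀ i, ∃ v, deg n v = α i * n i ∧ v i = 0 ∧
      ((∀ j, j ≠ i → (α i * n i : ℤ) ≠ α j * n j) → ∃ s t, s ≠ t ∧ 0 < v s ∧ 0 < v t) := by
    intro i
    by_cases hi : ∀ j, j ≠ i → (α i * n i : ℤ) ≠ α j * n j
    · obtain ⟨v, h1, h2, h3⟩ := hc.exists_two_support hi
      exact ⟨v, h1, h2, fun _ => h3⟩
    · exact ⟨m i, hc.deg_m i, hc.m_self i, fun h => absurd h hi⟩
  choose m' h1 h2 h3 using h
  exact ⟨m', ⟨hc.pos, hc.α_pos, h2, h1, hc.least⟩, h3⟩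

/-- `m` is a witness for `α`, the degrees `α i * n i` are distinct, and every `m i` involves at
least two variables. -/
structure Ctx2 (n α : Fin 4 → ℕ) (m : Fin 4 → Fin 4 → ℕ) : Prop extends Ctx n α m where
  inj : ∀ i j, i ≠ j → (α i * n i : ℤ) ≠ α j * n j
  supp : ∀ i, ∃ s t, s ≠ t ∧ 0 < m i s ∧ 0 < m i t

lemma C4.zero {d : ℤ} {p q r s : Fin 4} (h : C4 n d p q r s) {x : Fin 4 → ℕ} (hx : deg n x = d) :
    (x p = 0 ∨ x r = 0) ∧ (x q = 0 ∨ x s = 0) := by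
  constructor <;> by_contra h0
  · exact h.pr ⟨x, hx, by omega, by omega⟩
  · exact h.qs ⟨x, hx, by omega, by omega⟩

/-- The edge `p q` of the 4-cycle `p, q, r, s` carries a monomial with `q`-exponent `α q`. -/
def Fat (n α : Fin 4 → ℕ) (m : Fin 4 → Fin 4 → ℕ) (d : ℤ) (p q r s : Fin 4) : Prop :=
  m q r = 0 ∧ 0 < m q p ∧ 0 < m q s ∧
    ∃ a, deg n a = d ∧ 0 < a p ∧ a q = α q ∧ a r = 0 ∧ a s = 0

lemma C4.fat_of_le (hc : Ctx2 n α m) {d : ℤ} {p q r s : Fin 4} (h : C4 n d p q r s)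
    {a b : Fin 4 → ℕ} (ha : deg n a = d) (hb : deg n b = d) (hap : 0 < a p) (haq : 0 < a q)
    (hbs : 0 < b s) (hle : a p ≤ b p) : Fat n α m d p q r s := by
  have hL := h.lab
  obtain ⟨h1, h2, h3, h4, h5, h6⟩ := h.lab
  have za := h.zero ha
  have zb := h.zero hb
  have hq := hc.least_lab hL.rot ha hb (by omega) (by omega) (by omega) (by omega)
  obtain ⟨x, hx, x1, x2⟩ := hc.sub ha (by omega : α q ≤ a q)
  have zx := h.zero hx
  have ep := x2 p h1
  have er := x2 r h4.symm
  have es := x2 s h5.symm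
  obtain ⟨mp, ms⟩ := hc.two_pos hL.rot.swap_left.rot.rot.rot (hc.supp q) (by omega)
  exact ⟨by omega, by omega, by omega, a, ha, hap, by omega, by omega, by omega⟩

lemma C4.fat (hc : Ctx2 n α m) {d : ℤ} {p q r s : Fin 4} (h : C4 n d p q r s) :
    Fat n α m d p q r s ∨ Fat n α m d p s r q := by
  obtain ⟨a, ha, hap, haq⟩ := h.pq
  obtain ⟨b, hb, hbs, hbp⟩ := h.sp
  by_cases hle : a p ≤ b p
  · exact Or.inl (h.fat_of_le hc ha hb hap haq hbs hle)
  · exact Or.inr (h.refl.fat_of_le hc hb ha hbp hbs haq (by omega))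

lemma C4.fat_swap_false (hc : Ctx2 n α m) {d : ℤ} {p q r s : Fin 4} (h : C4 n d p q r s)
    (h1 : Fat n α m d p q r s) (h2 : Fat n α m d q p s r) : False := by
  have hL := h.lab
  obtain ⟨hpq, hpr, hps, hqr, hqs, hrs⟩ := h.lab
  obtain ⟨m1, m2, m3, a, ha, a1, a2, a3, a4⟩ := h1
  obtain ⟨m4, m5, m6, b, hb, b1, b2, b3, b4⟩ := h2
  have hbq : α q ≤ b q := by
    by_contra h0
    by_cases hle : a p ≤ b p
    · have := hc.least_lab hL.rot ha hb (by omega) (by omega) (by omega) (by omega)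
      omega
    · have := hc.eq_of_le (ha.trans hb.symm) (fun t => by
        rcases hL.cover t with rfl | rfl | rfl | rfl <;> omega) q
      omega
  obtain ⟨x, hx, x1, x2⟩ := hc.sub hb hbq
  have xp := x2 p hpq
  have xs := x2 s hqs.symm
  obtain ⟨y, hy, y1, y2⟩ := hc.sub hx (by omega : α p ≤ x p)
  have yr := y2 r hpr.symm
  have zy := h.zero hy
  omega

lemma C4.fat_next (hc : Ctx2 n α m) {d : ℤ} {p q r s : Fin 4} (h : C4 n d p q r s)
    (h1 : Fat n α m d p q r s) : Fat n α m d q r s p :=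
  (h.rot.fat hc).resolve_right (h.fat_swap_false hc h1)

/-- The 4-cycle `p, q, r, s` is traversed in the direction given by the fat edges. -/
structure Rot (n α : Fin 4 → ℕ) (m : Fin 4 → Fin 4 → ℕ) (d : ℤ) (p q r s : Fin 4) : Prop where
  c4 : C4 n d p q r s
  pq : Fat n α m d p q r s
  qr : Fat n α m d q r s p
  rs : Fat n α m d r s p q
  sp : Fat n α m d s p q r

lemma Rot.rot {d : ℤ} {p q r s : Fin 4} (h : Rot n α m d p q r s) : Rot n α m d q r s p :=
  ⟨h.c4.rot, h.qr, h.rs, h.sp, h.pq⟩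

lemma C4.rot_of_fat (hc : Ctx2 n α m) {d : ℤ} {p q r s : Fin 4} (h : C4 n d p q r s)
    (h1 : Fat n α m d p q r s) : Rot n α m d p q r s := by
  have h2 := h.fat_next hc h1
  have h3 := h.rot.fat_next hc h2
  exact ⟨h, h1, h2, h3, h.rot.rot.fat_next hc h3⟩

lemma C4.exists_rot (hc : Ctx2 n α m) {d : ℤ} {p q r s : Fin 4} (h : C4 n d p q r s) :
    Rot n α m d p q r s ∨ Rot n α m d p s r q :=
  (h.fat hc).imp (h.rot_of_fat hc) (h.refl.rot_of_fat hc)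

lemma Rot.eq (hc : Ctx2 n α m) {d : ℤ} {p q r s : Fin 4} (h : Rot n α m d p q r s) :
    d = (α p - m q p) * n p + α q * n q := by
  have hL := h.c4.lab
  obtain ⟨hpq, hpr, hps, hqr, hqs, hrs⟩ := h.c4.lab
  obtain ⟨m1, m2, m3, a, ha, a1, a2, a3, a4⟩ := h.pq
  obtain ⟨m4, m5, m6, b, hb, b1, b2, b3, b4⟩ := h.sp
  obtain ⟨x, hx, x1, x2⟩ := hc.sub ha a2.ge
  have xp := x2 p hpq
  have xr := x2 r hqr.symm
  have xs := x2 s hqs.symm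
  have hval : a p + m q p = α p := by
    rcases lt_trichotomy (x p) (α p) with hlt | he | hgt
    · by_cases hle : b s ≤ x s
      · have := hc.least_lab hL hb hx (by omega) (by omega) (by omega) (by omega)
        omega
      · have := hc.eq_of_le (hb.trans hx.symm) (fun t => by
          rcases hL.cover t with rfl | rfl | rfl | rfl <;> omega) p
        omega
    · omega
    · obtain ⟨y, hy, y1, y2⟩ := hc.sub hx hgt.le
      have yr := y2 r hpr.symm
      have zy := h.c4.zero hy
      omega
  rw [← ha, deg_lab hL, a2, a3, a4, ← hval]
  push_cast
  ring

lemma Rot.unique_aux (hc : Ctx2 n α m) {d d' : ℤ} {p q r s q' r' s' : Fin 4}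
    (h : Rot n α m d p q r s) (h' : Rot n α m d' p q' r' s') :
    d = d' ∧ q' = q ∧ r' = r ∧ s' = s := by
  have hq : q' = q := by
    have h1 := h.sp
    have h2 := h'.sp
    have hL' := h'.c4.lab
    rcases h.c4.lab.cover q' with rfl | rfl | rfl | rfl
    · exact absurd rfl hL'.1
    · rfl
    · exact absurd h2.1 h1.2.2.1.ne'
    · exact absurd h2.1 h1.2.1.ne'
  subst hq
  have hr : r' = r := by
    have h1 := h.pq
    have h2 := h'.pq
    have hL' := h'.c4.lab
    rcases h.c4.lab.cover r' with rfl | rfl | rfl | rfl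
    · exact absurd rfl hL'.2.1
    · exact absurd rfl hL'.2.2.2.1
    · rfl
    · exact absurd h2.1 h1.2.2.1.ne'
  subst hr
  refine ⟨(h.eq hc).trans (h'.eq hc).symm, rfl, rfl, ?_⟩
  obtain ⟨-, -, h3, -, h5, h6⟩ := h'.c4.lab
  rcases h.c4.lab.cover s' with rfl | rfl | rfl | rfl
  · exact absurd rfl h3
  · exact absurd rfl h5
  · exact absurd rfl h6
  · rfl

lemma Rot.unique (hc : Ctx2 n α m) {d d' : ℤ} {p q r s p' q' r' s' : Fin 4}
    (h : Rot n α m d p q r s) (h' : Rot n α m d' p' q' r' s') {C : Fin 4 → Prop}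
    (hpr : C p' ↔ C r') (hqs : C q' ↔ C s') (hpq : ¬ (C p' ↔ C q')) :
    d = d' ∧ ¬ (C p ↔ C q) := by
  rcases h'.c4.lab.cover p with rfl | rfl | rfl | rfl
  · obtain ⟨rfl, rfl, rfl, rfl⟩ := h.unique_aux hc h'
    exact ⟨rfl, hpq⟩
  · obtain ⟨rfl, rfl, rfl, rfl⟩ := h.unique_aux hc h'.rot
    exact ⟨rfl, fun h => hpq (hpr.trans h.symm)⟩
  · obtain ⟨rfl, rfl, rfl, rfl⟩ := h.unique_aux hc h'.rot.rot
    exact ⟨rfl, fun h => hpq (hpr.trans (h.trans hqs.symm))⟩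
  · obtain ⟨rfl, rfl, rfl, rfl⟩ := h.unique_aux hc h'.rot.rot.rot
    exact ⟨rfl, fun h => hpq (h.symm.trans hqs.symm)⟩

lemma C4.unique (hc : Ctx2 n α m) {d d' : ℤ} {p q r s p' q' r' s' : Fin 4}
    (h : C4 n d p q r s) (h' : C4 n d' p' q' r' s') {C : Fin 4 → Prop}
    (hpr : C p' ↔ C r') (hqs : C q' ↔ C s') (hpq : ¬ (C p' ↔ C q')) :
    d = d' ∧ ¬ (C p ↔ C q) ∧ ¬ (C p ↔ C s) := by
  have key : ∀ {q r s q' r' s' : Fin 4}, Rot n α m d p q r s → Rot n α m d' p' q' r' s' →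
      (C p' ↔ C r') → (C q' ↔ C s') → ¬ (C p' ↔ C q') →
      d = d' ∧ ¬ (C p ↔ C q) ∧ ¬ (C p ↔ C s) := by
    intro q r s q' r' s' h h' h1 h2 h3
    obtain ⟨e1, e2⟩ := h.unique hc h' h1 h2 h3
    obtain ⟨-, e3⟩ := h.rot.unique hc h' h1 h2 h3
    obtain ⟨-, e4⟩ := h.rot.rot.rot.unique hc h' h1 h2 h3
    exact ⟨e1, e2, fun h => e4 h.symm⟩
  rcases h.exists_rot hc with h1 | h1 <;> rcases h'.exists_rot hc with h2 | h2
  · exact key h1 h2 hpr hqs hpq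
  · exact key h1 h2 hpr hqs.symm fun h => hpq (h.trans hqs.symm)
  · obtain ⟨e1, e2, e3⟩ := key h1 h2 hpr hqs hpq
    exact ⟨e1, e3, e2⟩
  · obtain ⟨e1, e2, e3⟩ := key h1 h2 hpr hqs.symm fun h => hpq (h.trans hqs.symm)
    exact ⟨e1, e3, e2⟩

end

section

variable {n α : Fin 4 → ℕ} {m : Fin 4 → Fin 4 → ℕ} {c : ℤ}

lemma Lab.four {i j k l : Fin 4} (h : Lab i j k l) : Lab i k j l := by
  unfold Lab at *
  tauto

lemma exists_lab_one (i : Fin 4) : ∃ j k l, Lab i j k l := by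
  unfold Lab
  revert i
  decide

lemma exists_lab_three {i j k : Fin 4} (h1 : i ≠ j) (h2 : i ≠ k) (h3 : j ≠ k) :
    ∃ l, Lab i j k l := by
  unfold Lab
  revert i j k
  decide

lemma dual_self_E (hc : Ctx n α m) (hd : ∀ D, Dual n D (c - D)) {i j k l : Fin 4}
    (hL : Lab i j k l) : E n (c - α i * n i) j k := by
  by_contra h
  exact hc.not_E hL.2.2.1 ((hd (α i * n i) i l j k hL.rot.rot.rot.swap_left).1.2 h)

lemma dual_self_not_T (hc : Ctx n α m) (hd : ∀ D, Dual n D (c - D)) {i j k l : Fin 4}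
    (hL : Lab i j k l) : ¬ T n (c - α i * n i) j k l := fun h =>
  (hd (α i * n i) j k l i hL.rot).2.2.1 h (hc.V_self i)

/-- If `d` has the edges of the triangle `j k l`, and no monomial of degree `d` involves three
variables, then `α k * n k` has a factorization in `j` and `l` with small exponents. -/
lemma exists_small_factorization (hc : Ctx2 n α m) {d : ℤ} {i j k l : Fin 4} (hL : Lab i j k l)
    (hjk : E n d j k) (hkl : E n d k l) (hlj : E n d l j)
    (hT : ∀ s t u, s ≠ t → s ≠ u → t ≠ u → ¬ T n d s t u) :
    ∃ v, deg n v = α k * n k ∧ v i = 0 ∧ v k = 0 ∧ (0 < v j ∧ v j < α j) ∧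
      0 < v l ∧ v l < α l := by
  have hz : ∀ x, deg n x = d → ∀ s t u, s ≠ t → s ≠ u → t ≠ u → x s = 0 ∨ x t = 0 ∨ x u = 0 := by
    intro x hx s t u h1 h2 h3
    by_contra h0
    exact hT s t u h1 h2 h3 ⟨x, hx, by omega, by omega, by omega⟩
  have hA : ∀ x u v, deg n x = d → u ≠ v → 0 < x u → α v ≤ x v → x v = α v := by
    intro x u v hx huv hu hv
    obtain ⟨y, hy, y1, y2⟩ := hc.sub hx hv
    obtain ⟨s, t, hst, hs, ht⟩ := hc.supp v
    have hsv : s ≠ v := by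
      rintro rfl
      rw [hc.m_self] at hs
      omega
    have htv : t ≠ v := by
      rintro rfl
      rw [hc.m_self] at ht
      omega
    have := hz y hy s t v hst hsv htv
    have := y2 s hsv
    have := y2 t htv
    omega
  obtain ⟨h1, h2, h3, h4, h5, h6⟩ := id hL
  obtain ⟨a, ha, aj, ak⟩ := hjk
  obtain ⟨b, hb, bk, bl⟩ := hkl
  obtain ⟨e, he, el, ej⟩ := hlj
  have za := hz a ha j k
  have zb := hz b hb k l
  have ze := hz e he l j
  have ai : a i = 0 := by
    have := za i h4 h1.symm h2.symm
    omega
  have al : a l = 0 := by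
    have := za l h4 h5 h6
    omega
  have bi : b i = 0 := by
    have := zb i h6 h2.symm h3.symm
    omega
  have bj : b j = 0 := by
    have := zb j h6 h4.symm h5.symm
    omega
  have ei : e i = 0 := by
    have := ze i h5.symm h3.symm h1.symm
    omega
  have ek : e k = 0 := by
    have := ze k h5.symm h6.symm h4
    omega
  have haj : a k ≤ b k → a j = α j := by
    intro h
    have := hc.least_lab hL.rot ha hb (by omega) (by omega) (by omega) (by omega)
    exact hA a k j ha h4.symm ak (by omega)
  have hbl : b k ≤ a k → b l = α l := by
    intro h
    have := hc.least_lab hL.rot.rot.rot hb ha (by omega) (by omega) (by omega) (by omega)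
    exact hA b k l hb h6 bk (by omega)
  have hbk : b l ≤ e l → b k = α k := by
    intro h
    have := hc.least_lab hL.rot.rot hb he (by omega) (by omega) (by omega) (by omega)
    exact hA b l k hb h6.symm bl (by omega)
  have hej : e l ≤ b l → e j = α j := by
    intro h
    have := hc.least_lab hL.rot he hb (by omega) (by omega) (by omega) (by omega)
    exact hA e l j he h5.symm el (by omega)
  have hel : e j ≤ a j → e l = α l := by
    intro h
    have := hc.least_lab hL.rot.rot.rot he ha (by omega) (by omega) (by omega) (by omega)
    exact hA e j l he h5 ej (by omega)
  have hak : a j ≤ e j → a k = α k := by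
    intro h
    have := hc.least_lab hL.rot.rot ha he (by omega) (by omega) (by omega) (by omega)
    exact hA a j k ha h4 aj (by omega)
  have da := ha
  have db := hb
  have de := he
  rw [deg_lab hL, ai, al] at da
  rw [deg_lab hL, bi, bj] at db
  rw [deg_lab hL, ei, ek] at de
  have nk : ¬ (a k = α k ∧ b k = α k) := by
    rintro ⟨e1, e2⟩
    rw [haj (by omega), e1] at da
    rw [hbl (by omega), e2] at db
    apply hc.inj j l h5
    push_cast at da db
    linarith
  have nl : ¬ (b l = α l ∧ e l = α l) := by
    rintro ⟨e1, e2⟩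
    rw [hbk (by omega), e1] at db
    rw [hej (by omega), e2] at de
    apply hc.inj k j h4.symm
    push_cast at db de
    linarith
  have nj : ¬ (a j = α j ∧ e j = α j) := by
    rintro ⟨e1, e2⟩
    rw [hak (by omega), e1] at da
    rw [hel (by omega), e2] at de
    apply hc.inj k l h6
    push_cast at da de
    linarith
  have haj' := hA a k j ha h4.symm ak
  have hbl' := hA b k l hb h6 bk
  have hej' := hA e l j he h5.symm el
  have hel' := hA e j l he h5 ej
  by_cases ho : a j = α j
  · have e1 : b k = α k := by omega
    have e2 : e l = α l := by omega
    obtain ⟨v, v1, v2, v3, v4⟩ := exists_vec hL 0 (e j) 0 (e l - b l)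
    refine ⟨v, ?_, v1, v3, ⟨by omega, by omega⟩, by omega, by omega⟩
    have hcast : ((e l - b l : ℕ) : ℤ) = e l - b l := by
      push_cast [show b l ≤ e l by omega]
      rfl
    rw [deg_lab hL, v1, v2, v3, v4, hcast, ← e1]
    push_cast at db de ⊢
    linarith
  · have e1 : a k = α k := by omega
    have e2 : e j = α j := by omega
    obtain ⟨v, v1, v2, v3, v4⟩ := exists_vec hL 0 (e j - a j) 0 (e l)
    refine ⟨v, ?_, v1, v3, ⟨by omega, by omega⟩, by omega, by omega⟩
    have hcast : ((e j - a j : ℕ) : ℤ) = e j - a j := by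
      push_cast [show a j ≤ e j by omega]
      rfl
    rw [deg_lab hL, v1, v2, v3, v4, hcast, ← e1]
    push_cast at da de ⊢
    linarith

lemma exists_small_of_full (hc : Ctx2 n α m) (hd : ∀ D, Dual n D (c - D)) {i j k l : Fin 4}
    (hL : Lab i j k l) (hV : ∀ t, V n (α i * n i) t) :
    ∃ v, deg n v = α k * n k ∧ v i = 0 ∧ v k = 0 ∧ (0 < v j ∧ v j < α j) ∧
      0 < v l ∧ v l < α l := by
  refine exists_small_factorization hc hL (dual_self_E hc.toCtx hd hL)
    (dual_self_E hc.toCtx hd hL.four.swap_right)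
    (dual_self_E hc.toCtx hd hL.refl.swap_right) fun s t u h1 h2 h3 h => ?_
  obtain ⟨w, hw⟩ := exists_lab_three h1 h2 h3
  exact (hd (α i * n i) s t u w hw).2.2.1 h (hV w)

lemma full_unique (hc : Ctx2 n α m) (hd : ∀ D, Dual n D (c - D)) {i l : Fin 4} (hil : i ≠ l)
    (hi : ∀ t, V n (α i * n i) t) (hl : ∀ t, V n (α l * n l) t) : False := by
  obtain ⟨j, k, hL⟩ := exists_lab hil
  replace hL := hL.swap_right
  obtain ⟨h1, h2, h3, h4, h5, h6⟩ := id hL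
  obtain ⟨a, ha, a1, a2, a3, a4⟩ := exists_small_of_full hc hd hL.four hi
  obtain ⟨e, he, e1, e2, e3, e4⟩ := exists_small_of_full hc hd hL.rot.rot.rot hl
  by_cases hle : e k ≤ a k
  · have := hc.least_lab hL he ha (by omega) (by omega) (by omega) (by omega)
    omega
  · have := hc.least_lab hL.rot.rot.rot ha he (by omega) (by omega) (by omega) (by omega)
    omega

lemma m_eq_zero_of_not_V (hc : Ctx n α m) {i j : Fin 4} (h : ¬ V n (α j * n j) i) :
    m j i = 0 := by
  by_contra h0
  exact h ⟨m j, hc.deg_m j, by omega⟩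

lemma m_pos_of_eq_zero (hc : Ctx2 n α m) {i j k l : Fin 4} (hL : Lab i j k l) (h : m j i = 0) :
    0 < m j k ∧ 0 < m j l := by
  have hL' : Lab k i j l := by
    unfold Lab at *
    tauto
  exact hc.two_pos hL' (hc.supp j) h

lemma missing_reverse (hc : Ctx2 n α m) (hd : ∀ D, Dual n D (c - D)) {i j k l : Fin 4}
    (hL : Lab i j k l) (h : ¬ V n (α j * n j) i) : m l j = 0 ∨ m k j = 0 := by
  obtain ⟨h1, h2, h3, h4, h5, h6⟩ := id hL
  obtain ⟨mk, ml⟩ := m_pos_of_eq_zero hc hL (m_eq_zero_of_not_V hc.toCtx h)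
  have hEkl : E n (α j * n j) k l := ⟨m j, hc.deg_m j, mk, ml⟩
  have hVk : V n (α j * n j) k := ⟨m j, hc.deg_m j, mk⟩
  have hVl : V n (α j * n j) l := ⟨m j, hc.deg_m j, ml⟩
  have hij := (hd (α j * n j) k l i j hL.rot.rot).1.1 hEkl
  have hikl := dual_self_not_T hc.toCtx hd hL.swap_left
  have hjk : ¬ T n (c - α j * n j) i j k := fun h => (hd _ i j k l hL).2.2.1 h hVl
  obtain ⟨b, hb, bi, bk⟩ := dual_self_E hc.toCtx hd hL.swap_left
  obtain ⟨e, he, ei, el⟩ := dual_self_E hc.toCtx hd hL.swap_left.swap_right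
  have hz : ∀ x, deg n x = c - α j * n j → (x i = 0 ∨ x j = 0) ∧ (x i = 0 ∨ x k = 0 ∨ x l = 0) := by
    intro x hx
    constructor <;> by_contra h0
    · exact hij ⟨x, hx, by omega, by omega⟩
    · exact hikl ⟨x, hx, by omega, by omega, by omega⟩
  have zb := hz b hb
  have ze := hz e he
  by_cases hle : b i ≤ e i
  · have := hc.least_lab hL.rot.rot hb he (by omega) (by omega) (by omega) (by omega)
    obtain ⟨x, hx, -, x2⟩ := hc.sub hb (by omega : α k ≤ b k)
    have := x2 i h2
    have := x2 j h4
    have := hz x hx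
    omega
  · have := hc.least_lab hL.rot.rot.rot he hb (by omega) (by omega) (by omega) (by omega)
    obtain ⟨x, hx, -, x2⟩ := hc.sub he (by omega : α l ≤ e l)
    have := x2 i h3
    have := x2 j h5
    have := hz x hx
    omega

/-- No degree `α i * n i` involves all the variables. -/
lemma exists_missing (hc : Ctx2 n α m) (hd : ∀ D, Dual n D (c - D)) (i : Fin 4) :
    ∃ j, ¬ V n (α i * n i) j := by
  by_contra! hi
  have key : ∀ {j k l : Fin 4}, Lab i j k l → m k i = 0 := by
    intro j k l hL
    obtain ⟨v, hv, -, -, ⟨vj, -⟩, vl, -⟩ := exists_small_of_full hc hd hL hi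
    refine m_eq_zero_of_not_V hc.toCtx fun hVi => full_unique hc hd hL.2.1 hi fun t => ?_
    rcases hL.cover t with rfl | rfl | rfl | rfl
    · exact hVi
    · exact ⟨v, hv, vj⟩
    · exact hc.V_self _
    · exact ⟨v, hv, vl⟩
  obtain ⟨j, k, l, hL⟩ := exists_lab_one i
  have hVj : ¬ V n (α j * n j) i := by
    intro hVi
    obtain ⟨v, hv, -, -, ⟨vk, -⟩, vl, -⟩ := exists_small_of_full hc hd hL.four hi
    refine full_unique hc hd hL.1 hi fun t => ?_
    rcases hL.cover t with rfl | rfl | rfl | rfl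
    · exact hVi
    · exact hc.V_self _
    · exact ⟨v, hv, vk⟩
    · exact ⟨v, hv, vl⟩
  have hk := (m_pos_of_eq_zero hc hL.four (key hL)).1
  have hl := (m_pos_of_eq_zero hc hL.refl (key hL.swap_right)).2
  rcases missing_reverse hc hd hL hVj with h | h <;> omega

end

section

variable {n α : Fin 4 → ℕ} {m : Fin 4 → Fin 4 → ℕ} {c : ℤ}

lemma Split2.exists_C4 (hc : Ctx2 n α m) {D d : ℤ} {C : Fin 4 → Prop} (h : Split2 n D C)
    (hd : Dual n D d) : ∃ i j k l, C4 n d i k j l ∧ (C i ↔ C j) ∧ (C k ↔ C l) ∧ ¬ (C i ↔ C k) ∧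
      E n D i j ∧ E n D k l := by
  have key : ∀ {i j k l}, Lab i j k l → (C i ↔ C j) → E n D i j := by
    intro i j k l hL hij
    by_contra h0
    obtain ⟨e1, e2⟩ := h.eq_of_not_E hc.toCtx hL hij h0
    exact hc.inj i j hL.1 (e1.symm.trans e2)
  obtain ⟨i, k, hik⟩ : ∃ i k, ¬ (C i ↔ C k) := by
    by_contra! h0
    exact (h.two 0 1 2 3 (by unfold Lab; decide) (h0 0 1)).2 (h0 0 2)
  obtain ⟨j, l, hL, hij, hkl⟩ := h.exists_lab hik
  exact ⟨i, j, k, l, h.dual_C4 hd hL hij (key hL hij) (key hL.rot.rot hkl), hij, hkl, hik,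
    key hL hij, key hL.rot.rot hkl⟩

/-- If there are no splittings into two pairs, a monomial not divisible by any `x_i ^ α i` and any
`m i` is the only one of its degree. -/
lemma unique_factorization (hc : Ctx2 n α m) (hS : ∀ D C, ¬ Split2 n D C) {M M' : Fin 4 → ℕ}
    (hM : deg n M' = deg n M) (hα : ∀ t, M t < α t) (hm : ∀ t, ∃ s, M s < m t s) : M' = M := by
  obtain ⟨N, hN⟩ : ∃ N : ℕ, deg n M = N := ⟨_, deg_eq_cast n M⟩
  induction N using Nat.strong_induction_on generalizing M M' with
  | _ N ih =>
  have share : ∀ x t, deg n x = deg n M → 0 < x t → 0 < M t → x = M := by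
    intro x t hx hxt hMt
    have dx := deg_sub_single n hxt
    have dM := deg_sub_single n hMt
    have hle : ∀ s, (M - Pi.single t 1 : Fin 4 → ℕ) s ≤ M s := fun s => Nat.sub_le _ _
    have hcast := deg_eq_cast n (M - Pi.single t 1)
    have hpos := hc.pos t
    have := ih (∑ i, (M - Pi.single t 1 : Fin 4 → ℕ) i * n i) (by omega)
      (M := M - Pi.single t 1) (M' := x - Pi.single t 1) (by omega)
      (fun s => (hle s).trans_lt (hα s))
      (fun u => (hm u).imp fun s hs => (hle s).trans_lt hs) hcast
    rw [← sub_add_single hxt, ← sub_add_single hMt, this]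
  by_contra hne
  have hdisj : ∀ x, deg n x = deg n M → x ≠ M → ∀ t, 0 < x t → M t = 0 := by
    intro x hx hxM t ht
    by_contra h0
    exact hxM (share x t hx ht (by omega))
  have hpos : ∀ x, deg n x = deg n M → ∃ t, 0 < x t := by
    intro x hx
    by_contra! h0
    have hx0 : deg n x = 0 := by
      have h1 : x = 0 := by
        ext t
        simpa using h0 t
      rw [h1]
      simp [deg]
    have e1 := eq_zero_of_deg hc.pos (hx.symm.trans hx0)
    have e2 := eq_zero_of_deg hc.pos (hM.trans (hx.symm.trans hx0))
    exact hne (e2.trans e1.symm)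
  have hsplit : Split n (deg n M) (fun t => 0 < M t) := by
    refine ⟨?_, ?_⟩
    · rintro s t ⟨x, hx, hs, ht⟩
      by_cases hxM : x = M
      · subst hxM
        exact iff_of_true hs ht
      · exact iff_of_false (hdisj x hx hxM s hs).not_gt (hdisj x hx hxM t ht).not_gt
    · obtain ⟨s, hs⟩ := hpos M rfl
      obtain ⟨t, ht⟩ := hpos M' hM
      exact ⟨s, t, ⟨M, rfl, hs⟩, ⟨M', hM, ht⟩, fun h => (hdisj M' hM hne t ht).not_gt (h.1 hs)⟩
  rcases hsplit.cases' hc.toCtx with ⟨i, hi, hV⟩ | h2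
  · by_cases hMi : 0 < M i
    · have := (hc.isolated hi hMi).1
      have := hα i
      omega
    · obtain ⟨t, ht, hmt⟩ := hc.exists_m_pos i
      have hdm : deg n (m i) = deg n M := (hc.deg_m i).trans hi.symm
      have hMt : 0 < M t := by
        have := hV t ht ⟨m i, hdm, hmt⟩
        omega
      have := share (m i) t hdm hmt hMt
      obtain ⟨s, hs⟩ := hm i
      rw [this] at hs
      omega
  · exact hS _ _ h2

/-- The zero pattern of `m` is a 4-cycle. -/
structure Cyc (α : Fin 4 → ℕ) (m : Fin 4 → Fin 4 → ℕ) (p q r s : Fin 4) : Prop where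
  lab : Lab p q r s
  pq : m p q = 0
  qr : m q r = 0
  rs : m r s = 0
  sp : m s p = 0
  lt : ∀ a b, a ≠ b → m a b < α b

lemma Cyc.rot {p q r s : Fin 4} (h : Cyc α m p q r s) : Cyc α m q r s p :=
  ⟨h.lab.rot, h.qr, h.rs, h.sp, h.pq, h.lt⟩

lemma Cyc.supp (hc : Ctx2 n α m) {p q r s : Fin 4} (h : Cyc α m p q r s) :
    0 < m p r ∧ 0 < m p s :=
  m_pos_of_eq_zero hc h.lab.swap_left h.pq

lemma Cyc.step (hc : Ctx2 n α m) (hS : ∀ D C, ¬ Split2 n D C) {p q r s : Fin 4}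
    (h : Cyc α m p q r s) (h1 : α r ≤ m p r + m s r) : α q ≤ m r q + m s q := by
  by_contra h2
  have hL := h.lab
  obtain ⟨pr, ps⟩ := h.supp hc
  obtain ⟨qs, qp⟩ := h.rot.supp hc
  obtain ⟨rp, rq⟩ := h.rot.rot.supp hc
  obtain ⟨sq, sr⟩ := h.rot.rot.rot.supp hc
  obtain ⟨hpq, hpr, hps, hqr, hqs, hrs⟩ := h.lab
  have l1 := h.lt p s hps
  have l2 := h.lt r p hpr.symm
  have l3 := h.lt p r hpr
  have l4 := h.lt s r hrs.symm
  have dp := hc.deg_m p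
  have dr := hc.deg_m r
  have ds := hc.deg_m s
  rw [deg_lab hL, hc.m_self, h.pq] at dp
  rw [deg_lab hL, hc.m_self, h.rs] at dr
  rw [deg_lab hL, hc.m_self, h.sp] at ds
  obtain ⟨a, a1, a2, a3, a4⟩ := exists_vec hL (α p - m r p) 0 0 (α s - m p s)
  obtain ⟨b, b1, b2, b3, b4⟩ := exists_vec hL 0 (m r q + m s q) (m p r + m s r - α r) 0
  have hab : deg n a = deg n b := by
    rw [deg_lab hL, deg_lab hL, a1, a2, a3, a4, b1, b2, b3, b4, Nat.cast_sub l2.le,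
      Nat.cast_sub l1.le, Nat.cast_sub h1]
    push_cast at dp dr ds ⊢
    linarith
  by_cases hX : m p r + m s r = α r
  · have := hc.least_lab hL.rot hab.symm rfl (by omega) (by omega) (by omega) (by omega)
    omega
  · have := unique_factorization hc hS hab
      (fun t => by
        rcases hL.cover t with rfl | rfl | rfl | rfl
        · have := hc.α_pos t
          omega
        · omega
        · omega
        · have := hc.α_pos t
          omega)
      (fun t => by
        rcases hL.cover t with rfl | rfl | rfl | rfl
        · exact ⟨s, by omega⟩
        · exact ⟨s, by omega⟩
        · exact ⟨p, by omega⟩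
        · exact ⟨r, by omega⟩)
    have := congrFun this r
    omega

lemma Cyc.false (hc : Ctx2 n α m) (hS : ∀ D C, ¬ Split2 n D C) {p q r s : Fin 4}
    (h : Cyc α m p q r s) : False := by
  have hL := h.lab
  have e1 := h.step hc hS
  have e2 := h.rot.step hc hS
  have e3 := h.rot.rot.step hc hS
  have e4 := h.rot.rot.rot.step hc hS
  obtain ⟨pr, ps⟩ := h.supp hc
  obtain ⟨qs, qp⟩ := h.rot.supp hc
  obtain ⟨rp, rq⟩ := h.rot.rot.supp hc
  obtain ⟨sq, sr⟩ := h.rot.rot.rot.supp hc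
  obtain ⟨hpq, hpr, hps, hqr, hqs, hrs⟩ := h.lab
  have l1 := h.lt q p hpq.symm
  have l2 := h.lt s r hrs.symm
  have dp := hc.deg_m p
  have dq := hc.deg_m q
  have dr := hc.deg_m r
  have ds := hc.deg_m s
  rw [deg_lab hL, hc.m_self, h.pq] at dp
  rw [deg_lab hL, hc.m_self, h.qr] at dq
  rw [deg_lab hL, hc.m_self, h.rs] at dr
  rw [deg_lab hL, hc.m_self, h.sp] at ds
  have hsum : ((m q p + m r p - α p : ℤ)) * n p + (m r q + m s q - α q) * n q +
      (m p r + m s r - α r) * n r + (m p s + m q s - α s) * n s = 0 := by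
    push_cast at dp dq dr ds
    linarith
  have np := hc.pos p
  have nq := hc.pos q
  have nr := hc.pos r
  have ns := hc.pos s
  have hzero : α p = m q p + m r p ∧ α q = m r q + m s q ∧ α r = m p r + m s r ∧
      α s = m p s + m q s := by
    by_cases hr : α r ≤ m p r + m s r
    · have hq := e1 hr
      have hp : α p ≤ m q p + m r p := by
        have := e4 (by omega)
        omega
      have hs : α s ≤ m p s + m q s := by
        have := e3 (by omega)
        omega
      have yp : (0 : ℤ) ≤ m q p + m r p - α p := by omega
      have yq : (0 : ℤ) ≤ m r q + m s q - α q := by omega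
      have yr : (0 : ℤ) ≤ m p r + m s r - α r := by omega
      have ys : (0 : ℤ) ≤ m p s + m q s - α s := by omega
      have zp : (0 : ℤ) < n p := by omega
      have zq : (0 : ℤ) < n q := by omega
      have zr : (0 : ℤ) < n r := by omega
      have zs : (0 : ℤ) < n s := by omega
      have wp := mul_nonneg yp zp.le
      have wq := mul_nonneg yq zq.le
      have wr := mul_nonneg yr zr.le
      have ws := mul_nonneg ys zs.le
      have vp := (mul_eq_zero.1 (by linarith : (m q p + m r p - α p : ℤ) * n p = 0)).resolve_right
        zp.ne'
      have vq := (mul_eq_zero.1 (by linarith : (m r q + m s q - α q : ℤ) * n q = 0)).resolve_right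
        zq.ne'
      have vr := (mul_eq_zero.1 (by linarith : (m p r + m s r - α r : ℤ) * n r = 0)).resolve_right
        zr.ne'
      have vs := (mul_eq_zero.1 (by linarith : (m p s + m q s - α s : ℤ) * n s = 0)).resolve_right
        zs.ne'
      omega
    · have hs : ¬ α s ≤ m p s + m q s := fun h => hr (by have := e2 (by omega); omega)
      have hp : ¬ α p ≤ m q p + m r p := fun h => hs (by have := e3 (by omega); omega)
      have hq : ¬ α q ≤ m r q + m s q := fun h => hp (by have := e4 (by omega); omega)
      have wp := mul_neg_of_neg_of_pos (by omega : (m q p + m r p - α p : ℤ) < 0)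
        (by omega : (0 : ℤ) < n p)
      have wq := mul_neg_of_neg_of_pos (by omega : (m r q + m s q - α q : ℤ) < 0)
        (by omega : (0 : ℤ) < n q)
      have wr := mul_neg_of_neg_of_pos (by omega : (m p r + m s r - α r : ℤ) < 0)
        (by omega : (0 : ℤ) < n r)
      have ws := mul_neg_of_neg_of_pos (by omega : (m p s + m q s - α s : ℤ) < 0)
        (by omega : (0 : ℤ) < n s)
      linarith
  obtain ⟨zp, zq, zr, zs⟩ := hzero
  obtain ⟨a, a1, a2, a3, a4⟩ := exists_vec hL 0 (m r q) 0 (m p s)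
  obtain ⟨b, b1, b2, b3, b4⟩ := exists_vec hL (m q p) 0 (m s r) 0
  have hab : deg n a = deg n b := by
    rw [deg_lab hL, deg_lab hL, a1, a2, a3, a4, b1, b2, b3, b4]
    rw [zq] at dq
    rw [zs] at ds
    push_cast at dq ds ⊢
    linarith
  have := unique_factorization hc hS hab
    (fun t => by rcases hL.cover t with rfl | rfl | rfl | rfl <;> omega)
    (fun t => by
      rcases hL.cover t with rfl | rfl | rfl | rfl
      · exact ⟨s, by omega⟩
      · exact ⟨s, by omega⟩
      · exact ⟨q, by omega⟩
      · exact ⟨q, by omega⟩)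
  have := congrFun this r
  omega

lemma exists_cycle {f : Fin 4 → Fin 4} (hne : ∀ j, f j ≠ j)
    (hf : ∀ j, ∃ l, l ≠ j ∧ l ≠ f j ∧ f l = j) (p : Fin 4) :
    Lab p (f p) (f (f p)) (f (f (f p))) ∧ f (f (f (f p))) = p := by
  have hinj : Function.Injective f := Finite.injective_iff_surjective.2 fun j => by
    obtain ⟨l, -, -, h⟩ := hf j
    exact ⟨l, h⟩
  have hne2 : ∀ j, f (f j) ≠ j := by
    intro j h
    obtain ⟨l, -, h2, h3⟩ := hf j
    exact h2 (hinj (h3.trans h.symm))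
  have h3 : p ≠ f (f (f p)) := by
    intro h
    obtain ⟨t, ht⟩ := exists_lab_three (hne p).symm (hne2 p).symm (hne (f p)).symm
    obtain ⟨-, -, h2, -, h4, h5⟩ := id ht
    rcases ht.cover (f t) with e | e | e | e
    · exact h5 (hinj (e.trans h)).symm
    · exact h2 (hinj e).symm
    · exact h4 (hinj e).symm
    · exact hne t e
  have hL : Lab p (f p) (f (f p)) (f (f (f p))) :=
    ⟨(hne _).symm, (hne2 _).symm, h3, (hne _).symm, (hne2 _).symm, (hne _).symm⟩
  refine ⟨hL, ?_⟩
  rcases hL.cover (f (f (f (f p)))) with e | e | e | e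
  · exact e
  · exact absurd (hinj e).symm h3
  · exact absurd (hinj e) (hne2 _)
  · exact absurd e (hne _)

lemma exists_split2 (hc : Ctx2 n α m) (hd : ∀ D, Dual n D (c - D)) : ∃ D C, Split2 n D C := by
  by_contra! hS
  choose f hf using exists_missing hc hd
  have hne : ∀ j, f j ≠ j := fun j h => hf j (by rw [h]; exact hc.V_self j)
  have hm0 : ∀ j, m j (f j) = 0 := fun j => m_eq_zero_of_not_V hc.toCtx (hf j)
  have huniq : ∀ j l, l ≠ j → m l j = 0 → f l = j := by
    intro j l hlj h
    by_contra hfl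
    obtain ⟨s, hs⟩ := exists_lab_three hfl (hne l) hlj.symm
    have := (m_pos_of_eq_zero hc hs.four (hm0 l)).1
    omega
  obtain ⟨hL, h4⟩ := exists_cycle hne (fun j => by
    obtain ⟨k, l, hkl⟩ := exists_lab (hne j)
    obtain ⟨h1, h2, h3, h4, h5, h6⟩ := id hkl
    rcases missing_reverse hc hd hkl.four (hf j) with h | h
    · exact ⟨l, h6.symm, h3.symm, huniq j l h6.symm h⟩
    · exact ⟨k, h4, h1.symm, huniq j k h4 h⟩) 0
  refine Cyc.false hc hS (p := 0) (q := f 0) (r := f (f 0)) (s := f (f (f 0)))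
    ⟨hL, hm0 _, hm0 _, hm0 _, ?_, ?_⟩
  · have := hm0 (f (f (f 0)))
    rwa [h4] at this
  · intro a b hab
    by_contra h
    obtain ⟨x, hx, x1, x2⟩ := hc.sub (hc.deg_m a) (by omega : α b ≤ m a b)
    have ha : m b a = 0 := by
      by_contra h0
      have xa := x2 a hab
      have hz := (hc.isolated hx (by omega)).2
      obtain ⟨s, t, hst, hs, ht⟩ := hc.supp b
      have key : ∀ u, u ≠ a → m b u = 0 := by
        intro u hu
        by_cases hub : u = b
        · rw [hub, hc.m_self]
        · have := x2 u hub
          have := hz u hu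
          omega
      by_cases hsa : s = a
      · rw [key t fun h => hst (hsa.trans h.symm)] at ht
        omega
      · rw [key s hsa] at hs
        omega
    have hfa : f a ≠ b := by
      rintro rfl
      have := hm0 a
      have := hc.α_pos (f a)
      omega
    have hb : m b (f a) = 0 := by
      by_contra h0
      have := x2 (f a) hfa
      exact hf a ⟨x, hx, by omega⟩
    exact hne a ((huniq _ _ hfa.symm hb).symm.trans (huniq _ _ hab.symm ha))

end

section

variable {n α : Fin 4 → ℕ} {m : Fin 4 → Fin 4 → ℕ} {c : ℤ} {k : Type*} [Field k]

lemma muIdeal_distinct (hc : Ctx2 n α m) (hd : ∀ D, Dual n D (c - D)) :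
    muIdeal (curveIdeal k n) = 5 := by
  have hα := hc.α_pos
  obtain ⟨Q, C, hS⟩ := exists_split2 hc hd
  obtain ⟨p, q, r, s, hC4, hpq, hrs, hpr, ⟨a, ha, hap, haq⟩, b, hb, hbr, hbs⟩ :=
    hS.exists_C4 hc (hd Q)
  obtain ⟨h1, h2, h3, h4, h5, h6⟩ := hC4.lab
  have hCb : ∀ t, 0 < b t → (C t ↔ C r) := fun t ht => hS.E_color _ _ ⟨b, hb, ht, hbr⟩
  have hQ : ∀ t, Q ≠ α t * n t := by
    rintro t rfl
    rcases hC4.lab.cover t with rfl | rfl | rfl | rfl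
    · exact hc.not_E h2 ⟨a, ha, hap, haq⟩
    · exact hc.not_E h5 ⟨b, hb, hbr, hbs⟩
    · exact hc.not_E h2.symm ⟨a, ha, haq, hap⟩
    · exact hc.not_E h5.symm ⟨b, hb, hbs, hbr⟩
  refine (muIdeal_curveIdeal hc.pos (ι := Option (Fin 4)) (fun x => x.elim Q fun t => α t * n t)
    (fun x => x.elim a fun t => Pi.single t (α t)) (fun x => x.elim b m)
    (fun x => x.elim (fun t => (C t ↔ C p)) fun u t => t = u) ?_ ?_ ?_ ?_ ?_ ?_ ?_).trans
    (by simp)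
  · rintro (_ | t)
    · exact ha
    · exact deg_single _ _ _
  · rintro (_ | t)
    · exact hb
    · exact hc.deg_m t
  · rintro (_ | u) s t hst
    · have := hS.E_color s t hst
      exact ⟨fun h => this.symm.trans h, fun h => this.trans h⟩
    · exact hc.E_color u rfl hst
  · rintro (_ | t)
    · exact ⟨p, hap, Iff.rfl⟩
    · exact (meets_single (hα t)).2 rfl
  · rintro (_ | t)
    · rintro ⟨t, ht, hCt⟩
      exact hpr ((hCb t ht).symm.trans hCt).symm
    · exact meets_eq.not.2 (hc.m_self t).not_gt
  · rintro (_ | t) (_ | u) hne hD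
    · exact absurd rfl hne
    · exact absurd hD (hQ u)
    · exact absurd hD.symm (hQ t)
    · exact absurd hD (hc.inj t u fun h => hne (congrArg some h))
  · intro d C' hC'
    rcases hC'.cases' hc.toCtx with ⟨i, hi, hiV⟩ | h2
    · obtain ⟨u, hu, hmu⟩ := hc.exists_m_pos i
      exact ⟨some i, hi.symm, i, u, by simpa using hα i, hmu,
        hiV u hu ⟨m i, (hc.deg_m i).trans hi.symm, hmu⟩⟩
    · obtain ⟨p', q', r', s', hC4', hpq', hrs', hpr', -, -⟩ := h2.exists_C4 hc (hd d)
      obtain ⟨e1, e2, -⟩ := hC4.unique hc hC4' hpq' hrs' hpr'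
      have hdQ : Q = d := by omega
      exact ⟨none, hdQ, p, r, hap, hbr, e2⟩

theorem muIdeal_eq_three_or_five (hc : Ctx n α m) (hd : ∀ D, Dual n D (c - D)) :
    muIdeal (curveIdeal k n) = 3 ∨ muIdeal (curveIdeal k n) = 5 := by
  obtain ⟨m', hc', hm'⟩ := hc.exists_good
  by_cases hinj : ∀ i j, i ≠ j → (α i * n i : ℤ) ≠ α j * n j
  · exact Or.inr (muIdeal_distinct ⟨hc', hinj, fun i => hm' i fun j hj => hinj i j hj.symm⟩ hd)
  left
  push Not at hinj
  obtain ⟨p, q, hpq, e⟩ := hinj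
  obtain ⟨r, s, hL⟩ := exists_lab hpq
  replace hL := hL.four
  obtain ⟨h1, h2, h3, h4, h5, h6⟩ := id hL
  by_cases hrs : (α r * n r : ℤ) = α s * n s
  · exact muIdeal_pair_pair hc hd hL e hrs
  by_cases hpr : (α p * n p : ℤ) = α r * n r
  · exact muIdeal_three_equal hc hd hL hpr (e.symm.trans hpr) (Ne.symm hrs)
  by_cases hps : (α p * n p : ℤ) = α s * n s
  · exact muIdeal_three_equal hc hd hL.swap_right hps (e.symm.trans hps) hrs
  refine muIdeal_two_equal hc' hd hL e hpr hps hrs (hm' r fun j hj => ?_) (hm' s fun j hj => ?_)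
  · rcases hL.cover j with rfl | rfl | rfl | rfl
    · exact Ne.symm hpr
    · exact fun h => hpr (e.trans h.symm)
    · exact absurd rfl hj
    · exact hrs
  · rcases hL.cover j with rfl | rfl | rfl | rfl
    · exact Ne.symm hps
    · exact fun h => hps (e.trans h.symm)
    · exact Ne.symm hrs
    · exact absurd rfl hj

end

end Bresinsky

/-- Bresinsky: if `H = ⟨n₁,n₂,n₃,n₄⟩` is symmetric, then
`μ(I_H) = 3` or `μ(I_H) = 5`. -/
theorem stmt6 (n : Fin 4 → ℕ) (H : Set ℕ)
    (hH : IsNumericalSemigroup H)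
    (hsym : (PF H).ncard = 1)
    (hgen : H = {m | ∃ a : Fin 4 → ℕ, m = ∑ i, a i * n i})
    (hmin : ∀ j : Fin 4, {m | ∃ a : Fin 4 → ℕ, a j = 0 ∧ m = ∑ i, a i * n i} ≠ H)
    (k : Type*) [Field k] :
    muIdeal (RingHom.ker (MvPolynomial.aeval
        (fun i => (Polynomial.X : Polynomial k) ^ n i) :
        MvPolynomial (Fin 4) k →ₐ[k] Polynomial k)) = 3 ∨
    muIdeal (RingHom.ker (MvPolynomial.aeval
        (fun i => (Polynomial.X : Polynomial k) ^ n i) :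
        MvPolynomial (Fin 4) k →ₐ[k] Polynomial k)) = 5 := by
  have hpos := Bresinsky.pos_of_minimal hgen hmin
  obtain ⟨F, hF⟩ := Bresinsky.exists_frobenius_symm hH hsym
  simp only [Bresinsky.exists_deg_iff hgen] at hF
  obtain ⟨α, m, hc⟩ := Bresinsky.exists_ctx hpos
  exact Bresinsky.muIdeal_eq_three_or_five hc (Bresinsky.dual_of_symm hF)
end

section
/- Let H be a symmetric numerical semigroup minimally generated by n_1, n_2, n_3, n_4, let k be a field, and assume that I_H is not generated by 3 elements. For each i ∈ {1,2,3,4}, let α_i be the least positive integer such that α_i n_i belongs to the submonoid ⟨n_j : j ≠ i⟩ of ℕ. Then α_i n_i ≠ α_j n_j whenever i ≠ j. -/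
/-- If `c * m = e * m'` is the first coincidence between multiples of `m` and `m'` and
`u ^ c = v ^ e`, then monomials in `u, v` are determined by their weighted degrees. -/
theorem pow_mul_pow_eq_of_comb_eq {Q : Type*} [CommMonoid Q] {u v : Q} {m m' : ℤ} {c e : ℕ}
    (hc : 0 < c) (hm : 0 < m) (hm' : 0 < m') (h : (c * m : ℤ) = e * m')
    (hmin : ∀ t s : ℕ, 0 < t → (t * m : ℤ) = s * m' → c ≤ t) (huv : u ^ c = v ^ e)
    {i j i' j' : ℕ} (hij : (i * m + j * m' : ℤ) = i' * m + j' * m') :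
    u ^ i * v ^ j = u ^ i' * v ^ j' := by
  have key : ∀ t s : ℕ, (t * m : ℤ) = s * m' → u ^ t = v ^ s := by
    intro t
    induction t using Nat.strong_induction_on with
    | _ t ih =>
    intro s hts
    rcases Nat.eq_zero_or_pos t with rfl | ht
    · have : s = 0 := by simpa [hm'.ne'] using hts.symm
      simp [this]
    · obtain ⟨k, rfl⟩ := Nat.exists_eq_add_of_le (hmin t s ht hts)
      have hs : (k * m : ℤ) = (s - e) * m' := by push_cast at hts; linear_combination hts - h
      have hes : (0 : ℤ) ≤ s - e := nonneg_of_mul_nonneg_left (hs ▸ by positivity) hm'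
      obtain ⟨l, rfl⟩ := Nat.exists_eq_add_of_le (show e ≤ s by omega)
      rw [pow_add, pow_add, huv, ih k (by omega) l (by rw [hs]; push_cast; ring)]
  have main : ∀ i j i' j' : ℕ, i ≤ i' → (i * m + j * m' : ℤ) = i' * m + j' * m' →
      u ^ i * v ^ j = u ^ i' * v ^ j' := by
    intro i j i' j' hi hij
    obtain ⟨t, rfl⟩ := Nat.exists_eq_add_of_le hi
    have hs : (t * m : ℤ) = (j - j') * m' := by push_cast at hij; linear_combination -hij
    have hj : (0 : ℤ) ≤ j - j' := nonneg_of_mul_nonneg_left (hs ▸ by positivity) hm'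
    obtain ⟨s, rfl⟩ := Nat.exists_eq_add_of_le (show j' ≤ j by omega)
    rw [pow_add u, key t s (by rw [hs]; push_cast; ring), pow_add, mul_assoc, mul_comm (v ^ j')]
  rcases le_total i i' with hi | hi
  · exact main i j i' j' hi hij
  · exact (main i' j' i j hi hij.symm).symm

/-- `z` lies in the submonoid of `ℤ` generated by `n₁, n₂, n₃, n₄`. -/
def InSg (n₁ n₂ n₃ n₄ z : ℤ) : Prop :=
  ∃ a b c d : ℕ, z = a * n₁ + b * n₂ + c * n₃ + d * n₄

/-- `z` is a minimal generator of the semigroup `⟨n₁, n₂, n₃, n₄⟩` as a set acted on by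
`⟨n₁, n₂⟩`. -/
def IsBase (n₁ n₂ n₃ n₄ z : ℤ) : Prop :=
  InSg n₁ n₂ n₃ n₄ z ∧ ¬ InSg n₁ n₂ n₃ n₄ (z - n₁) ∧ ¬ InSg n₁ n₂ n₃ n₄ (z - n₂)

/-- The semigroup `⟨n₁, n₂, n₃, n₄⟩` is symmetric with Frobenius number `F`, the least multiple
of `n₁` in `⟨n₂, n₃, n₄⟩` is `q * n₁`, the least multiple of `n₂` in `⟨n₁, n₃, n₄⟩` is `p * n₂`,
and these agree. -/
structure SymmetricWithRelation (n₁ n₂ n₃ n₄ F : ℤ) (q p : ℕ) : Prop where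
  pos₁ : 0 < n₁
  pos₂ : 0 < n₂
  pos₃ : 0 < n₃
  pos₄ : 0 < n₄
  symm : ∀ z, InSg n₁ n₂ n₃ n₄ z ↔ ¬ InSg n₁ n₂ n₃ n₄ (F - z)
  rel : q * n₁ = p * n₂
  q_pos : 0 < q
  p_pos : 0 < p
  min₁ : ∀ t b c d : ℕ, 0 < t → t * n₁ = b * n₂ + c * n₃ + d * n₄ → q ≤ t
  min₂ : ∀ t a c d : ℕ, 0 < t → t * n₂ = a * n₁ + c * n₃ + d * n₄ → p ≤ t

section Core

variable {n₁ n₂ n₃ n₄ F z : ℤ} {q p : ℕ}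

theorem InSg.add {y : ℤ} (hy : InSg n₁ n₂ n₃ n₄ y) (hz : InSg n₁ n₂ n₃ n₄ z) :
    InSg n₁ n₂ n₃ n₄ (y + z) := by
  obtain ⟨a, b, c, d, rfl⟩ := hy
  obtain ⟨a', b', c', d', rfl⟩ := hz
  exact ⟨a + a', b + b', c + c', d + d', by push_cast; ring⟩

theorem InSg.comb₁₂ (x y : ℕ) : InSg n₁ n₂ n₃ n₄ (x * n₁ + y * n₂) :=
  ⟨x, y, 0, 0, by simp⟩

theorem InSg.comb₃₄ (i j : ℕ) : InSg n₁ n₂ n₃ n₄ (i * n₃ + j * n₄) :=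
  ⟨0, 0, i, j, by simp⟩

theorem IsBase.exists_comb (hz : IsBase n₁ n₂ n₃ n₄ z) : ∃ i j : ℕ, z = i * n₃ + j * n₄ := by
  obtain ⟨⟨a, b, c, d, rfl⟩, h₁, h₂⟩ := hz
  refine ⟨c, d, ?_⟩
  rcases a with _ | a
  · rcases b with _ | b
    · simp
    · exact absurd ⟨0, b, c, d, by push_cast; ring⟩ h₂
  · exact absurd ⟨a, b, c, d, by push_cast; ring⟩ h₁

theorem IsBase.coeff_eq_zero (hz : IsBase n₁ n₂ n₃ n₄ z) {g : ℤ} (hg : InSg n₁ n₂ n₃ n₄ g)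
    {x y : ℕ} (h : z = g + x * n₁ + y * n₂) : x = 0 ∧ y = 0 := by
  refine ⟨?_, ?_⟩ <;> by_contra h0
  · obtain ⟨x, rfl⟩ := Nat.exists_eq_succ_of_ne_zero h0
    refine hz.2.1 ?_
    convert hg.add (InSg.comb₁₂ x y) using 1
    rw [h]; push_cast; ring
  · obtain ⟨y, rfl⟩ := Nat.exists_eq_succ_of_ne_zero h0
    refine hz.2.2 ?_
    convert hg.add (InSg.comb₁₂ x y) using 1
    rw [h]; push_cast; ring

theorem IsBase.of_add {y : ℤ} (hyz : IsBase n₁ n₂ n₃ n₄ (y + z)) (hy : InSg n₁ n₂ n₃ n₄ y)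
    (hz : InSg n₁ n₂ n₃ n₄ z) : IsBase n₁ n₂ n₃ n₄ y := by
  refine ⟨hy, fun h => hyz.2.1 ?_, fun h => hyz.2.2 ?_⟩
  · convert h.add hz using 1; ring
  · convert h.add hz using 1; ring

theorem exists_common_part (a b : ℕ) :
    ∃ t a' b' : ℕ, a = a' + t ∧ b = b' + t ∧ (a' = 0 ∨ b' = 0) :=
  ⟨min a b, a - min a b, b - min a b, by omega, by omega, by omega⟩

namespace SymmetricWithRelation

theorem nonneg (D : SymmetricWithRelation n₁ n₂ n₃ n₄ F q p) (hz : InSg n₁ n₂ n₃ n₄ z) :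
    0 ≤ z := by
  obtain ⟨a, b, c, d, rfl⟩ := hz
  have := D.pos₁; have := D.pos₂; have := D.pos₃; have := D.pos₄
  positivity

theorem exists_base (D : SymmetricWithRelation n₁ n₂ n₃ n₄ F q p) {z : ℤ}
    (hz : InSg n₁ n₂ n₃ n₄ z) :
    ∃ (m : ℤ) (x y : ℕ), IsBase n₁ n₂ n₃ n₄ m ∧ z = m + x * n₁ + y * n₂ := by
  have := D.pos₁
  have := D.pos₂
  by_cases h₁ : InSg n₁ n₂ n₃ n₄ (z - n₁)
  · have := D.nonneg h₁
    obtain ⟨m, x, y, hm, h⟩ := D.exists_base h₁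
    exact ⟨m, x + 1, y, hm, by push_cast; linear_combination h⟩
  by_cases h₂ : InSg n₁ n₂ n₃ n₄ (z - n₂)
  · have := D.nonneg h₂
    obtain ⟨m, x, y, hm, h⟩ := D.exists_base h₂
    exact ⟨m, x, y + 1, hm, by push_cast; linear_combination h⟩
  exact ⟨z, 0, 0, ⟨hz, h₁, h₂⟩, by simp⟩
termination_by z.toNat
decreasing_by all_goals omega

theorem not_inSg_frobenius₁₂ (D : SymmetricWithRelation n₁ n₂ n₃ n₄ F q p) :
    ¬ InSg n₁ n₂ n₃ n₄ (p * n₂ - n₁ - n₂) := by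
  rintro ⟨a, b, c, d, h⟩
  have := D.pos₁; have := D.pos₂; have := D.pos₃; have := D.pos₄
  rcases le_or_gt p (b + 1) with hb | hb
  · obtain ⟨l, hl⟩ := Nat.exists_eq_add_of_le hb
    have hl' : (b : ℤ) + 1 = p + l := by exact_mod_cast hl
    have : (0 : ℤ) = (a + 1) * n₁ + l * n₂ + c * n₃ + d * n₄ := by
      linear_combination h + n₂ * hl'
    have : 0 < (a + 1) * n₁ + l * n₂ + c * n₃ + d * n₄ := by positivity
    omega
  · obtain ⟨l, rfl⟩ := Nat.exists_eq_add_of_lt hb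
    have := D.min₂ (l + 1) (a + 1) c d (by omega) (by push_cast at h ⊢; linear_combination h)
    omega

/-- The largest element of `H` not divisible by `n₁` or `n₂`. -/
theorem isBase_top (D : SymmetricWithRelation n₁ n₂ n₃ n₄ F q p) :
    IsBase n₁ n₂ n₃ n₄ (F - (p * n₂ - n₁ - n₂)) := by
  obtain ⟨p', hp⟩ := Nat.exists_eq_add_of_lt D.p_pos
  obtain ⟨q', hq⟩ := Nat.exists_eq_add_of_lt D.q_pos
  have hr := D.rel
  refine ⟨?_, ?_, ?_⟩ <;> rw [D.symm]
  · convert D.not_inSg_frobenius₁₂ using 2; ring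
  · rw [not_not]
    refine ⟨0, p', 0, 0, ?_⟩
    subst hp; push_cast; ring
  · rw [not_not]
    refine ⟨q', 0, 0, 0, ?_⟩
    subst hq; push_cast at hr ⊢; linear_combination -hr

theorem base_eq_of_rel (D : SymmetricWithRelation n₁ n₂ n₃ n₄ F q p) (u : ℕ) :
    ∀ (v : ℕ) (g₁ g₂ : ℤ), IsBase n₁ n₂ n₃ n₄ g₁ → IsBase n₁ n₂ n₃ n₄ g₂ → 0 < u → 0 < v →
      g₁ + u * n₁ = g₂ + v * n₂ → g₁ = g₂ := by
  induction u using Nat.strong_induction_on with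
  | _ u ih =>
  intro v g₁ g₂ hg₁ hg₂ hu hv huv
  by_contra hne
  have hr := D.rel
  have huq : u < q := by
    by_contra hq
    obtain ⟨k, rfl⟩ := Nat.exists_eq_add_of_le (not_lt.1 hq)
    rcases le_or_gt v p with hvp | hvp
    · obtain ⟨l, hl⟩ := Nat.exists_eq_add_of_le hvp
      have hl' : (p : ℤ) = v + l := by exact_mod_cast hl
      have hE : g₂ = g₁ + k * n₁ + l * n₂ := by
        push_cast at huv; linear_combination -huv + hr + n₂ * hl'
      obtain ⟨rfl, rfl⟩ := hg₂.coeff_eq_zero hg₁.1 hE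
      exact hne (by simpa using hE.symm)
    · obtain ⟨l, rfl⟩ := Nat.exists_eq_add_of_lt hvp
      have hE : g₁ + k * n₁ = g₂ + (l + 1 : ℕ) * n₂ := by
        push_cast at huv ⊢; linear_combination huv - hr
      rcases Nat.eq_zero_or_pos k with rfl | hk
      · have := hg₁.coeff_eq_zero hg₂.1 (x := 0) (y := l + 1) (by simpa using hE)
        omega
      · exact hne (ih k (by have := D.q_pos; omega) _ _ _ hg₁ hg₂ hk (by omega) hE)
  have hvp : v < p := by
    by_contra hp
    obtain ⟨k, rfl⟩ := Nat.exists_eq_add_of_le (not_lt.1 hp)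
    obtain ⟨l, rfl⟩ := Nat.exists_eq_add_of_lt huq
    have := hg₁.coeff_eq_zero hg₂.1 (x := l + 1) (y := k)
      (by push_cast at huv hr ⊢; linear_combination huv - hr)
    omega
  obtain ⟨s, rfl⟩ := Nat.exists_eq_add_of_lt huq
  obtain ⟨r, rfl⟩ := Nat.exists_eq_add_of_lt hvp
  obtain ⟨u, rfl⟩ := Nat.exists_eq_succ_of_ne_zero hu.ne'
  obtain ⟨v, rfl⟩ := Nat.exists_eq_succ_of_ne_zero hv.ne'
  have hw := D.isBase_top
  set w := F - (((v.succ + r + 1 : ℕ) : ℤ) * n₂ - n₁ - n₂) with hw_def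
  push_cast at huv hr hw_def
  -- Cancelling common factors, we may assume that `g₁` and `g₂` are coprime monomials.
  obtain ⟨c₁, e₁, h₁⟩ := hg₁.exists_comb
  obtain ⟨c₂, e₂, h₂⟩ := hg₂.exists_comb
  obtain ⟨c, c₁, c₂, rfl, rfl, hc⟩ := exists_common_part c₁ c₂
  obtain ⟨e, e₁, e₂, rfl, rfl, he⟩ := exists_common_part e₁ e₂
  obtain ⟨f₁, hf₁⟩ : ∃ f : ℤ, f = c₁ * n₃ + e₁ * n₄ := ⟨_, rfl⟩
  obtain ⟨f₂, hf₂⟩ : ∃ f : ℤ, f = c₂ * n₃ + e₂ * n₄ := ⟨_, rfl⟩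
  have hgf₁ : g₁ = f₁ + (c * n₃ + e * n₄) := by rw [h₁, hf₁]; push_cast; ring
  have hgf₂ : g₂ = f₂ + (c * n₃ + e * n₄) := by rw [h₂, hf₂]; push_cast; ring
  have b₁ : IsBase n₁ n₂ n₃ n₄ f₁ :=
    (hgf₁ ▸ hg₁).of_add (hf₁ ▸ InSg.comb₃₄ _ _) (InSg.comb₃₄ _ _)
  have b₂ : IsBase n₁ n₂ n₃ n₄ f₂ :=
    (hgf₂ ▸ hg₂).of_add (hf₂ ▸ InSg.comb₃₄ _ _) (InSg.comb₃₄ _ _)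
  have hf : f₁ + (u + 1) * n₁ = f₂ + (v + 1) * n₂ := by
    rw [hgf₁, hgf₂] at huv; linear_combination huv
  -- The complementary element `y` satisfies `f₁ + y = w + (s + 1) n₁`, `f₂ + y = w + (r + 1) n₂`.
  have hz : InSg n₁ n₂ n₃ n₄ (w + (s + 1) * n₁ - f₁) := by
    rw [D.symm]
    intro h
    obtain ⟨g, x, y, hg, hE⟩ := D.exists_base h
    have hE' : f₁ + u * n₁ = g + x * n₁ + (y + 1) * n₂ := by
      linear_combination hE + hw_def + hr
    rcases le_or_gt u x with hx | hx
    · obtain ⟨l, rfl⟩ := Nat.exists_eq_add_of_le hx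
      have := b₁.coeff_eq_zero hg.1 (x := l) (y := y + 1)
        (by push_cast at hE' ⊢; linear_combination hE')
      omega
    · obtain ⟨l, rfl⟩ := Nat.exists_eq_add_of_lt hx
      have hE'' : f₁ + (l + 1 : ℕ) * n₁ = g + (y + 1 : ℕ) * n₂ := by
        push_cast at hE' ⊢; linear_combination hE'
      have := ih (l + 1) (by omega) (y + 1) f₁ g b₁ hg (by omega) (by omega) hE''
      have := D.min₁ (l + 1) (y + 1) 0 0 (by omega) (by
        push_cast at hE'' ⊢; linear_combination hE'' - this)
      omega
  obtain ⟨y, hy⟩ : ∃ y, y = w + (s + 1) * n₁ - f₁ := ⟨_, rfl⟩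
  rw [← hy] at hz
  have hy' : y = w + (r + 1) * n₂ - f₂ := by linear_combination hy - hf + hr
  have hyb : IsBase n₁ n₂ n₃ n₄ y := by
    refine ⟨hz, fun h => ?_, fun h => ?_⟩ <;> refine (D.symm _).1 h ?_
    · convert b₂.1.add (InSg.comb₁₂ 0 v) using 1
      push_cast; linear_combination -hy' - hw_def
    · convert b₁.1.add (InSg.comb₁₂ u 0) using 1
      push_cast; linear_combination -hy - hw_def - hr
  have nwf₁ : ¬ InSg n₁ n₂ n₃ n₄ (w - f₁) := fun h => by
    refine (D.symm _).1 (h.add b₂.1) ?_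
    convert InSg.comb₁₂ (n₃ := n₃) (n₄ := n₄) s v using 1
    linear_combination -hw_def + hf - hr
  have nwf₂ : ¬ InSg n₁ n₂ n₃ n₄ (w - f₂) := fun h => by
    refine (D.symm _).1 (h.add b₁.1) ?_
    convert InSg.comb₁₂ (n₃ := n₃) (n₄ := n₄) u r using 1
    linear_combination -hw_def - hf
  have nwy : ¬ InSg n₁ n₂ n₃ n₄ (w - y) := fun h => by
    have := b₁.coeff_eq_zero h (x := s + 1) (y := 0) (by push_cast; linear_combination hy)
    omega
  obtain ⟨a, b, hab⟩ := hw.exists_comb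
  obtain ⟨i, j, hij⟩ := hyb.exists_comb
  have ndvd : ∀ c e : ℕ, ¬ InSg n₁ n₂ n₃ n₄ (w - (c * n₃ + e * n₄)) → a < c ∨ b < e := by
    intro c e h
    by_contra! h'
    obtain ⟨k, rfl⟩ := Nat.exists_eq_add_of_le h'.1
    obtain ⟨l, rfl⟩ := Nat.exists_eq_add_of_le h'.2
    exact h ⟨0, 0, k, l, by rw [hab]; push_cast; ring⟩
  have d₁ := ndvd _ _ (hf₁ ▸ nwf₁)
  have d₂ := ndvd _ _ (hf₂ ▸ nwf₂)
  have d₃ := ndvd _ _ (hij ▸ nwy)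
  have d₄ : i + c₁ < a ∨ j + e₁ < b := by
    by_contra! h
    obtain ⟨k, hk⟩ := Nat.exists_eq_add_of_le h.1
    obtain ⟨l, hl⟩ := Nat.exists_eq_add_of_le h.2
    have hk' : (i : ℤ) + c₁ = a + k := by exact_mod_cast hk
    have hl' : (j : ℤ) + e₁ = b + l := by exact_mod_cast hl
    have := D.min₁ (s + 1) 0 k l (by omega) (by
      push_cast; linear_combination -hy + hij + hf₁ - hab + n₃ * hk' + n₄ * hl')
    omega
  have d₅ : i + c₂ < a ∨ j + e₂ < b := by
    by_contra! h
    obtain ⟨k, hk⟩ := Nat.exists_eq_add_of_le h.1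
    obtain ⟨l, hl⟩ := Nat.exists_eq_add_of_le h.2
    have hk' : (i : ℤ) + c₂ = a + k := by exact_mod_cast hk
    have hl' : (j : ℤ) + e₂ = b + l := by exact_mod_cast hl
    have := D.min₂ (r + 1) 0 k l (by omega) (by
      push_cast; linear_combination -hy' + hij + hf₂ - hab + n₃ * hk' + n₄ * hl')
    omega
  omega

theorem base_unique (D : SymmetricWithRelation n₁ n₂ n₃ n₄ F q p) {m m' : ℤ}
    (hm : IsBase n₁ n₂ n₃ n₄ m) (hm' : IsBase n₁ n₂ n₃ n₄ m') {x y x' y' : ℕ}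
    (h : m + x * n₁ + y * n₂ = m' + x' * n₁ + y' * n₂) : m = m' := by
  obtain ⟨k, x, x', rfl, rfl, hx⟩ := exists_common_part x x'
  obtain ⟨l, y, y', rfl, rfl, hy⟩ := exists_common_part y y'
  have h : m + x * n₁ + y * n₂ = m' + x' * n₁ + y' * n₂ := by
    push_cast at h; linear_combination h
  rcases hx with rfl | rfl <;> rcases hy with rfl | rfl
  · have h : m = m' + x' * n₁ + y' * n₂ := by simpa using h
    obtain ⟨rfl, rfl⟩ := hm.coeff_eq_zero hm'.1 h
    simpa using h
  · rcases Nat.eq_zero_or_pos x' with rfl | hx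
    · have h : m' = m + (0 : ℕ) * n₁ + y * n₂ := by simpa using h.symm
      obtain ⟨-, rfl⟩ := hm'.coeff_eq_zero hm.1 h
      simpa using h.symm
    rcases Nat.eq_zero_or_pos y with rfl | hy
    · have h : m = m' + x' * n₁ + (0 : ℕ) * n₂ := by simpa using h
      obtain ⟨rfl, -⟩ := hm.coeff_eq_zero hm'.1 h
      simpa using h
    exact (D.base_eq_of_rel x' y m' m hm' hm hx hy (by simpa using h.symm)).symm
  · rcases Nat.eq_zero_or_pos x with rfl | hx
    · have h : m = m' + (0 : ℕ) * n₁ + y' * n₂ := by simpa using h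
      obtain ⟨-, rfl⟩ := hm.coeff_eq_zero hm'.1 h
      simpa using h
    rcases Nat.eq_zero_or_pos y' with rfl | hy
    · have h : m' = m + x * n₁ + (0 : ℕ) * n₂ := by simpa using h.symm
      obtain ⟨rfl, -⟩ := hm'.coeff_eq_zero hm.1 h
      simpa using h.symm
    exact D.base_eq_of_rel x y' m m' hm hm' hx hy (by simpa using h)
  · have h : m' = m + x * n₁ + y * n₂ := by simpa using h.symm
    obtain ⟨rfl, rfl⟩ := hm'.coeff_eq_zero hm.1 h
    simpa using h.symm

theorem inSg_top_sub (D : SymmetricWithRelation n₁ n₂ n₃ n₄ F q p)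
    (hz : IsBase n₁ n₂ n₃ n₄ z) : InSg n₁ n₂ n₃ n₄ (F - (p * n₂ - n₁ - n₂) - z) := by
  rw [D.symm]
  intro h
  obtain ⟨m, x, y, hm, hE⟩ := D.exists_base h
  have hzm : z = m := D.base_unique hz hm (x := 0) (y := p) (x' := x + 1) (y' := y + 1)
    (by push_cast; linear_combination hE)
  exact D.not_inSg_frobenius₁₂ ⟨x, y, 0, 0, by push_cast; linear_combination hE - hzm⟩

theorem exists_comb_of_not_isBase (D : SymmetricWithRelation n₁ n₂ n₃ n₄ F q p) {i j : ℕ}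
    (h : ¬ IsBase n₁ n₂ n₃ n₄ (i * n₃ + j * n₄)) : ∃ x y i' j' : ℕ, 0 < x + y ∧
      (i * n₃ + j * n₄ : ℤ) = x * n₁ + y * n₂ + i' * n₃ + j' * n₄ := by
  obtain ⟨m, x, y, hm, hE⟩ := D.exists_base (InSg.comb₃₄ i j)
  obtain ⟨i', j', rfl⟩ := hm.exists_comb
  refine ⟨x, y, i', j', ?_, by rw [hE]; ring⟩
  by_contra h0
  obtain ⟨rfl, rfl⟩ : x = 0 ∧ y = 0 := by omega
  exact h (by rw [hE]; simpa using hm)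

/-- If the monomials in `x₃, x₄` whose degree is divisible by `n₁` or `n₂` can be rewritten using
`x₁` or `x₂`, and the other ones are determined by their degrees, then all monomials are determined
by their degrees. -/
theorem monomial_eq {Q : Type*} [CommMonoid Q] {x₁ x₂ x₃ x₄ : Q}
    (D : SymmetricWithRelation n₁ n₂ n₃ n₄ F q p) (h₁₂ : x₁ ^ q = x₂ ^ p)
    (hred : ∀ i j : ℕ, ¬ IsBase n₁ n₂ n₃ n₄ (i * n₃ + j * n₄) → ∃ x y i' j' : ℕ, 0 < x + y ∧
      (i * n₃ + j * n₄ : ℤ) = x * n₁ + y * n₂ + i' * n₃ + j' * n₄ ∧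
      x₃ ^ i * x₄ ^ j = x₁ ^ x * x₂ ^ y * x₃ ^ i' * x₄ ^ j')
    (huniq : ∀ i j i' j' : ℕ, IsBase n₁ n₂ n₃ n₄ (i * n₃ + j * n₄) →
      (i * n₃ + j * n₄ : ℤ) = i' * n₃ + j' * n₄ → x₃ ^ i * x₄ ^ j = x₃ ^ i' * x₄ ^ j')
    {a b c d a' b' c' d' : ℕ}
    (h : (a * n₁ + b * n₂ + c * n₃ + d * n₄ : ℤ) = a' * n₁ + b' * n₂ + c' * n₃ + d' * n₄) :
    x₁ ^ a * x₂ ^ b * x₃ ^ c * x₄ ^ d = x₁ ^ a' * x₂ ^ b' * x₃ ^ c' * x₄ ^ d' := by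
  have normal : ∀ (N i j : ℕ), (i * n₃ + j * n₄ : ℤ) ≤ N → ∃ x y i' j' : ℕ,
      IsBase n₁ n₂ n₃ n₄ (i' * n₃ + j' * n₄) ∧
      (i * n₃ + j * n₄ : ℤ) = x * n₁ + y * n₂ + i' * n₃ + j' * n₄ ∧
      x₃ ^ i * x₄ ^ j = x₁ ^ x * x₂ ^ y * x₃ ^ i' * x₄ ^ j' := by
    intro N
    induction N using Nat.strong_induction_on with
    | _ N ih =>
    intro i j hN
    by_cases hb : IsBase n₁ n₂ n₃ n₄ (i * n₃ + j * n₄)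
    · exact ⟨0, 0, i, j, hb, by simp, by simp⟩
    obtain ⟨x, y, i', j', hxy, hE, hx⟩ := hred i j hb
    have hpos : 0 < (x * n₁ + y * n₂ : ℤ) := by
      have := D.pos₁
      have := D.pos₂
      rcases Nat.eq_zero_or_pos x with rfl | h0
      · have : 0 < y := by omega
        positivity
      · positivity
    have hnn := D.nonneg (InSg.comb₃₄ i' j')
    obtain ⟨x', y', k, l, hb', hE', hx'⟩ := ih (i' * n₃ + j' * n₄ : ℤ).toNat (by omega) i' j'
      (by omega)
    refine ⟨x + x', y + y', k, l, hb', by push_cast; linear_combination hE + hE', ?_⟩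
    rw [hx, mul_assoc, hx', pow_add, pow_add]
    simp only [mul_assoc, mul_left_comm]
  obtain ⟨x, y, i, j, hb, hE, hx⟩ := normal (c * n₃ + d * n₄ : ℤ).toNat c d (by omega)
  obtain ⟨x', y', i', j', hb', hE', hx'⟩ := normal (c' * n₃ + d' * n₄ : ℤ).toNat c' d' (by omega)
  have hbase := D.base_unique hb hb' (x := a + x) (y := b + y) (x' := a' + x') (y' := b' + y')
    (by push_cast; linear_combination h - hE + hE')
  have h₃₄ := huniq i j i' j' hb hbase
  have hl := pow_mul_pow_eq_of_comb_eq D.q_pos D.pos₁ D.pos₂ D.rel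
    (fun t s ht h => D.min₁ t s 0 0 ht (by simpa using h)) h₁₂
    (i := a + x) (j := b + y) (i' := a' + x') (j' := b' + y')
    (by push_cast; linear_combination h - hE + hE' - hbase)
  rw [mul_assoc _ (x₃ ^ c), hx, mul_assoc _ (x₃ ^ c'), hx']
  calc _ = x₁ ^ (a + x) * x₂ ^ (b + y) * (x₃ ^ i * x₄ ^ j) := by
        rw [pow_add, pow_add]; simp only [mul_assoc, mul_left_comm]
    _ = x₁ ^ (a' + x') * x₂ ^ (b' + y') * (x₃ ^ i' * x₄ ^ j') := by rw [hl, h₃₄]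
    _ = _ := by
        rw [pow_add, pow_add]; simp only [mul_assoc, mul_left_comm]

end SymmetricWithRelation

/-- The monomials with exponents `r t` and `s t` have the same degree with respect to the weights
`n`, and these relations generate all coincidences of degrees. -/
def PresentedBy.{u} (n : Fin 4 → ℕ) (r s : Fin 3 → Fin 4 → ℕ) : Prop :=
  (∀ t, ∑ i, r t i * n i = ∑ i, s t i * n i) ∧
  ∀ (Q : Type u) [CommMonoid Q] (x : Fin 4 → Q),
    (∀ t, ∏ i, x i ^ r t i = ∏ i, x i ^ s t i) →
    ∀ a b : Fin 4 → ℕ, ∑ i, a i * n i = ∑ i, b i * n i → ∏ i, x i ^ a i = ∏ i, x i ^ b i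

theorem PresentedBy.of_perm.{u} {n : Fin 4 → ℕ} {r s : Fin 3 → Fin 4 → ℕ}
    (e : Equiv.Perm (Fin 4)) (h : PresentedBy.{u} (n ∘ e) r s) :
    PresentedBy.{u} n (fun t => r t ∘ e.symm) (fun t => s t ∘ e.symm) := by
  have hsum : ∀ a : Fin 4 → ℕ, ∑ i, a i * n i = ∑ i, (a ∘ e) i * (n ∘ e) i :=
    fun a => (Equiv.sum_comp e fun i => a i * n i).symm
  refine ⟨fun t => ?_, fun Q _ x hx a b hab => ?_⟩
  · rw [hsum, hsum]
    simpa [Function.comp_assoc] using h.1 t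
  · have hprod : ∀ a : Fin 4 → ℕ, ∏ i, x i ^ a i = ∏ i, (x ∘ e) i ^ (a ∘ e) i :=
      fun a => (Equiv.prod_comp e fun i => x i ^ a i).symm
    rw [hprod, hprod]
    refine h.2 Q (x ∘ e) (fun t => ?_) _ _ (by rw [← hsum, ← hsum, hab])
    have := hx t
    rw [hprod, hprod] at this
    simpa [Function.comp_assoc] using this

theorem SymmetricWithRelation.presentedBy.{u} {n : Fin 4 → ℕ}
    (D : SymmetricWithRelation (n 0) (n 1) (n 2) (n 3) F q p) :
    ∃ r s, PresentedBy.{u} n r s := by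
  obtain ⟨w, hw⟩ : ∃ w, w = F - (p * n 1 - n 0 - n 1) := ⟨_, rfl⟩
  have hwb := D.isBase_top
  have hws := fun z => D.inSg_top_sub (z := z)
  rw [← hw] at hwb hws
  have isBase_iff : ∀ i j : ℕ, IsBase (n 0) (n 1) (n 2) (n 3) (i * n 2 + j * n 3) ↔
      ∃ k l : ℕ, w = (i + k : ℕ) * n 2 + (j + l : ℕ) * n 3 := by
    refine fun i j => ⟨fun h => ?_, ?_⟩
    · have hs := hws _ h
      have hb : IsBase (n 0) (n 1) (n 2) (n 3) (w - (i * n 2 + j * n 3)) := by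
        refine IsBase.of_add (z := i * n 2 + j * n 3) (by simpa using hwb) hs h.1
      obtain ⟨k, l, h'⟩ := hb.exists_comb
      exact ⟨k, l, by push_cast; linear_combination h'⟩
    · rintro ⟨k, l, rfl⟩
      refine IsBase.of_add (z := k * n 2 + l * n 3) ?_ (InSg.comb₃₄ _ _) (InSg.comb₃₄ _ _)
      convert hwb using 1
      push_cast; ring
  have hr : q * n 0 = p * n 1 := by exact_mod_cast D.rel
  obtain ⟨a, b, hab⟩ := hwb.exists_comb
  by_cases huniq : ∀ i j : ℕ, w = i * n 2 + j * n 3 → i = a ∧ j = b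
  · have hbox : ∀ i j : ℕ, IsBase (n 0) (n 1) (n 2) (n 3) (i * n 2 + j * n 3) ↔
        i ≤ a ∧ j ≤ b := by
      refine fun i j => (isBase_iff i j).trans ⟨?_, fun h => ⟨a - i, b - j, ?_⟩⟩
      · rintro ⟨k, l, h⟩
        have := huniq _ _ h
        omega
      · rw [Nat.add_sub_cancel' h.1, Nat.add_sub_cancel' h.2, hab]
    obtain ⟨x, y, i, j, hxy, hE⟩ := D.exists_comb_of_not_isBase (i := a + 1) (j := 0)
      (by rw [hbox]; omega)
    obtain ⟨x', y', i', j', hxy', hE'⟩ := D.exists_comb_of_not_isBase (i := 0) (j := b + 1)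
      (by rw [hbox]; omega)
    refine ⟨![![q, 0, 0, 0], ![0, 0, a + 1, 0], ![0, 0, 0, b + 1]],
      ![![0, p, 0, 0], ![x, y, i, j], ![x', y', i', j']], fun t => ?_, ?_⟩
    · fin_cases t <;> simp [Fin.sum_univ_four]
      · exact hr
      · zify; simpa using hE
      · zify; simpa using hE'
    intro Q _ X hX A B hAB
    have hX₀ : X 0 ^ q = X 1 ^ p := by simpa [Fin.prod_univ_four] using hX 0
    have hX₁ : X 2 ^ (a + 1) = X 0 ^ x * X 1 ^ y * X 2 ^ i * X 3 ^ j := by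
      simpa [Fin.prod_univ_four] using hX 1
    have hX₂ : X 3 ^ (b + 1) = X 0 ^ x' * X 1 ^ y' * X 2 ^ i' * X 3 ^ j' := by
      simpa [Fin.prod_univ_four] using hX 2
    simp only [Fin.sum_univ_four, Fin.prod_univ_four] at hAB ⊢
    refine D.monomial_eq hX₀ (fun k l hkl => ?_) (fun k l k' l' hkl h => ?_)
      (by exact_mod_cast hAB)
    · rw [hbox] at hkl
      by_cases hk : k ≤ a
      · obtain ⟨m, rfl⟩ := Nat.exists_eq_add_of_lt (not_le.1 fun hl => hkl ⟨hk, hl⟩)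
        refine ⟨x', y', k + i', m + j', hxy', ?_, ?_⟩
        · push_cast at hE' ⊢; linear_combination hE'
        · rw [show b + m + 1 = (b + 1) + m by ring, pow_add _ _ m, hX₂, pow_add, pow_add]
          simp only [mul_assoc, mul_left_comm, mul_comm]
      · obtain ⟨m, rfl⟩ := Nat.exists_eq_add_of_lt (not_le.1 hk)
        refine ⟨x, y, m + i, l + j, hxy, ?_, ?_⟩
        · push_cast at hE ⊢; linear_combination hE
        · rw [show a + m + 1 = (a + 1) + m by ring, pow_add _ _ m, hX₁, pow_add, pow_add]
          simp only [mul_assoc, mul_left_comm, mul_comm]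
    · obtain ⟨m, o, hm⟩ := (isBase_iff k l).1 hkl
      have h₁ := huniq _ _ hm
      have h₂ := huniq (k' + m) (l' + o) (by push_cast at hm ⊢; linear_combination hm + h)
      rw [show k = k' by omega, show l = l' by omega]
  · have hex : ∃ t : ℕ, 0 < t ∧ (∃ s : ℕ, t * n 2 = s * n 3) ∧ ∃ i j : ℕ,
        w = (i + t : ℕ) * n 2 + j * n 3 := by
      push Not at huniq
      obtain ⟨i, j, hij, hne⟩ := huniq
      have h₂ := D.pos₃
      have h₃ := D.pos₄
      have hE : i * n 2 + j * n 3 = a * n 2 + b * n 3 := by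
        zify; rw [← hij, ← hab]
      rcases lt_trichotomy i a with h | rfl | h
      · obtain ⟨t, rfl⟩ := Nat.exists_eq_add_of_lt h
        have hbj : b ≤ j := by
          by_contra hbj
          have : i * n 2 ≤ (i + t + 1) * n 2 := Nat.mul_le_mul_right _ (by omega)
          have : j * n 3 < b * n 3 := Nat.mul_lt_mul_of_pos_right (by omega) (by omega)
          omega
        obtain ⟨s, rfl⟩ := Nat.exists_eq_add_of_le hbj
        exact ⟨t + 1, by omega, ⟨s, by linarith⟩, i, b, by rw [hab]; push_cast; ring⟩
      · have : j = b := Nat.eq_of_mul_eq_mul_right (by omega : 0 < n 3) (by omega)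
        exact absurd this (hne rfl)
      · obtain ⟨t, rfl⟩ := Nat.exists_eq_add_of_lt h
        have hbj : j ≤ b := by
          by_contra hbj
          have : a * n 2 ≤ (a + t + 1) * n 2 := Nat.mul_le_mul_right _ (by omega)
          have : b * n 3 < j * n 3 := Nat.mul_lt_mul_of_pos_right (by omega) (by omega)
          omega
        obtain ⟨s, rfl⟩ := Nat.exists_eq_add_of_le hbj
        exact ⟨t + 1, by omega, ⟨s, by linarith⟩, a, j, by rw [hij]; push_cast; ring⟩
    obtain ⟨t, ht, ⟨s', hs'⟩, i, j, hij⟩ := hex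
    have hex : ∃ c : ℕ, 0 < c ∧ ∃ e : ℕ, c * n 2 = e * n 3 := ⟨t, ht, s', hs'⟩
    classical
    obtain ⟨c, hc, hcmin⟩ : ∃ c : ℕ, (0 < c ∧ ∃ e : ℕ, c * n 2 = e * n 3) ∧
        ∀ t s : ℕ, 0 < t → (t * n 2 : ℤ) = s * n 3 → c ≤ t :=
      ⟨Nat.find hex, Nat.find_spec hex, fun t s ht h => Nat.find_min' hex
        ⟨ht, s, by exact_mod_cast h⟩⟩
    obtain ⟨hc, e, hce⟩ := hc
    have hceZ : (c * n 2 : ℤ) = e * n 3 := by exact_mod_cast hce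
    have he : 0 < e := by
      have := D.pos₃
      by_contra h0
      obtain rfl : e = 0 := by omega
      have : 0 < c * n 2 := Nat.mul_pos hc (by omega)
      omega
    -- A factorization of the top element with small last exponent.
    obtain ⟨i, j, hij, hj⟩ : ∃ i j : ℕ, w = (i + c : ℕ) * n 2 + j * n 3 ∧ j < e := by
      obtain ⟨k, rfl⟩ := Nat.exists_eq_add_of_le (hcmin t s' ht (by exact_mod_cast hs'))
      refine ⟨i + k + j / e * c, j % e, ?_, Nat.mod_lt _ he⟩
      have := congrArg (Nat.cast : ℕ → ℤ) (Nat.mod_add_div j e)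
      push_cast at this hij ⊢
      linear_combination hij - n 3 * this - (j / e) * hceZ
    have hred : ∀ k l : ℕ, ¬ IsBase (n 0) (n 1) (n 2) (n 3) (k * n 2 + l * n 3) → ∃ k' l' : ℕ,
        (k * n 2 + l * n 3 : ℤ) = (i + 1 + k' : ℕ) * n 2 + (j + 1 + l' : ℕ) * n 3 := by
      intro k l hkl
      obtain ⟨k', l', hl', hE⟩ : ∃ k' l' : ℕ, l' < e ∧
          (k * n 2 + l * n 3 : ℤ) = k' * n 2 + l' * n 3 := by
        refine ⟨k + l / e * c, l % e, Nat.mod_lt _ he, ?_⟩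
        have := congrArg (Nat.cast : ℕ → ℤ) (Nat.mod_add_div l e)
        push_cast at this ⊢
        linear_combination - n 3 * this - (l / e) * hceZ
      rw [hE, isBase_iff] at hkl
      rcases le_or_gt l' j with hl | hl
      · obtain ⟨l, rfl⟩ := Nat.exists_eq_add_of_le hl
        rcases le_or_gt k' (i + c) with hk | hk
        · obtain ⟨o, ho⟩ := Nat.exists_eq_add_of_le hk
          exact absurd ⟨o, l, by rw [hij, ho]⟩ hkl
        · obtain ⟨o, rfl⟩ := Nat.exists_eq_add_of_lt hk
          obtain ⟨e', rfl⟩ := Nat.exists_eq_add_of_lt hj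
          refine ⟨o, l' + e', ?_⟩
          rw [hE]
          push_cast at hceZ ⊢
          linear_combination hceZ
      · obtain ⟨l, rfl⟩ := Nat.exists_eq_add_of_lt hl
        rcases le_or_gt k' i with hk | hk
        · obtain ⟨o, rfl⟩ := Nat.exists_eq_add_of_le hk
          obtain ⟨e', rfl⟩ := Nat.exists_eq_add_of_lt hl'
          refine absurd ⟨o, j + e' + 1, ?_⟩ hkl
          rw [hij]
          push_cast at hceZ ⊢
          linear_combination hceZ
        · obtain ⟨o, rfl⟩ := Nat.exists_eq_add_of_lt hk
          exact ⟨o, l, by rw [hE]; push_cast; ring⟩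
    have hcorner : ¬ IsBase (n 0) (n 1) (n 2) (n 3) ((i + 1 : ℕ) * n 2 + (j + 1 : ℕ) * n 3) := by
      rw [isBase_iff]
      rintro ⟨k, l, hkl⟩
      have h₃ := D.pos₃
      have h₄ := D.pos₄
      obtain ⟨c, rfl⟩ := Nat.exists_eq_add_of_lt hc
      rcases le_or_gt k c with hk | hk
      · obtain ⟨o, rfl⟩ := Nat.exists_eq_add_of_le hk
        rcases Nat.eq_zero_or_pos o with rfl | ho
        · have : ((l + 1) * n 3 : ℤ) = 0 := by
            push_cast at hkl hij; linear_combination hij - hkl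
          have : 0 < ((l + 1) * n 3 : ℤ) := by positivity
          omega
        · have := hcmin o (l + 1) ho (by push_cast at hkl hij ⊢; linear_combination hkl - hij)
          omega
      · obtain ⟨o, rfl⟩ := Nat.exists_eq_add_of_lt hk
        have : ((o + 1) * n 2 + (l + 1) * n 3 : ℤ) = 0 := by
          push_cast at hkl hij; linear_combination hij - hkl
        have : 0 < ((o + 1) * n 2 + (l + 1) * n 3 : ℤ) := by positivity
        omega
    obtain ⟨x, y, i', j', hxy, hE⟩ := D.exists_comb_of_not_isBase hcorner
    refine ⟨![![q, 0, 0, 0], ![0, 0, c, 0], ![0, 0, i + 1, j + 1]],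
      ![![0, p, 0, 0], ![0, 0, 0, e], ![x, y, i', j']], fun t => ?_, ?_⟩
    · fin_cases t <;> simp [Fin.sum_univ_four]
      · exact hr
      · exact hce
      · zify; simpa using hE
    intro Q _ X hX A B hAB
    have hX₀ : X 0 ^ q = X 1 ^ p := by simpa [Fin.prod_univ_four] using hX 0
    have hX₁ : X 2 ^ c = X 3 ^ e := by simpa [Fin.prod_univ_four] using hX 1
    have hX₂ : X 2 ^ (i + 1) * X 3 ^ (j + 1) = X 0 ^ x * X 1 ^ y * X 2 ^ i' * X 3 ^ j' := by
      simpa [Fin.prod_univ_four] using hX 2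
    have hX₃ : ∀ k l k' l' : ℕ, (k * n 2 + l * n 3 : ℤ) = k' * n 2 + l' * n 3 →
        X 2 ^ k * X 3 ^ l = X 2 ^ k' * X 3 ^ l' := fun k l k' l' h =>
      pow_mul_pow_eq_of_comb_eq hc D.pos₃ D.pos₄ hceZ hcmin hX₁ h
    simp only [Fin.sum_univ_four, Fin.prod_univ_four] at hAB ⊢
    refine D.monomial_eq hX₀ (fun k l hkl => ?_) (fun k l k' l' _ h => hX₃ k l k' l' h)
      (by exact_mod_cast hAB)
    obtain ⟨k', l', h⟩ := hred k l hkl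
    refine ⟨x, y, k' + i', l' + j', hxy, ?_, ?_⟩
    · rw [h]; push_cast at hE ⊢; linear_combination hE
    · rw [hX₃ _ _ _ _ h, pow_add, pow_add _ _ l', mul_mul_mul_comm, hX₂, pow_add, pow_add]
      simp only [mul_assoc, mul_left_comm, mul_comm]

end Core

theorem IsNumericalSemigroup.exists_add_mem_PF {H : Set ℕ} (hH : IsNumericalSemigroup H) {z : ℤ}
    (hz : z ∉ ((Nat.cast : ℕ → ℤ) '' H)) : ∃ h ∈ H, z + (h : ℤ) ∈ PF H := by
  obtain ⟨h0, hadd, hfin⟩ := hH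
  set T : Set ℕ := {h | h ∈ H ∧ z + (h : ℤ) ∉ ((Nat.cast : ℕ → ℤ) '' H)} with hT
  have hTfin : T.Finite := by
    obtain ⟨B, hB⟩ := hfin.bddAbove
    refine (Set.finite_Iic (B + z.natAbs)).subset fun h hh => ?_
    by_contra hlt
    simp only [Set.mem_Iic, not_le] at hlt
    have hmem : (z + h).toNat ∈ H := by
      by_contra hn
      have := hB hn
      omega
    exact hh.2 ⟨_, hmem, by omega⟩
  obtain ⟨h, hh, hmax⟩ := hTfin.exists_maximal ⟨0, h0, by simpa using hz⟩
  refine ⟨h, hh.1, hh.2, fun h' hh' hpos => ?_⟩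
  by_contra hn
  have := hmax (y := h + h') ⟨hadd _ hh.1 _ hh', by push_cast; rwa [← add_assoc]⟩ (by simp)
  omega

theorem IsNumericalSemigroup.exists_symmetry {H : Set ℕ} (hH : IsNumericalSemigroup H)
    (hsym : (PF H).ncard = 1) : ∃ F : ℤ, ∀ z : ℤ,
      z ∈ ((Nat.cast : ℕ → ℤ) '' H) ↔ F - z ∉ ((Nat.cast : ℕ → ℤ) '' H) := by
  obtain ⟨F, hF⟩ := Set.ncard_eq_one.1 hsym
  have hFH : F ∉ ((Nat.cast : ℕ → ℤ) '' H) := (show F ∈ PF H by rw [hF]; rfl).1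
  refine ⟨F, fun z => ⟨?_, fun hz => ?_⟩⟩
  · rintro ⟨a, ha, rfl⟩ ⟨b, hb, h⟩
    exact hFH ⟨a + b, hH.2.1 a ha b hb, by push_cast; linear_combination h⟩
  · by_contra hz'
    obtain ⟨h, hh, hPF⟩ := hH.exists_add_mem_PF hz'
    rw [hF, Set.mem_singleton_iff] at hPF
    exact hz ⟨h, hh, by linear_combination hPF⟩

theorem PresentedBy.span_eq_ker.{u} {n : Fin 4 → ℕ} {r s : Fin 3 → Fin 4 → ℕ}
    (h : PresentedBy.{u} n r s) (k : Type u) [Field k] :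
    Ideal.span (Set.range fun t => (∏ i, MvPolynomial.X i ^ r t i - ∏ i, MvPolynomial.X i ^ s t i :
      MvPolynomial (Fin 4) k)) = RingHom.ker (MvPolynomial.aeval
        (fun i => (Polynomial.X : Polynomial k) ^ n i) :
        MvPolynomial (Fin 4) k →ₐ[k] Polynomial k) := by
  have hX : ∀ a : Fin 4 → ℕ, MvPolynomial.aeval (fun i => (Polynomial.X : Polynomial k) ^ n i)
      (∏ i, MvPolynomial.X i ^ a i : MvPolynomial (Fin 4) k) =
        Polynomial.X ^ ∑ i, a i * n i := by
    intro a
    simp [map_prod, ← pow_mul, Finset.prod_pow_eq_pow_sum, mul_comm]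
  set J := Ideal.span (Set.range fun t => (∏ i, MvPolynomial.X i ^ r t i -
    ∏ i, MvPolynomial.X i ^ s t i : MvPolynomial (Fin 4) k)) with hJ
  refine le_antisymm ?_ fun f hf => ?_
  · rw [hJ, Ideal.span_le]
    rintro _ ⟨t, rfl⟩
    simp only [SetLike.mem_coe, RingHom.mem_ker, map_sub, hX, h.1 t, sub_self]
  have hJX : ∀ a b : Fin 4 → ℕ, ∑ i, a i * n i = ∑ i, b i * n i →
      Ideal.Quotient.mk J (∏ i, MvPolynomial.X i ^ a i) =
        Ideal.Quotient.mk J (∏ i, MvPolynomial.X i ^ b i) := by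
    intro a b hab
    have := h.2 (MvPolynomial (Fin 4) k ⧸ J) (fun i => Ideal.Quotient.mk J (MvPolynomial.X i))
      (fun t => ?_) a b hab
    · simpa [map_prod] using this
    · have : Ideal.Quotient.mk J (∏ i, MvPolynomial.X i ^ r t i) =
          Ideal.Quotient.mk J (∏ i, MvPolynomial.X i ^ s t i) :=
        Ideal.Quotient.eq.2 (Ideal.subset_span ⟨t, rfl⟩)
      simpa [map_prod] using this
  -- A linear left inverse, modulo `J`, of the parametrization.
  classical
  let σ : ℕ → MvPolynomial (Fin 4) k ⧸ J := fun d =>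
    if hd : ∃ a : Fin 4 → ℕ, ∑ i, a i * n i = d then
      Ideal.Quotient.mk J (∏ i, MvPolynomial.X i ^ hd.choose i) else 0
  let ψ : Polynomial k →ₗ[k] MvPolynomial (Fin 4) k ⧸ J :=
    (Polynomial.basisMonomials k).constr k σ
  have hψ : ∀ d, ψ (Polynomial.X ^ d) = σ d := fun d => by
    rw [← (Polynomial.basisMonomials k).constr_basis k σ d, Polynomial.coe_basisMonomials,
      Polynomial.X_pow_eq_monomial]
  have hcomp : ψ ∘ₗ (MvPolynomial.aeval (fun i => (Polynomial.X : Polynomial k) ^ n i) :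
      MvPolynomial (Fin 4) k →ₐ[k] Polynomial k).toLinearMap =
      (Ideal.Quotient.mkₐ k J).toLinearMap := by
    refine (MvPolynomial.basisMonomials (Fin 4) k).ext fun a => ?_
    have ha : MvPolynomial.basisMonomials (Fin 4) k a = ∏ i, MvPolynomial.X i ^ a i := by
      rw [MvPolynomial.coe_basisMonomials]
      beta_reduce
      rw [MvPolynomial.monomial_eq, map_one, one_mul,
        Finsupp.prod_fintype _ _ (by simp)]
    have hd : ∃ b : Fin 4 → ℕ, ∑ i, b i * n i = ∑ i, a i * n i := ⟨a, rfl⟩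
    simp only [ha, LinearMap.comp_apply, AlgHom.toLinearMap_apply, hX, hψ, σ, dif_pos hd,
      Ideal.Quotient.mkₐ_eq_mk]
    exact hJX _ _ hd.choose_spec
  have := LinearMap.congr_fun hcomp f
  simp only [LinearMap.comp_apply, AlgHom.toLinearMap_apply, (RingHom.mem_ker).1 hf, map_zero,
    Ideal.Quotient.mkₐ_eq_mk] at this
  exact Ideal.Quotient.eq_zero_iff_mem.1 this.symm

theorem exists_perm_map_zero_one (i j : Fin 4) (hij : i ≠ j) :
    ∃ e : Equiv.Perm (Fin 4), e 0 = i ∧ e 1 = j := by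
  revert i j
  decide

/-- Bresinsky's Lemma 2: for symmetric `H = ⟨n₁,n₂,n₃,n₄⟩` with
`I_H` not generated by `3` elements and `α_i` the least positive integer with
`α_i n_i ∈ ⟨n_j : j ≠ i⟩`, we have `α_i n_i ≠ α_j n_j` for `i ≠ j`. -/
theorem stmt7 (n : Fin 4 → ℕ) (H : Set ℕ)
    (hH : IsNumericalSemigroup H)
    (hsym : (PF H).ncard = 1)
    (hgen : H = {m | ∃ a : Fin 4 → ℕ, m = ∑ i, a i * n i})
    (hmin : ∀ j : Fin 4, {m | ∃ a : Fin 4 → ℕ, a j = 0 ∧ m = ∑ i, a i * n i} ≠ H)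
    (k : Type*) [Field k]
    (hnotCI : ¬ ∃ g : Fin 3 → MvPolynomial (Fin 4) k,
      Ideal.span (Set.range g) = RingHom.ker (MvPolynomial.aeval
        (fun i => (Polynomial.X : Polynomial k) ^ n i) :
        MvPolynomial (Fin 4) k →ₐ[k] Polynomial k))
    (α : Fin 4 → ℕ)
    (hα : ∀ i : Fin 4, 0 < α i ∧
      (∃ a : Fin 4 → ℕ, a i = 0 ∧ α i * n i = ∑ j, a j * n j) ∧
      ∀ β : ℕ, 0 < β → (∃ a : Fin 4 → ℕ, a i = 0 ∧ β * n i = ∑ j, a j * n j) →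
        α i ≤ β) :
    ∀ i j : Fin 4, i ≠ j → α i * n i ≠ α j * n j := by
  intro i j hij heq
  obtain ⟨e, rfl, rfl⟩ := exists_perm_map_zero_one i j hij
  have hpos : ∀ t, 0 < n t := by
    intro t
    by_contra h0
    refine hmin t ?_
    rw [hgen]
    ext m
    refine ⟨fun ⟨a, _, h⟩ => ⟨a, h⟩, fun ⟨a, h⟩ => ⟨Function.update a t 0, by simp, ?_⟩⟩
    rw [h]
    refine Finset.sum_congr rfl fun l _ => ?_
    rcases eq_or_ne l t with rfl | hl
    · simp [show n l = 0 by omega]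
    · rw [Function.update_of_ne hl]
  have hsum : ∀ a : Fin 4 → ℕ, ∑ t, a t * n t = a (e 0) * n (e 0) + a (e 1) * n (e 1) +
      a (e 2) * n (e 2) + a (e 3) * n (e 3) := fun a => by
    rw [← Equiv.sum_comp e, Fin.sum_univ_four]
  have hmem : ∀ z : ℤ, InSg (n (e 0)) (n (e 1)) (n (e 2)) (n (e 3)) z ↔
      z ∈ ((Nat.cast : ℕ → ℤ) '' H) := by
    intro z
    rw [hgen]
    constructor
    · rintro ⟨a, b, c, d, rfl⟩
      exact ⟨_, ⟨![a, b, c, d] ∘ e.symm, rfl⟩, by rw [hsum]; simp⟩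
    · rintro ⟨_, ⟨a, rfl⟩, rfl⟩
      exact ⟨a (e 0), a (e 1), a (e 2), a (e 3), by rw [hsum]; push_cast; rfl⟩
  obtain ⟨F, hF⟩ := hH.exists_symmetry hsym
  have D : SymmetricWithRelation ((n ∘ e) 0) ((n ∘ e) 1) ((n ∘ e) 2) ((n ∘ e) 3) F
      (α (e 0)) (α (e 1)) :=
    { pos₁ := by exact_mod_cast hpos _
      pos₂ := by exact_mod_cast hpos _
      pos₃ := by exact_mod_cast hpos _
      pos₄ := by exact_mod_cast hpos _
      symm := fun z => by simpa only [Function.comp_apply, hmem] using hF z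
      rel := by exact_mod_cast heq
      q_pos := (hα _).1
      p_pos := (hα _).1
      min₁ := fun t b c d ht h => (hα _).2.2 t ht ⟨![0, b, c, d] ∘ e.symm, by simp, by
        rw [hsum]; zify; simpa using h⟩
      min₂ := fun t a c d ht h => (hα _).2.2 t ht ⟨![a, 0, c, d] ∘ e.symm, by simp, by
        rw [hsum]; zify; simpa using h⟩ }
  obtain ⟨r, s, hrs⟩ := D.presentedBy
  exact hnotCI ⟨_, (hrs.of_perm e).span_eq_ker k⟩
end

section
/- Let e > 1 be an integer, c ≥ 2 an even integer, and set n_1 = e + c, n_2 = e + c + 1, and n_i = (c² + (e+2)c + 2(i−1))/2 for 3 ≤ i ≤ e, with H = ⟨n_1,…,n_e⟩. Then the Apéry set of H with respect to n_1 = e + c is Ap(H, e+c) = {j·n_2 : 0 ≤ j ≤ c+1} ∪ {n_3, n_4, …, n_e}, and this set has exactly e + c elements. -/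
/-- For `H = H_{e,c}`, the least `q` such that `q * (e + c) + r` lies in `H`, where `r < e + c`. -/
def aperyQuotient (c r : ℕ) : ℕ := if r ≤ c + 1 then r else c / 2

theorem eq_and_eq_of_mul_add_eq {m q r q' r' : ℕ} (hr : r < m) (hr' : r' < m)
    (h : q * m + r = q' * m + r') : q = q' ∧ r = r' := by
  have hm : 0 < m := by omega
  have hq : q = q' := by
    have := congrArg (· / m) h
    simpa [Nat.mul_add_div, Nat.mul_comm _ m, hm, Nat.div_eq_of_lt hr, Nat.div_eq_of_lt hr']
      using this
  subst hq
  exact ⟨rfl, by omega⟩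

/-- A predicate that holds at `0` and is stable under adding each `n i` holds at every
natural combination of the `n i`. -/
theorem sum_mul_induction {ι : Type*} [Fintype ι] (n : ι → ℕ) (P : ℕ → Prop) (h0 : P 0)
    (hadd : ∀ x i, P x → P (x + n i)) (a : ι → ℕ) : P (∑ i, a i * n i) := by
  classical
  have hmul : ∀ x i t, P x → P (x + t * n i) := by
    intro x i t hx
    induction t with
    | zero => simpa using hx
    | succ t ih => simpa [Nat.succ_mul, add_assoc] using hadd _ i ih
  have hsum : ∀ s : Finset ι, P (∑ i ∈ s, a i * n i) := by
    intro s
    induction s using Finset.induction_on with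
    | empty => simpa using h0
    | insert i s hi ih =>
      rw [Finset.sum_insert hi, add_comm]
      exact hmul _ _ _ ih
  exact hsum Finset.univ

theorem exists_sum_mul_eq_iff {e c : ℕ} (he : 1 < e) (hceven : Even c) {n : Fin e → ℕ}
    (hn0 : ∀ i : Fin e, (i : ℕ) = 0 → n i = e + c)
    (hn1 : ∀ i : Fin e, (i : ℕ) = 1 → n i = e + c + 1)
    (hn : ∀ i : Fin e, 2 ≤ (i : ℕ) → n i = c / 2 * (e + c) + (c + i)) (x : ℕ) :
    (∃ a : Fin e → ℕ, x = ∑ i, a i * n i) ↔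
      ∃ q r, r < e + c ∧ aperyQuotient c r ≤ q ∧ x = q * (e + c) + r := by
  obtain ⟨d, rfl⟩ := hceven
  have hd : (d + d) / 2 = d := by omega
  rw [hd] at hn
  constructor
  · rintro ⟨a, rfl⟩
    refine sum_mul_induction n
      (fun x => ∃ q r, r < e + (d + d) ∧ aperyQuotient (d + d) r ≤ q ∧ x = q * (e + (d + d)) + r)
      ⟨0, 0, by omega, by simp [aperyQuotient], by simp⟩ ?_ a
    rintro _ i ⟨q, r, hr, hq, rfl⟩
    have hi := i.isLt
    rcases lt_trichotomy (i : ℕ) 1 with h | h | h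
    · refine ⟨q + 1, r, hr, by omega, ?_⟩
      rw [hn0 i (by omega)]
      ring
    · rw [hn1 i h]
      by_cases hr' : r + 1 < e + (d + d)
      · refine ⟨q + 1, r + 1, hr', ?_, by ring⟩
        unfold aperyQuotient at *
        split_ifs at * <;> omega
      · refine ⟨q + 2, 0, by omega, by simp [aperyQuotient], ?_⟩
        rw [show e + (d + d) + 1 = r + 1 + 1 by omega, show e + (d + d) = r + 1 by omega]
        ring
    · rw [hn i h]
      by_cases hr' : r + (d + d + i) < e + (d + d)
      · refine ⟨q + d, r + (d + d + i), hr', ?_, by ring⟩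
        unfold aperyQuotient at *
        split_ifs at * <;> omega
      · obtain ⟨s, hs⟩ := Nat.exists_eq_add_of_le (not_lt.mp hr')
        refine ⟨q + d + 1, s, by omega, ?_, by linarith⟩
        unfold aperyQuotient at *
        split_ifs at * <;> omega
  · rintro ⟨q, r, hr, hq, rfl⟩
    unfold aperyQuotient at hq
    have hcomb : ∀ (i j : Fin e) (s t : ℕ), ∃ a : Fin e → ℕ,
        s * n i + t * n j = ∑ k, a k * n k := fun i j s t =>
      ⟨Pi.single i s + Pi.single j t, by
        simp [add_mul, Finset.sum_add_distrib, Pi.single_apply, ite_mul]⟩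
    split_ifs at hq with h
    · obtain ⟨s, rfl⟩ := Nat.exists_eq_add_of_le hq
      convert hcomb ⟨0, by omega⟩ ⟨1, by omega⟩ s r using 3
      rw [hn0 _ rfl, hn1 _ rfl]
      ring
    · rw [hd] at hq
      obtain ⟨s, rfl⟩ := Nat.exists_eq_add_of_le hq
      obtain ⟨k, rfl⟩ := Nat.exists_eq_add_of_le (show d + d ≤ r by omega)
      convert hcomb ⟨0, by omega⟩ ⟨k, by omega⟩ s 1 using 3
      rw [hn0 _ rfl, hn _ (show 2 ≤ k by omega)]
      ring

/-- for `H = H_{e,c}` with `c ≥ 2` even, the Apéry set of `H`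
with respect to `n₁ = e+c` is `{j·n₂ : 0 ≤ j ≤ c+1} ∪ {n₃, …, n_e}`, and it
has exactly `e + c` elements. -/
theorem stmt14 (e c : ℕ) (he : 1 < e) (hc : 2 ≤ c) (hceven : Even c)
    (n : Fin e → ℕ)
    (hn0 : ∀ i : Fin e, (i : ℕ) = 0 → n i = e + c)
    (hn1 : ∀ i : Fin e, (i : ℕ) = 1 → n i = e + c + 1)
    (hni : ∀ i : Fin e, 2 ≤ (i : ℕ) →
      2 * n i = c ^ 2 + (e + 2) * c + 2 * (i : ℕ))
    (H : Set ℕ) (hH : H = {m | ∃ a : Fin e → ℕ, m = ∑ i, a i * n i}) :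
    {a ∈ H | ¬ ∃ b ∈ H, b + (e + c) = a} =
      ({x | ∃ j : ℕ, j ≤ c + 1 ∧ x = j * n (⟨1, by omega⟩ : Fin e)} ∪
        {x | ∃ i : Fin e, 2 ≤ (i : ℕ) ∧ x = n i}) ∧
    ({a ∈ H | ¬ ∃ b ∈ H, b + (e + c) = a}).ncard = e + c := by
  have hn : ∀ i : Fin e, 2 ≤ (i : ℕ) → n i = c / 2 * (e + c) + (c + i) := by
    intro i hi
    have h := hni i hi
    obtain ⟨d, rfl⟩ := hceven
    rw [show (d + d) / 2 = d by omega]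
    linarith
  have hmem : ∀ x, x ∈ H ↔ ∃ q r, r < e + c ∧ aperyQuotient c r ≤ q ∧ x = q * (e + c) + r := by
    intro x
    rw [hH]
    exact exists_sum_mul_eq_iff he hceven hn0 hn1 hn x
  have hap : {a ∈ H | ¬ ∃ b ∈ H, b + (e + c) = a} =
      (fun r => aperyQuotient c r * (e + c) + r) '' (Finset.range (e + c) : Set ℕ) := by
    ext x
    simp only [Set.mem_ofPred_eq, Set.mem_image, Finset.coe_range, Set.mem_Iio]
    constructor
    · rintro ⟨hx, hb⟩
      obtain ⟨q, r, hr, hq, rfl⟩ := (hmem x).1 hx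
      refine ⟨r, hr, ?_⟩
      obtain hq | hq := hq.eq_or_lt
      · rw [hq]
      · obtain ⟨p, rfl⟩ := Nat.exists_eq_add_of_lt hq
        exact absurd ⟨_, (hmem _).2 ⟨_, r, hr, Nat.le_add_right _ p, rfl⟩, by ring⟩ hb
    · rintro ⟨r, hr, rfl⟩
      refine ⟨(hmem _).2 ⟨_, r, hr, le_rfl, rfl⟩, ?_⟩
      rintro ⟨b, hb, h⟩
      obtain ⟨q, s, hs, hq, rfl⟩ := (hmem b).1 hb
      obtain ⟨h₁, rfl⟩ := eq_and_eq_of_mul_add_eq (q := q + 1) hs hr (by linarith)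
      omega
  constructor
  · rw [hap]
    ext x
    simp only [Set.mem_image, Finset.coe_range, Set.mem_Iio, Set.mem_union, Set.mem_ofPred_eq]
    rw [hn1 _ rfl]
    constructor
    · rintro ⟨r, hr, rfl⟩
      by_cases h : r ≤ c + 1
      · exact Or.inl ⟨r, h, by simp only [aperyQuotient, if_pos h]; ring⟩
      · refine Or.inr ⟨⟨r - c, by omega⟩, by simp only; omega, ?_⟩
        rw [hn _ (by simp only; omega), aperyQuotient, if_neg h]
        simp only
        omega
    · rintro (⟨j, hj, rfl⟩ | ⟨i, hi, rfl⟩)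
      · exact ⟨j, by omega, by simp only [aperyQuotient, if_pos hj]; ring⟩
      · refine ⟨c + i, by omega, ?_⟩
        rw [hn i hi, aperyQuotient, if_neg (by omega)]
  · rw [hap, Set.InjOn.ncard_image, Set.ncard_coe_finset, Finset.card_range]
    intro r hr s hs h
    rw [Finset.coe_range, Set.mem_Iio] at hr hs
    exact (eq_and_eq_of_mul_add_eq hr hs h).2
end

section
/- Let H be a numerical semigroup minimally generated by n_1,…,n_e, let k be a field, and suppose the defining ideal I_H ⊆ S = k[x_1,…,x_e] is generated by e − 1 elements g_1, …, g_{e−1} (so k[H] is a complete intersection). Then for every subset T ⊆ {1,…,e} with #T = p ≥ 1, the number of indices i ∈ {1,…,e−1} such that g_i belongs to the ideal of S generated by the variables {x_j : j ∈ T} is at most p − 1. -/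
open MvPolynomial in
/-- The kernel of the constant coefficient is contained in any ideal containing all variables. -/
theorem MvPolynomial.ker_constantCoeff_le {σ R : Type*} [CommRing R] {J : Ideal (MvPolynomial σ R)}
    (hJ : ∀ i, (X i : MvPolynomial σ R) ∈ J) :
    RingHom.ker (constantCoeff : MvPolynomial σ R →+* R) ≤ J := by
  intro f hf
  have hspan : f ∈ Ideal.span ((X : σ → MvPolynomial σ R) '' Set.univ) := by
    rw [mem_ideal_span_X_image]
    intro m hm
    by_contra! h
    have hm0 : m = 0 := Finsupp.ext fun i => h i (Set.mem_univ i)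
    subst hm0
    exact mem_support_iff.mp hm hf
  refine Ideal.span_le.mpr ?_ hspan
  rintro _ ⟨i, -, rfl⟩
  exact hJ i

open MvPolynomial in
/-- The ideal of polynomials vanishing after setting the first `r` variables to zero has height
at least `r`. -/
theorem MvPolynomial.le_height_ker_aeval_ite {e : ℕ} (k : Type*) [Field k] (r : ℕ) (hr : r ≤ e) :
    (r : ℕ∞) ≤ (RingHom.ker (aeval (fun i : Fin e => if i.1 < r then 0 else X i) :
      MvPolynomial (Fin e) k →ₐ[k] MvPolynomial (Fin e) k)).height := by
  induction r with
  | zero => simp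
  | succ r ih =>
    let φ (r : ℕ) : MvPolynomial (Fin e) k →ₐ[k] MvPolynomial (Fin e) k :=
      aeval (fun i : Fin e => if i.1 < r then 0 else X i)
    have hcomp : (φ (r + 1)).comp (φ r) = φ (r + 1) := by
      ext1 i
      by_cases hi : i.1 < r
      · simp [φ, hi, show i.1 < r + 1 by lia, -Order.lt_add_one_iff]
      · simp [φ, hi]
    have hlt : RingHom.ker (φ r) < RingHom.ker (φ (r + 1)) := by
      refine lt_of_le_of_ne (fun f hf => ?_) fun heq => ?_
      · rw [RingHom.mem_ker] at hf ⊢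
        rw [← hcomp, AlgHom.comp_apply, hf, map_zero]
      · have hmem : (X ⟨r, hr⟩ : MvPolynomial (Fin e) k) ∈ RingHom.ker (φ (r + 1)) := by
          simp [φ, RingHom.mem_ker]
        rw [← heq] at hmem
        simp [φ, RingHom.mem_ker] at hmem
    have hprime : (RingHom.ker (φ r)).IsPrime := RingHom.ker_isPrime _
    have hprime' : (RingHom.ker (φ (r + 1))).IsPrime := RingHom.ker_isPrime _
    push_cast
    calc (r : ℕ∞) + 1 ≤ (RingHom.ker (φ r)).height + 1 := by
          gcongr
          exact ih (by lia)
      _ ≤ (RingHom.ker (φ (r + 1))).height := Ideal.height_add_one_le_of_lt_of_isPrime hlt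

open MvPolynomial in
theorem MvPolynomial.le_height_ker_constantCoeff {e : ℕ} (k : Type*) [Field k] :
    (e : ℕ∞) ≤ (RingHom.ker (constantCoeff : MvPolynomial (Fin e) k →+* k)).height := by
  refine (le_height_ker_aeval_ite k e le_rfl).trans (Ideal.height_mono fun f hf => ?_)
  have h0 : (fun i : Fin e => if i.1 < e then (0 : MvPolynomial (Fin e) k) else X i) = 0 := by
    ext1 i
    simp
  rw [RingHom.mem_ker, h0, aeval_zero] at hf
  exact C_injective (Fin e) k (by simpa [algebraMap_eq] using hf)

open MvPolynomial in
/-- By Krull's height theorem, a proper ideal whose radical is the ideal of the variables needs at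
least as many generators as there are variables. -/
theorem MvPolynomial.le_ncard_of_X_mem_of_span_le {e : ℕ} {k : Type*} [Field k]
    {s : Set (MvPolynomial (Fin e) k)} (hs : s.Finite) (hs0 : ∀ f ∈ s, constantCoeff f = 0)
    (hX : ∀ J : Ideal (MvPolynomial (Fin e) k), J.IsPrime → Ideal.span s ≤ J →
      ∀ i, (X i : MvPolynomial (Fin e) k) ∈ J) :
    e ≤ s.ncard := by
  have hmin : RingHom.ker (constantCoeff : MvPolynomial (Fin e) k →+* k) ∈
      (Ideal.span s).minimalPrimes :=
    ⟨⟨RingHom.ker_isPrime _, Ideal.span_le.mpr hs0⟩,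
      fun J hJ _ => ker_constantCoeff_le (hX J hJ.1 hJ.2)⟩
  exact_mod_cast (le_height_ker_constantCoeff k).trans
    (Ideal.height_le_card_of_mem_minimalPrimes_span hs hmin)

open MvPolynomial in
theorem MvPolynomial.constantCoeff_eq_zero_of_aeval_X_pow_eq_zero {σ k : Type*} [Field k]
    {n : σ → ℕ} (hn : ∀ i, n i ≠ 0) {f : MvPolynomial σ k}
    (hf : aeval (fun i => (Polynomial.X : Polynomial k) ^ n i) f = 0) :
    constantCoeff f = 0 := by
  have hcomp : (Polynomial.aeval (0 : k)).comp
      (aeval (fun i => (Polynomial.X : Polynomial k) ^ n i)) = aeval (0 : σ → k) := by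
    ext1 i
    simp [hn i]
  have h := DFunLike.congr_fun hcomp f
  rw [AlgHom.comp_apply, hf, map_zero, aeval_zero] at h
  simpa using h.symm


/-- Watanabe's Lemma 2: if `I_H` is generated by `e−1` elements
`g₁,…,g_{e−1}`, then for every set `T` of `p ≥ 1` variables, at most `p−1` of
the `gᵢ` belong to the ideal generated by the variables in `T`. -/
theorem stmt18 {e : ℕ} (n : Fin e → ℕ) (H : Set ℕ)
    (hH : IsNumericalSemigroup H)
    (hgen : H = {m | ∃ a : Fin e → ℕ, m = ∑ i, a i * n i})
    (hmin : ∀ j : Fin e, {m | ∃ a : Fin e → ℕ, a j = 0 ∧ m = ∑ i, a i * n i} ≠ H)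
    (k : Type*) [Field k]
    (g : Fin (e - 1) → MvPolynomial (Fin e) k)
    (hg : Ideal.span (Set.range g) = RingHom.ker (MvPolynomial.aeval
      (fun i => (Polynomial.X : Polynomial k) ^ n i) :
      MvPolynomial (Fin e) k →ₐ[k] Polynomial k)) :
    ∀ T : Finset (Fin e), 1 ≤ T.card →
      {i : Fin (e - 1) | g i ∈ Ideal.span
          ((fun j => (MvPolynomial.X j : MvPolynomial (Fin e) k)) '' ↑T)}.ncard ≤
        T.card - 1 := by
  open MvPolynomial in
  intro T hT
  have hn : ∀ j, n j ≠ 0 := by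
    intro j hj
    refine hmin j ?_
    rw [hgen]
    ext m
    constructor
    · rintro ⟨a, -, ha⟩
      exact ⟨a, ha⟩
    · rintro ⟨a, rfl⟩
      refine ⟨Function.update a j 0, by simp, Finset.sum_congr rfl fun i _ => ?_⟩
      rcases eq_or_ne i j with rfl | hij
      · simp [hj]
      · simp [hij]
  obtain ⟨t, ht⟩ := Finset.card_pos.mp hT
  set V : Set (MvPolynomial (Fin e) k) := (fun j => X j) '' (T : Set (Fin e)) with hV
  set B : Set (Fin (e - 1)) := {i | g i ∈ Ideal.span V}
  have hs0 : ∀ f ∈ V ∪ g '' Bᶜ, constantCoeff f = 0 := by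
    rintro _ (⟨j, -, rfl⟩ | ⟨i, -, rfl⟩)
    · simp
    · refine constantCoeff_eq_zero_of_aeval_X_pow_eq_zero hn ?_
      rw [← RingHom.mem_ker, ← hg]
      exact Ideal.subset_span (Set.mem_range_self i)
  have hcard : e ≤ (V ∪ g '' Bᶜ).ncard := by
    refine le_ncard_of_X_mem_of_span_le (Set.toFinite _) hs0 fun J hJ hle j => ?_
    have hVJ : Ideal.span V ≤ J := (Ideal.span_mono Set.subset_union_left).trans hle
    have hgJ : Ideal.span (Set.range g) ≤ J := by
      rw [Ideal.span_le]
      rintro _ ⟨i, rfl⟩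
      by_cases hi : i ∈ B
      · exact hVJ hi
      · exact hle (Ideal.subset_span (Or.inr ⟨i, hi, rfl⟩))
    have hbin : (X j ^ n t - X t ^ n j : MvPolynomial (Fin e) k) ∈ J := by
      refine hgJ ?_
      rw [hg, RingHom.mem_ker]
      simp [← pow_mul, mul_comm]
    have hXt : (X t : MvPolynomial (Fin e) k) ∈ J := hVJ (Ideal.subset_span ⟨t, ht, rfl⟩)
    exact hJ.mem_of_pow_mem _ ((J.sub_mem_iff_left
      (Ideal.pow_mem_of_mem J hXt _ (Nat.pos_of_ne_zero (hn j)))).mp hbin)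
  have hVcard : V.ncard ≤ T.card := by
    simpa using Set.ncard_image_le (f := fun j => (X j : MvPolynomial (Fin e) k)) T.finite_toSet
  have hBcard : B.ncard + Bᶜ.ncard = e - 1 := by
    simpa using Set.ncard_add_ncard_compl B
  have hunion := Set.ncard_union_le V (g '' Bᶜ)
  have himage : (g '' Bᶜ).ncard ≤ Bᶜ.ncard := Set.ncard_image_le
  have he : 0 < e := t.pos
  lia
end
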